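/- Let (H, α, β, ·, Δ, ε) be a Hopf algebroid over R, F a twistor of H, and H_F the twisted Hopf algebroid over R_F. Let P_{H_F} and P_H be the non-symmetric operads associated with H_F and H respectively. Then the family of K-linear maps F♯_n : P_{H_F}(n) → P_H(n), x₁⊗_{R_F}⋯⊗_{R_F}x_n ↦ F{F{⋯F{F{x₁, x₂}, x₃}⋯}, x_n}, is an isomorphism of non-symmetric operads: each F♯_n is a K-linear bijection, F♯₁ is the identity of H (in particular F♯(1) = 1), and F♯(γ_{H_F}(h; u₁,…,u_n)) = γ_H(F♯h; F♯u₁,…,F♯u_n) for all h ∈ P_{H_F}(n) and u_i ∈ P_{H_F}(k_i). Moreover F♯(1⊗_{R_F}1) = F, so F♯ sends the multiplication 1⊗_{R_F}1 ∈ P_{H_F}(2) to the multiplication F ∈ P_H(2). -/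

import Mathlib

/-! # Preliminaries: Hopf algebroids in the sense of Xu

We fix a field `K` of characteristic zero, an associative unital `K`-algebra `R` and an
associative unital `K`-algebra `H`.  We construct the `n`-fold tensor powers
`H^{⊗_K n}` of `H` over `K` and, given source and target maps `α, β : R → H`, the
quotients `H^{⊗_R n}` of `H^{⊗_K n}` by the right ideal `I_n` generated by the elements
`1 ⊗ ⋯ ⊗ β(r) ⊗ 1 ⊗ ⋯ ⊗ 1 − 1 ⊗ ⋯ ⊗ 1 ⊗ α(r) ⊗ ⋯ ⊗ 1`.

A Hopf algebroid is then given by the data `(H, α, β, ·, Δ, ε)` subject to the axioms of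
Xu; the iterated coproducts `Δⁿ = (Δ^{n−1} ⊗_R id) ∘ Δ` are part of the data, uniquely
characterized by their recursion.  All axioms involving maps induced on the quotients
`H^{⊗_R n}` are stated equivalently in terms of (arbitrary) lifts along the quotient
maps and (arbitrary) presentations of elements as sums of pure tensors. -/

noncomputable section

open scoped TensorProduct

universe u

variable (K : Type u) [Field K] [CharZero K]

/-- A bundled associative unital `K`-algebra. -/
structure BAlg : Type (u + 1) where
  carrier : Type u
  [isRing : Ring carrier]
  [isAlgebra : Algebra K carrier]

attribute [instance] BAlg.isRing BAlg.isAlgebra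

instance : CoeSort (BAlg K) (Type u) := ⟨BAlg.carrier⟩

variable (H : Type u) [Ring H] [Algebra K H]

/-- The `n`-fold tensor power `H^{⊗_K n}` of `H` over `K` (with `H^{⊗_K 0} = K` and
`H^{⊗_K 1} = H`), as a bundled `K`-algebra. -/
def TPa : ℕ → BAlg K
  | 0 => ⟨K⟩
  | 1 => ⟨H⟩
  | (n + 2) => ⟨(TPa (n + 1)) ⊗[K] H⟩

/-- The `n`-fold tensor power `H^{⊗_K n}`. -/
abbrev TP (n : ℕ) : Type u := TPa K H n

/-- The element of `H^{⊗_K n}` with `h` in slot `i` (`0`-indexed) and `1` in all other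
slots. -/
def slotP : (n : ℕ) → ℕ → H → TP K H n
  | 0, _, _ => 1
  | 1, _, h => h
  | (n + 2), i, h =>
      if i = n + 1 then ((1 : TP K H (n + 1)) ⊗ₜ[K] h : TP K H (n + 1) ⊗[K] H)
      else ((slotP (n + 1) i h) ⊗ₜ[K] (1 : H) : TP K H (n + 1) ⊗[K] H)

/-- The pure tensor `x₀ ⊗ x₁ ⊗ ⋯ ⊗ x_{n-1} ∈ H^{⊗_K n}`, written as the product of its
slot components. -/
def chainP (n : ℕ) (x : Fin n → H) : TP K H n :=
  (List.ofFn (fun i : Fin n => slotP K H n (i : ℕ) (x i))).prod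

variable {R : Type u} [Ring R] [Algebra K R]

/-- The relator `1 ⊗ ⋯ ⊗ β(r) ⊗ 1 ⊗ ⋯ ⊗ 1 − 1 ⊗ ⋯ ⊗ 1 ⊗ α(r) ⊗ ⋯ ⊗ 1` with `β(r)` in
slot `i` and `α(r)` in slot `i + 1` (`0`-indexed). -/
def relator (αf βf : R → H) (n : ℕ) (r : R) (i : ℕ) : TP K H n :=
  slotP K H n i (βf r) - slotP K H n (i + 1) (αf r)

/-- The right ideal `I_n ⊆ H^{⊗_K n}` generated by the relators. -/
def Idl (αf βf : R → H) (n : ℕ) : Submodule K (TP K H n) :=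
  Submodule.span K
    {z | ∃ (r : R) (i : ℕ) (x : TP K H n), i + 2 ≤ n ∧ z = relator K H αf βf n r i * x}

/-- The `n`-fold tensor power `H^{⊗_R n} := H^{⊗_K n} / I_n` of `H` over `R`
(`H^{⊗_R 1} = H` and, by convention, `H^{⊗_R 0} = R` is treated separately). -/
abbrev QT (αf βf : R → H) (n : ℕ) : Type u := TP K H n ⧸ Idl K H αf βf n

/-- The quotient map `H^{⊗_K n} → H^{⊗_R n}`. -/
abbrev qtMk (αf βf : R → H) (n : ℕ) : TP K H n →ₗ[K] QT K H αf βf n :=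
  (Idl K H αf βf n).mkQ

variable (R)

/-- A Hopf algebroid `(H, α, β, ·, Δ, ε)` over `R`, in the sense of Xu, together with its
(uniquely characterized) iterated coproducts `Δⁿ`.  The source map `α` (an algebra
homomorphism) and the target map `β` (an algebra anti-homomorphism) are taken as
parameters.  All conditions on elements of the quotients `H^{⊗_R n}` are expressed via
arbitrary lifts along the quotient maps. -/
structure HopfAlgebroid (α : R →ₐ[K] H) (β : R →ₗ[K] H) : Type u where
  β_one : β 1 = 1
  /-- `β` is an algebra anti-homomorphism -/
  β_mul : ∀ a b : R, β (a * b) = β b * β a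
  /-- the images of `α` and `β` commute -/
  αβ_comm : ∀ a b : R, α a * β b = β b * α a
  /-- the coproduct -/
  Δ : H →ₗ[K] QT K H (fun a => α a) (fun a => β a) 2
  Δ_one : Δ 1 = qtMk K H (fun a => α a) (fun a => β a) 2 1
  /-- `Δ(x) · (β(a) ⊗ 1 − 1 ⊗ α(a)) = 0` -/
  Δ_compat : ∀ (x : H) (a : R) (s : TP K H 2),
    qtMk K H (fun a => α a) (fun a => β a) 2 s = Δ x →
    qtMk K H (fun a => α a) (fun a => β a) 2
      (s * relator K H (fun a => α a) (fun a => β a) 2 a 0) = 0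
  /-- `Δ(x₁ x₂) = Δ(x₁) · Δ(x₂)` -/
  Δ_mul : ∀ (x y : H) (s t : TP K H 2),
    qtMk K H (fun a => α a) (fun a => β a) 2 s = Δ x →
    qtMk K H (fun a => α a) (fun a => β a) 2 t = Δ y →
    Δ (x * y) = qtMk K H (fun a => α a) (fun a => β a) 2 (s * t)
  /-- `Δ` is a morphism of `(R,R)`-bimodules, left action -/
  Δ_bimod_left : ∀ (a : R) (x : H) (s : TP K H 2),
    qtMk K H (fun a => α a) (fun a => β a) 2 s = Δ x →
    Δ (α a * x) = qtMk K H (fun a => α a) (fun a => β a) 2 (slotP K H 2 0 (α a) * s)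
  /-- `Δ` is a morphism of `(R,R)`-bimodules, right action -/
  Δ_bimod_right : ∀ (a : R) (x : H) (s : TP K H 2),
    qtMk K H (fun a => α a) (fun a => β a) 2 s = Δ x →
    Δ (β a * x) = qtMk K H (fun a => α a) (fun a => β a) 2 (slotP K H 2 1 (β a) * s)
  /-- coassociativity `(Δ ⊗_R id) ∘ Δ = (id ⊗_R Δ) ∘ Δ` -/
  coassoc : ∀ (x : H) (C : ℕ) (uu vv : Fin C → H),
    qtMk K H (fun a => α a) (fun a => β a) 2 (∑ c, (uu c ⊗ₜ[K] vv c : TP K H 2)) = Δ x →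
    ∀ s t : Fin C → TP K H 2,
      (∀ c, qtMk K H (fun a => α a) (fun a => β a) 2 (s c) = Δ (uu c)) →
      (∀ c, qtMk K H (fun a => α a) (fun a => β a) 2 (t c) = Δ (vv c)) →
      qtMk K H (fun a => α a) (fun a => β a) 3 (∑ c, (s c ⊗ₜ[K] vv c : TP K H 3)) =
        qtMk K H (fun a => α a) (fun a => β a) 3
          (∑ c, (TensorProduct.assoc K H H H).symm (uu c ⊗ₜ[K] t c))
  /-- the counit -/
  ε : H →ₗ[K] R
  ε_one : ε 1 = 1
  ε_bimod_left : ∀ (a : R) (x : H), ε (α a * x) = a * ε x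
  ε_bimod_right : ∀ (a : R) (x : H), ε (β a * x) = ε x * a
  /-- `(ε ⊗_R id) ∘ Δ = id` -/
  counit_left : ∀ (x : H) (C : ℕ) (uu vv : Fin C → H),
    qtMk K H (fun a => α a) (fun a => β a) 2 (∑ c, (uu c ⊗ₜ[K] vv c : TP K H 2)) = Δ x →
    ∑ c, α (ε (uu c)) * vv c = x
  /-- `(id ⊗_R ε) ∘ Δ = id` -/
  counit_right : ∀ (x : H) (C : ℕ) (uu vv : Fin C → H),
    qtMk K H (fun a => α a) (fun a => β a) 2 (∑ c, (uu c ⊗ₜ[K] vv c : TP K H 2)) = Δ x →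
    ∑ c, β (ε (vv c)) * uu c = x
  /-- `ker ε` is a left ideal of `H` -/
  ker_ε_ideal : ∀ x y : H, ε y = 0 → ε (x * y) = 0
  /-- the iterated coproducts `Δⁿ : H → H^{⊗_R (n+1)}` -/
  Δpow : ∀ n : ℕ, H →ₗ[K] QT K H (fun a => α a) (fun a => β a) (n + 1)
  Δpow_zero : ∀ x : H, Δpow 0 x = qtMk K H (fun a => α a) (fun a => β a) 1 x
  Δpow_one : Δpow 1 = Δ
  /-- `Δ^{n+1} = (Δⁿ ⊗_R id) ∘ Δ` -/
  Δpow_succ : ∀ (n : ℕ) (x : H) (C : ℕ) (uu vv : Fin C → H),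
    qtMk K H (fun a => α a) (fun a => β a) 2 (∑ c, (uu c ⊗ₜ[K] vv c : TP K H 2)) = Δ x →
    ∀ s : Fin C → TP K H (n + 1),
      (∀ c, qtMk K H (fun a => α a) (fun a => β a) (n + 1) (s c) = Δpow n (uu c)) →
      Δpow (n + 1) x =
        qtMk K H (fun a => α a) (fun a => β a) (n + 2)
          (∑ c, (s c ⊗ₜ[K] vv c : TP K H (n + 2)))

namespace HopfAlgebroid

variable {K H R}
variable {α : R →ₐ[K] H} {β : R →ₗ[K] H} (D : HopfAlgebroid K H R α β)

/-- The left `H`-module structure `h ▷ a := ε(h · α(a))` on `R`. -/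
def hAct (h : H) (a : R) : R := D.ε (h * α a)

end HopfAlgebroid

/-- The sign `(-1)^t` in the field `K`, for an integer exponent `t`. -/
def sgn (K : Type u) [Field K] (t : ℤ) : K := ((((-1 : Kˣ)) ^ t : Kˣ) : K)
/-! ### The graded space `⊕ₙ H^{⊗_R n}` -/

/-- Splicing a pure tensor: replace the slot `i` of `x₀ ⊗ ⋯ ⊗ x_n` by `u ⊗ v`. -/
def spliceAt {H : Type u} {n : ℕ} (x : Fin (n + 1) → H) (i : Fin (n + 1)) (u v : H) :
    Fin (n + 2) → H := fun j =>
  if _ : (j : ℕ) < (i : ℕ) then x ⟨(j : ℕ), by omega⟩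
  else if _ : (j : ℕ) = (i : ℕ) then u
  else if _ : (j : ℕ) = (i : ℕ) + 1 then v
  else x ⟨(j : ℕ) - 1, by have := j.isLt; omega⟩

section GradedSpace

variable (K : Type u) [Field K] [CharZero K]
variable (H : Type u) [Ring H] [Algebra K H]
variable {R : Type u} [Ring R] [Algebra K R]
variable (αf βf : R → H)

/-- The degree-`n` component `P_H(n)` of the graded space `⊕ₙ H^{⊗_R n}[-n]`:
`P_H(0) = R` and `P_H(n) = H^{⊗_R n}` for `n ≥ 1`. -/
@[reducible] def PH : ℕ → Type u
  | 0 => R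
  | (n + 1) => QT K H αf βf (n + 1)

instance PH.instAddCommGroup : ∀ n : ℕ, AddCommGroup (PH K H αf βf n)
  | 0 => inferInstanceAs (AddCommGroup R)
  | (n + 1) => inferInstanceAs (AddCommGroup (QT K H αf βf (n + 1)))

instance PH.instModule : ∀ n : ℕ, Module K (PH K H αf βf n)
  | 0 => inferInstanceAs (Module K R)
  | (n + 1) => inferInstanceAs (Module K (QT K H αf βf (n + 1)))

/-- Transport along an equality of degrees. -/
def phCast {a b : ℕ} (h : a = b) (x : PH K H αf βf a) : PH K H αf βf b := h ▸ x

end GradedSpace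
/-- Inserting a block `b` of length `m + 1` into slot `i` of the pure tensor
`x₀ ⊗ ⋯ ⊗ x_n` (the slot `i` is deleted; it is consumed by the block). -/
def insChain {H : Type u} {n m : ℕ} (i : Fin (n + 1)) (x : Fin (n + 1) → H)
    (b : Fin (m + 1) → H) : Fin (n + (m + 1)) → H := fun j =>
  if h1 : (j : ℕ) < (i : ℕ) then x ⟨(j : ℕ), by omega⟩
  else if h2 : (j : ℕ) < (i : ℕ) + (m + 1) then b ⟨(j : ℕ) - (i : ℕ), by omega⟩
  else x ⟨(j : ℕ) - m, by have := j.isLt; have := i.isLt; omega⟩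
section Shorthands

variable (K : Type u) [Field K] [CharZero K]
variable (H : Type u) [Ring H] [Algebra K H]
variable {R : Type u} [Ring R] [Algebra K R]

/-- Shorthand for the components of `⊕ₙ H^{⊗_R n}[-n]` attached to `(α, β)`. -/
@[reducible] def PHb (α : R →ₐ[K] H) (β : R →ₗ[K] H) : ℕ → Type u :=
  PH K H (fun a => α a) (fun a => β a)

/-- Shorthand for the quotient maps attached to `(α, β)`. -/
@[reducible] def qmk (α : R →ₐ[K] H) (β : R →ₗ[K] H) (n : ℕ) :
    TP K H n →ₗ[K] QT K H (fun a => α a) (fun a => β a) n :=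
  qtMk K H (fun a => α a) (fun a => β a) n

end Shorthands
/-! ### Twistor-type elements: common definitions -/

section TwistorBasics

variable {K : Type u} [Field K] [CharZero K]
variable {H : Type u} [Ring H] [Algebra K H]
variable {R : Type u} [Ring R] [Algebra K R]
variable {α : R →ₐ[K] H} {β : R →ₗ[K] H}

/-- Given a presentation `F = Σ_c (p c) ⊗_R (q c)` of an element of `H ⊗_R H`, the
induced product `a ⋆_F b := (F₁ ▷ a) · (F₂ ▷ b)` on `R`. -/
def starF (D : HopfAlgebroid K H R α β) {C : ℕ} (p q : Fin C → H) (a b : R) : R :=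
  ∑ c, D.hAct (p c) a * D.hAct (q c) b

/-- The twisted source map `α_F(a) := α(F₁ ▷ a) · F₂`. -/
def alphaF (D : HopfAlgebroid K H R α β) {C : ℕ} (p q : Fin C → H) (a : R) : H :=
  ∑ c, α (D.hAct (p c) a) * q c

/-- The twisted target map `β_F(a) := β(F₂ ▷ a) · F₁`. -/
def betaF (D : HopfAlgebroid K H R α β) {C : ℕ} (p q : Fin C → H) (a : R) : H :=
  ∑ c, β (D.hAct (q c) a) * p c

/-- The twistor equation (T1):
`(Δ ⊗_R id)(F) · (F ⊗_R 1) = (id ⊗_R Δ)(F) · (1 ⊗_R F)` in `H^{⊗_R 3}`, expressed via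
a presentation `F = Σ_c (p c) ⊗_R (q c)` and lifts `s c`, `t c` of `Δ(p c)`, `Δ(q c)`. -/
def TwistorEq1 (D : HopfAlgebroid K H R α β) {C : ℕ} (p q : Fin C → H)
    (s t : Fin C → TP K H 2) : Prop :=
  qtMk K H (fun a => α a) (fun a => β a) 3
      ((∑ c, (s c ⊗ₜ[K] q c : TP K H 3)) *
        (∑ c, ((p c ⊗ₜ[K] q c : TP K H 2) ⊗ₜ[K] (1 : H) : TP K H 3))) =
    qtMk K H (fun a => α a) (fun a => β a) 3
      ((∑ c, (TensorProduct.assoc K H H H).symm (p c ⊗ₜ[K] t c)) *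
        (∑ c, (TensorProduct.assoc K H H H).symm ((1 : H) ⊗ₜ[K] (p c ⊗ₜ[K] q c : TP K H 2))))

/-- The counit condition (T2): `(ε ⊗_R id)F = (id ⊗_R ε)F = 1`. -/
def TwistorEq2 (D : HopfAlgebroid K H R α β) {C : ℕ} (p q : Fin C → H) : Prop :=
  (∑ c, α (D.ε (p c)) * q c = 1) ∧ (∑ c, β (D.ε (q c)) * p c = 1)

end TwistorBasics
/-! ### Twistors of Hopf algebroids -/

section Twistors

variable {K : Type u} [Field K] [CharZero K]
variable {H : Type u} [Ring H] [Algebra K H]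
variable {R : Type u} [Ring R] [Algebra K R]

/-- The relations defining `M₁ ⊗_R M₂` for two left `H`-modules `M₁`, `M₂` (with actions
`ρ₁`, `ρ₂`), relative to source/target maps `αf, βf : R → H`. -/
def modRel (K : Type u) [Field K] {H : Type u} [Ring H] [Algebra K H]
    {R : Type u} (αf βf : R → H)
    {M₁ M₂ : Type u} [AddCommGroup M₁] [Module K M₁] [AddCommGroup M₂] [Module K M₂]
    (ρ₁ : H →ₐ[K] Module.End K M₁) (ρ₂ : H →ₐ[K] Module.End K M₂) :
    Submodule K (M₁ ⊗[K] M₂) :=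
  Submodule.span K
    {z | ∃ (r : R) (m : M₁) (m' : M₂),
      z = (ρ₁ (βf r) m) ⊗ₜ[K] m' - m ⊗ₜ[K] (ρ₂ (αf r) m')}

variable {α : R →ₐ[K] H} {β : R →ₗ[K] H}

/-- `F = Σ_c (p c) ⊗_R (q c)` is a **twistor** of the Hopf algebroid `H`: it satisfies
the twistor equation (T1) and the counit condition (T2), and for any two left
`H`-modules `M₁`, `M₂` the induced map `F♯ : M₁ ⊗_{R_F} M₂ → M₁ ⊗_R M₂` is invertible. -/
def IsTwistor (D : HopfAlgebroid K H R α β) {C : ℕ} (p q : Fin C → H) : Prop :=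
  (∃ s t : Fin C → TP K H 2,
    (∀ c, qmk K H α β 2 (s c) = D.Δ (p c)) ∧
    (∀ c, qmk K H α β 2 (t c) = D.Δ (q c)) ∧ TwistorEq1 D p q s t) ∧
  TwistorEq2 D p q ∧
  ∀ (M₁ : Type u) [AddCommGroup M₁] [Module K M₁]
    (M₂ : Type u) [AddCommGroup M₂] [Module K M₂]
    (ρ₁ : H →ₐ[K] Module.End K M₁) (ρ₂ : H →ₐ[K] Module.End K M₂),
    ∃ G : ((M₁ ⊗[K] M₂) ⧸ modRel K (alphaF D p q) (betaF D p q) ρ₁ ρ₂) →ₗ[K]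
        ((M₁ ⊗[K] M₂) ⧸ modRel K (fun a => α a) (fun a => β a) ρ₁ ρ₂),
      (∀ w : M₁ ⊗[K] M₂,
        G (Submodule.Quotient.mk w) =
          Submodule.Quotient.mk (∑ c, TensorProduct.map (ρ₁ (p c)) (ρ₂ (q c)) w)) ∧
      Function.Bijective G

variable (D : HopfAlgebroid K H R α β) {C : ℕ} (p q : Fin C → H)

/-- The family `e n` of lifts of the elements
`E_n = F_{1∧⋯∧n−1,n} ⋯ F_{1∧2,3} · F_{1,2} ∈ H^{⊗_R n}` (with `E₁ = 1`, `E₂ = F`,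
`E_{n+1} = (Δ^{n−1} ⊗_R id)(F) · (E_n ⊗_R 1)`). -/
def IsEChain (e : ∀ n : ℕ, TP K H n) : Prop :=
  (qmk K H α β 1 (e 1) = qmk K H α β 1 1) ∧
  (qmk K H α β 2 (e 2) = qmk K H α β 2 (∑ c, (p c ⊗ₜ[K] q c : TP K H 2))) ∧
  ∀ (n : ℕ) (CP : Fin C → ℕ) (ZP : (c : Fin C) → Fin (CP c) → Fin (n + 1) → H),
    (∀ c, qmk K H α β (n + 1) (∑ d, chainP K H (n + 1) (ZP c d)) = D.Δpow n (p c)) →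
    qmk K H α β (n + 2) (e (n + 2)) =
      qmk K H α β (n + 2)
        ((∑ c, ∑ d : Fin (CP c), chainP K H (n + 2) (Fin.snoc (ZP c d) (q c))) *
          (show TP K H (n + 2) from e (n + 1) ⊗ₜ[K] (1 : H)))

/-- The degreewise components `F♯ : H^{⊗_{R_F} n} → H^{⊗_R n}` of the map `F♯`:
`F♯(x₁ ⊗_{R_F} ⋯ ⊗_{R_F} x_n) = E_n · (x₁ ⊗_R ⋯ ⊗_R x_n)`, and `F♯ = id` in degree 0. -/
def IsFSharp (e : ∀ n : ℕ, TP K H n)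
    (Fs : ∀ n : ℕ, PH K H (alphaF D p q) (betaF D p q) n →ₗ[K]
        PH K H (fun a => α a) (fun a => β a) n) : Prop :=
  (∀ a : R, Fs 0 a = a) ∧
  ∀ (n : ℕ) (x : Fin (n + 1) → H),
    Fs (n + 1) (qtMk K H (alphaF D p q) (betaF D p q) (n + 1) (chainP K H (n + 1) x)) =
      qmk K H α β (n + 1) (e (n + 1) * chainP K H (n + 1) x)

/-- The binary brace operations `F{x, y}` with head the twistor `F`, on the graded space
`⊕ₙ H^{⊗_R n}`: on sums of pure tensors,
`F{x, y} = (−1)^{|x|(|y|−1)} (Δ^{|x|−1} ⊗ Δ^{|y|−1})(F) · (x ⊗_R y)`; insertions of the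
degree-`0` component `R` are absorbed through `α_F`, `β_F` and `⋆_F`. -/
def IsFBrace
    (Fbr : ∀ n m : ℕ, PH K H (fun a => α a) (fun a => β a) n →ₗ[K]
        PH K H (fun a => α a) (fun a => β a) m →ₗ[K]
        PH K H (fun a => α a) (fun a => β a) (n + m)) : Prop :=
  -- main clause: both arguments of degree `≥ 1`
  (∀ (n m : ℕ) (x : Fin (n + 1) → H) (y : Fin (m + 1) → H)
      (CP CQ : Fin C → ℕ)
      (ZP : (c : Fin C) → Fin (CP c) → Fin (n + 1) → H)
      (ZQ : (c : Fin C) → Fin (CQ c) → Fin (m + 1) → H),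
    (∀ c, qmk K H α β (n + 1) (∑ d, chainP K H (n + 1) (ZP c d)) = D.Δpow n (p c)) →
    (∀ c, qmk K H α β (m + 1) (∑ d, chainP K H (m + 1) (ZQ c d)) = D.Δpow m (q c)) →
    Fbr (n + 1) (m + 1)
        (qmk K H α β (n + 1) (chainP K H (n + 1) x))
        (qmk K H α β (m + 1) (chainP K H (m + 1) y)) =
      sgn K (((n : ℤ) + 1) * (m : ℤ)) •
        qmk K H α β ((n + 1) + (m + 1))
          (∑ c, ∑ d : Fin (CP c), ∑ d' : Fin (CQ c),
            chainP K H ((n + 1) + (m + 1))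
              (Fin.append (fun t => ZP c d t * x t) (fun t => ZQ c d' t * y t)))) ∧
  -- left argument of degree `0`: `F{a, y} = (Δ^{|y|−1} α_F(a)) · y`
  (∀ (m : ℕ) (a : R) (y : Fin (m + 1) → H) (CA : ℕ) (ZA : Fin CA → Fin (m + 1) → H),
    qmk K H α β (m + 1) (∑ d, chainP K H (m + 1) (ZA d)) = D.Δpow m (alphaF D p q a) →
    Fbr 0 (m + 1) a (qmk K H α β (m + 1) (chainP K H (m + 1) y)) =
      phCast K H (fun a => α a) (fun a => β a) (a := m + 1) (b := 0 + (m + 1)) (by omega)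
        (qmk K H α β (m + 1) (∑ d, chainP K H (m + 1) (fun t => ZA d t * y t)))) ∧
  -- right argument of degree `0`: `F{x, a} = (−1)^{|x|} (Δ^{|x|−1} β_F(a)) · x`
  (∀ (n : ℕ) (a : R) (x : Fin (n + 1) → H) (CB : ℕ) (ZB : Fin CB → Fin (n + 1) → H),
    qmk K H α β (n + 1) (∑ d, chainP K H (n + 1) (ZB d)) = D.Δpow n (betaF D p q a) →
    Fbr (n + 1) 0 (qmk K H α β (n + 1) (chainP K H (n + 1) x)) a =
      sgn K ((n : ℤ) + 1) •
        qmk K H α β (n + 1) (∑ d, chainP K H (n + 1) (fun t => ZB d t * x t))) ∧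
  -- both arguments of degree `0`: `F{a, b} = a ⋆_F b`
  (∀ a b : R, Fbr 0 0 a b = starF D p q a b)

end Twistors

/-! ### Generic concatenation products, iterated coproducts and compositions -/

section Generic

variable {K : Type u} [Field K] [CharZero K]
variable {H : Type u} [Ring H] [Algebra K H]
variable {R : Type u} [Ring R] [Algebra K R]

/-- The concatenation product on `⊕ₙ H^{⊗_R n}` relative to source/target maps
`αf, βf`, a product `mulR` on the degree-`0` part `R`, and a coefficient system `coef`
(`coef n m = (−1)^{nm}` for the cup product, `coef = 1` for the plain tensor
concatenation). -/
def IsConcatOn (αf βf : R → H) (mulR : R → R → R) (coef : ℕ → ℕ → K)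
    (cup : ∀ n m : ℕ, PH K H αf βf n →ₗ[K] PH K H αf βf m →ₗ[K] PH K H αf βf (n + m)) :
    Prop :=
  (∀ (n m : ℕ) (x : Fin (n + 1) → H) (y : Fin (m + 1) → H),
    cup (n + 1) (m + 1)
        (qtMk K H αf βf (n + 1) (chainP K H (n + 1) x))
        (qtMk K H αf βf (m + 1) (chainP K H (m + 1) y)) =
      coef (n + 1) (m + 1) •
        qtMk K H αf βf ((n + 1) + (m + 1))
          (chainP K H ((n + 1) + (m + 1)) (Fin.append x y))) ∧
  (∀ (m : ℕ) (a : R) (y : Fin (m + 1) → H),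
    cup 0 (m + 1) a (qtMk K H αf βf (m + 1) (chainP K H (m + 1) y)) =
      phCast K H αf βf (a := m + 1) (b := 0 + (m + 1)) (by omega)
        (qtMk K H αf βf (m + 1) (slotP K H (m + 1) 0 (αf a) * chainP K H (m + 1) y))) ∧
  (∀ (n : ℕ) (a : R) (x : Fin (n + 1) → H),
    cup (n + 1) 0 (qtMk K H αf βf (n + 1) (chainP K H (n + 1) x)) a =
      qtMk K H αf βf (n + 1) (slotP K H (n + 1) n (βf a) * chainP K H (n + 1) x)) ∧
  (∀ a b : R, cup 0 0 a b = mulR a b)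

/-- A family `Δp` is the family of iterated coproducts of a coproduct `Δ2`, relative to
source/target maps `αf, βf`. -/
def IsIteratedOn (αf βf : R → H) (Δ2 : H →ₗ[K] QT K H αf βf 2)
    (Δp : ∀ n : ℕ, H →ₗ[K] QT K H αf βf (n + 1)) : Prop :=
  (∀ x : H, Δp 0 x = qtMk K H αf βf 1 x) ∧
  (Δp 1 = Δ2) ∧
  ∀ (n : ℕ) (x : H) (C : ℕ) (uu vv : Fin C → H),
    qtMk K H αf βf 2 (∑ c, (uu c ⊗ₜ[K] vv c : TP K H 2)) = Δ2 x →
    ∀ s : Fin C → TP K H (n + 1),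
      (∀ c, qtMk K H αf βf (n + 1) (s c) = Δp n (uu c)) →
      Δp (n + 1) x = qtMk K H αf βf (n + 2) (∑ c, (s c ⊗ₜ[K] vv c : TP K H (n + 2)))

/-- The defining clauses of the operadic partial composition maps of the operad
`P_H` attached to the data `(αf, βf, act, Δp)`; cf. Statement 1. -/
def IsCompOn (αf βf : R → H) (act : H → R → R)
    (Δp : ∀ n : ℕ, H →ₗ[K] QT K H αf βf (n + 1))
    (comp : ∀ (n m : ℕ), Fin (n + 1) →
      (PH K H αf βf (n + 1) →ₗ[K] PH K H αf βf m →ₗ[K] PH K H αf βf (n + m))) : Prop :=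
  (∀ (n m : ℕ) (i : Fin (n + 1)) (x : Fin (n + 1) → H) (y : Fin (m + 1) → H)
      (C : ℕ) (z : Fin C → Fin (m + 1) → H),
    qtMk K H αf βf (m + 1) (∑ c, chainP K H (m + 1) (z c)) = Δp m (x i) →
    comp n (m + 1) i
        (qtMk K H αf βf (n + 1) (chainP K H (n + 1) x))
        (qtMk K H αf βf (m + 1) (chainP K H (m + 1) y)) =
      qtMk K H αf βf (n + (m + 1))
        (∑ c, chainP K H (n + (m + 1)) (insChain i x (fun t => z c t * y t)))) ∧
  (∀ (i : Fin 1) (h : H) (a : R),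
    comp 0 0 i (qtMk K H αf βf 1 h) a = act h a) ∧
  (∀ (n : ℕ) (i : Fin (n + 2)) (x : Fin (n + 2) → H) (a : R),
    comp (n + 1) 0 i (qtMk K H αf βf (n + 2) (chainP K H (n + 2) x)) a =
      qtMk K H αf βf (n + 1)
        (chainP K H (n + 1) (fun j : Fin (n + 1) =>
          if (i : ℕ) ≤ n then
            (if (j : ℕ) < (i : ℕ) then x ⟨(j : ℕ), by omega⟩
             else if (j : ℕ) = (i : ℕ) then αf (act (x i) a) * x ⟨(j : ℕ) + 1, by omega⟩
             else x ⟨(j : ℕ) + 1, by omega⟩)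
          else
            (if (j : ℕ) + 1 = n + 1 then βf (act (x i) a) * x ⟨(j : ℕ), by omega⟩
             else x ⟨(j : ℕ), by omega⟩))))

/-- Iterated binary operation `(⋯(y₁ ⊚ y₂) ⊚ ⋯ ) ⊚ y_k` on a graded family. -/
def foldOp {F : ℕ → Type u} (c : ∀ a b : ℕ, F a → F b → F (a + b)) :
    ∀ {k : ℕ} (deg : Fin (k + 1) → ℕ), ((i : Fin (k + 1)) → F (deg i)) → F (∑ i, deg i)
  | 0, deg, y => (show deg 0 = ∑ i, deg i by simp) ▸ y 0
  | (k + 1), deg, y =>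
      (show (∑ i : Fin (k + 1), deg i.castSucc) + deg (Fin.last (k + 1)) = ∑ i, deg i from
        (Fin.sum_univ_castSucc deg).symm) ▸
        c _ _ (foldOp c (fun i => deg i.castSucc) (fun i => y i.castSucc))
          (y (Fin.last (k + 1)))

end Generic
set_option linter.unusedSectionVars false

section Aux1

variable {K : Type u} [Field K]
variable {H : Type u} [Ring H] [Algebra K H]
variable {R : Type u}

/-- Identification of `H` with the first tensor power. -/
def oo : H ≃ₐ[K] TP K H (0 + 1) := (AlgEquiv.refl : H ≃ₐ[K] H)

/-- Appending one tensor factor. -/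
def sn {n : ℕ} : TP K H (n + 1) →ₗ[K] H →ₗ[K] TP K H (n + 2) :=
  (TensorProduct.mk K (TP K H (n + 1)) H)

theorem sn_mul {n : ℕ} (X Y : TP K H (n + 1)) (h k : H) :
    sn X h * sn Y k = sn (X * Y) (h * k) :=
  Algebra.TensorProduct.tmul_mul_tmul X Y h k

theorem sn_one {n : ℕ} : (sn (1 : TP K H (n + 1)) (1 : H) : TP K H (n + 2)) = 1 := rfl

/-- Linear maps out of the tensor powers. -/
def snLift {n : ℕ} {M : Type u} [AddCommGroup M] [Module K M]
    (f : TP K H (n + 1) →ₗ[K] H →ₗ[K] M) : TP K H (n + 2) →ₗ[K] M :=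
  (TensorProduct.lift f : (TP K H (n + 1) ⊗[K] H) →ₗ[K] M)

theorem snLift_sn {n : ℕ} {M : Type u} [AddCommGroup M] [Module K M]
    (f : TP K H (n + 1) →ₗ[K] H →ₗ[K] M) (X : TP K H (n + 1)) (h : H) :
    snLift f (sn X h) = f X h := TensorProduct.lift.tmul X h

theorem sn_ind {n : ℕ} {P : TP K H (n + 2) → Prop}
    (hadd : ∀ X Y, P X → P Y → P (X + Y)) (hsn : ∀ X h, P (sn X h)) : ∀ X, P X := by
  intro X
  refine TensorProduct.induction_on (motive := P) X ?_ hsn hadd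
  have := hsn 0 0
  rw [map_zero] at this
  exact this

theorem sn_pres {n : ℕ} (X : TP K H (n + 2)) :
    ∃ (C : ℕ) (uu : Fin C → TP K H (n + 1)) (vv : Fin C → H), X = ∑ c, sn (uu c) (vv c) := by
  refine sn_ind (P := fun X => ∃ (C : ℕ) (uu : Fin C → TP K H (n + 1)) (vv : Fin C → H),
    X = ∑ c, sn (uu c) (vv c)) ?_ ?_ X
  · rintro X Y ⟨C, uu, vv, rfl⟩ ⟨C', uu', vv', rfl⟩
    exact ⟨C + C', Fin.append uu uu', Fin.append vv vv', by simp [Fin.sum_univ_add]⟩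
  · intro X h
    exact ⟨1, fun _ => X, fun _ => h, by simp⟩

theorem oo_surj (X : TP K H (0 + 1)) : ∃ h : H, X = oo h := ⟨oo.symm X, by simp⟩

theorem oo_ind {P : TP K H (0 + 1) → Prop} (h : ∀ x, P (oo x)) (X : TP K H (0 + 1)) : P X := by
  obtain ⟨x, hx⟩ := oo_surj X
  rw [hx]; exact h x

theorem slot_one (i : ℕ) (h : H) : slotP K H (0 + 1) i h = oo h := rfl

theorem slot_last {n : ℕ} (h : H) :
    slotP K H (n + 2) (n + 1) h = sn (1 : TP K H (n + 1)) h := by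
  exact if_pos rfl

theorem slot_ne {n i : ℕ} (hi : i ≠ n + 1) (h : H) :
    slotP K H (n + 2) i h = sn (slotP K H (n + 1) i h) (1 : H) := by
  exact if_neg hi

theorem slot_mul : ∀ {n : ℕ} (i : ℕ) (h k : H),
    slotP K H (n + 1) i (h * k) = slotP K H (n + 1) i h * slotP K H (n + 1) i k
  | 0, i, h, k => by simp [slot_one]
  | n + 1, i, h, k => by
    by_cases hi : i = n + 1
    · subst hi; simp [slot_last, sn_mul]
    · simp [slot_ne hi, sn_mul, slot_mul]

theorem slot_unit : ∀ {n : ℕ} (i : ℕ), slotP K H (n + 1) i 1 = 1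
  | 0, i => by simp [slot_one]
  | n + 1, i => by
    by_cases hi : i = n + 1
    · subst hi; simp [slot_last, sn_one]
    · simp [slot_ne hi, sn_one, slot_unit]

theorem chain_one (x : Fin (0 + 1) → H) : chainP K H (0 + 1) x = oo (x 0) := by
  simp [chainP, slot_one]

theorem prod_sn_one {n : ℕ} (l : List (TP K H (n + 1))) :
    (l.map (fun X => (sn X (1 : H) : TP K H (n + 2)))).prod = sn l.prod 1 := by
  induction l with
  | nil => simp [sn_one]
  | cons a l ih => simp [ih, sn_mul]

theorem chain_succ {n : ℕ} (x : Fin (n + 2) → H) :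
    chainP K H (n + 2) x = sn (chainP K H (n + 1) (fun i => x i.castSucc)) (x (Fin.last _)) := by
  unfold chainP
  rw [List.ofFn_succ', List.concat_eq_append, List.prod_append]
  have : (List.ofFn fun i : Fin (n + 1) => slotP K H (n + 2) (i.castSucc : ℕ) (x i.castSucc)) =
      (List.ofFn fun i : Fin (n + 1) => slotP K H (n + 1) (i : ℕ) (x i.castSucc)).map
        (fun X => (sn X (1 : H) : TP K H (n + 2))) := by
    rw [List.map_ofFn]
    congr 1
    funext i
    simp only [Function.comp, Fin.val_castSucc]
    rw [slot_ne (by have := i.isLt; omega)]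
  rw [this, prod_sn_one]
  simp [slot_last, sn_mul]

theorem chain_mul : ∀ {n : ℕ} (x y : Fin (n + 1) → H),
    chainP K H (n + 1) x * chainP K H (n + 1) y = chainP K H (n + 1) (fun i => x i * y i)
  | 0, x, y => by simp [chain_one]
  | n + 1, x, y => by simp [chain_succ, sn_mul, chain_mul]

theorem chain_unit : ∀ {n : ℕ}, chainP K H (n + 1) (fun _ => 1) = 1
  | 0 => by simp [chain_one]
  | n + 1 => by simp [chain_succ, chain_unit, sn_one]

theorem slot_chain : ∀ {n : ℕ} (i : ℕ) (_ : i < n + 1) (h : H),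
    slotP K H (n + 1) i h = chainP K H (n + 1) (fun j => if (j : ℕ) = i then h else 1)
  | 0, i, hi, h => by
    obtain rfl : i = 0 := by omega
    simp [chain_one, slot_one]
  | n + 1, i, hi, h => by
    by_cases hi' : i = n + 1
    · subst hi'
      rw [slot_last, chain_succ]
      simp only [Fin.val_castSucc, Fin.val_last, if_true]
      congr 2
      rw [← chain_unit]
      congr 1
      funext j
      rw [if_neg (by have := j.isLt; omega)]
    · rw [slot_ne hi', chain_succ, slot_chain i (by omega)]
      simp only [Fin.val_castSucc, Fin.val_last]
      rw [if_neg (by omega)]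

theorem chain_ind : ∀ {n : ℕ} {P : TP K H (n + 1) → Prop}
    (_ : ∀ X Y, P X → P Y → P (X + Y)) (_ : ∀ x, P (chainP K H (n + 1) x)), ∀ X, P X
  | 0, P, _, hc, X => by
    refine oo_ind (fun h => ?_) X
    simpa [chain_one] using hc (fun _ => h)
  | n + 1, P, hadd, hc, X => by
    refine sn_ind hadd ?_ X
    intro X
    refine chain_ind (P := fun X => ∀ h, P (sn X h)) ?_ ?_ X
    · intro X Y hX hY h
      simpa using hadd _ _ (hX h) (hY h)
    · intro x h
      simpa [chain_succ] using hc (Fin.snoc x h : Fin (n + 2) → H)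

theorem chain_pres {n : ℕ} (X : TP K H (n + 1)) :
    ∃ (C : ℕ) (z : Fin C → Fin (n + 1) → H), X = ∑ c, chainP K H (n + 1) (z c) := by
  refine chain_ind (P := fun X => ∃ (C : ℕ) (z : Fin C → Fin (n + 1) → H),
    X = ∑ c, chainP K H (n + 1) (z c)) ?_ ?_ X
  · rintro X Y ⟨C, z, rfl⟩ ⟨C', z', rfl⟩
    exact ⟨C + C', Fin.append z z', by simp [Fin.sum_univ_add]⟩
  · intro x
    exact ⟨1, fun _ => x, by simp⟩

/-- The ideal, generic membership facts. -/
theorem idl_one (αf βf : R → H) : Idl K H αf βf (0 + 1) = ⊥ := by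
  rw [Idl, Submodule.span_eq_bot]
  rintro z ⟨r, i, x, hi, -⟩
  omega

theorem idl_mul {αf βf : R → H} {n : ℕ} {Z : TP K H n} (hZ : Z ∈ Idl K H αf βf n)
    (W : TP K H n) : Z * W ∈ Idl K H αf βf n := by
  induction hZ using Submodule.span_induction with
  | mem z hz =>
    obtain ⟨r, i, x, hi, rfl⟩ := hz
    exact Submodule.subset_span ⟨r, i, x * W, hi, by rw [mul_assoc]⟩
  | zero => simp
  | add x y _ _ hx hy => rw [add_mul]; exact add_mem hx hy
  | smul a x _ hx => rw [smul_mul_assoc]; exact Submodule.smul_mem _ _ hx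

theorem relator_last {αf βf : R → H} {n : ℕ} (r : R) :
    relator K H αf βf (n + 2) r n =
      sn (slotP K H (n + 1) n (βf r)) 1 - sn (1 : TP K H (n + 1)) (αf r) := by
  rw [relator, slot_last, slot_ne (by omega)]

theorem relator_lt {αf βf : R → H} {n i : ℕ} (hi : i < n) (r : R) :
    relator K H αf βf (n + 2) r i = sn (relator K H αf βf (n + 1) r i) 1 := by
  rw [relator, slot_ne (by omega), slot_ne (by omega), relator]
  simp

theorem idl_sn {αf βf : R → H} {n : ℕ} {Z : TP K H (n + 1)} (hZ : Z ∈ Idl K H αf βf (n + 1))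
    (h : H) : (sn Z h : TP K H (n + 2)) ∈ Idl K H αf βf (n + 2) := by
  induction hZ using Submodule.span_induction with
  | mem z hz =>
    obtain ⟨r, i, x, hi, rfl⟩ := hz
    refine Submodule.subset_span ⟨r, i, sn x h, by omega, ?_⟩
    rw [relator_lt (by omega), sn_mul, one_mul]
  | zero => simp
  | add x y _ _ hx hy => simpa using add_mem hx hy
  | smul a x _ hx => simpa using Submodule.smul_mem _ a hx

theorem idl_seam {αf βf : R → H} {n : ℕ} (r : R) (X : TP K H (n + 1)) (h : H) :
    (sn (slotP K H (n + 1) n (βf r) * X) h - sn X (αf r * h) : TP K H (n + 2)) ∈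
      Idl K H αf βf (n + 2) := by
  refine Submodule.subset_span ⟨r, n, sn X h, le_rfl, ?_⟩
  rw [relator_last, sub_mul, sn_mul, sn_mul, one_mul, one_mul]

theorem idl_le {αf βf : R → H} {n : ℕ} {U : Submodule K (TP K H (n + 2))}
    (h1 : ∀ Z ∈ Idl K H αf βf (n + 1), ∀ h : H, sn Z h ∈ U)
    (h2 : ∀ (r : R) (X : TP K H (n + 1)) (h : H),
      sn (slotP K H (n + 1) n (βf r) * X) h - sn X (αf r * h) ∈ U) :
    Idl K H αf βf (n + 2) ≤ U := by
  rw [Idl, Submodule.span_le]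
  rintro z ⟨r, i, x, hi, rfl⟩
  refine sn_ind (P := fun x => relator K H αf βf (n + 2) r i * x ∈ U) ?_ ?_ x
  · intro X Y hX hY
    rw [mul_add]; exact add_mem hX hY
  · intro X h
    by_cases hin : i = n
    · subst hin
      rw [relator_last, sub_mul, sn_mul, sn_mul, one_mul, one_mul]
      exact h2 r X h
    · rw [relator_lt (by omega), sn_mul, one_mul]
      exact h1 _ (Submodule.subset_span ⟨r, i, X, by omega, rfl⟩) h

/-- Congruence modulo the ideal. -/
def CG (αf βf : R → H) (n : ℕ) (X Y : TP K H n) : Prop := X - Y ∈ Idl K H αf βf n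

section
variable {αf βf : R → H} {n : ℕ}

theorem CG.refl (X : TP K H n) : CG αf βf n X X := by simp [CG]

theorem CG.of_eq {X Y : TP K H n} (h : X = Y) : CG αf βf n X Y := h ▸ CG.refl X

theorem CG.symm {X Y : TP K H n} (h : CG αf βf n X Y) : CG αf βf n Y X := by
  have := neg_mem h
  rwa [neg_sub] at this

theorem CG.trans {X Y Z : TP K H n} (h : CG αf βf n X Y) (h' : CG αf βf n Y Z) :
    CG αf βf n X Z := by
  have := add_mem h h'
  rwa [sub_add_sub_cancel] at this

theorem CG.add {X Y X' Y' : TP K H n} (h : CG αf βf n X Y) (h' : CG αf βf n X' Y') :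
    CG αf βf n (X + X') (Y + Y') := by
  have := add_mem h h'
  rwa [sub_add_sub_comm] at this

theorem CG.sum {ι : Type*} {s : Finset ι} {X Y : ι → TP K H n}
    (h : ∀ i ∈ s, CG αf βf n (X i) (Y i)) : CG αf βf n (∑ i ∈ s, X i) (∑ i ∈ s, Y i) := by
  unfold CG
  rw [← Finset.sum_sub_distrib]
  exact Submodule.sum_mem _ h

theorem CG.mul {X Y : TP K H n} (h : CG αf βf n X Y) (W : TP K H n) :
    CG αf βf n (X * W) (Y * W) := by
  have := idl_mul h W
  rwa [sub_mul] at this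

theorem CG.sn {X Y : TP K H (n + 1)} (h : CG αf βf (n + 1) X Y) (k : H) :
    CG αf βf (n + 2) (sn X k) (sn Y k) := by
  have := idl_sn h k
  simpa [CG] using this

theorem CG.seam (r : R) (X : TP K H (n + 1)) (h : H) :
    CG αf βf (n + 2) (_root_.sn (slotP K H (n + 1) n (βf r) * X) h) (_root_.sn X (αf r * h)) :=
  idl_seam r X h

theorem CG.eq_one {X Y : TP K H (0 + 1)} (h : CG αf βf (0 + 1) X Y) : X = Y := by
  rw [CG, idl_one, Submodule.mem_bot, sub_eq_zero] at h
  exact h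

theorem CG_iff {X Y : TP K H n} :
    CG αf βf n X Y ↔ qtMk K H αf βf n X = qtMk K H αf βf n Y := by
  rw [CG, ← sub_eq_zero (a := qtMk K H αf βf n X), ← map_sub, Submodule.mkQ_apply,
    Submodule.Quotient.mk_eq_zero]

/-- A linear map preserving ideals preserves congruence. -/
theorem CG.map {m : ℕ} {αf' βf' : R → H} {f : TP K H n →ₗ[K] TP K H m}
    (hf : Idl K H αf βf n ≤ (Idl K H αf' βf' m).comap f) {X Y : TP K H n}
    (h : CG αf βf n X Y) : CG αf' βf' m (f X) (f Y) := by
  have := hf h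
  simpa [CG] using this
end

/-- Transport along an equality of degrees. -/
def tc {a b : ℕ} (h : a = b) : TP K H a ≃ₐ[K] TP K H b := h ▸ AlgEquiv.refl

theorem tc_rfl {a : ℕ} (h : a = a) (X : TP K H a) : tc h X = X := rfl

theorem tc_CG {αf βf : R → H} {a b : ℕ} (h : a = b) {X Y : TP K H a} (hXY : CG αf βf a X Y) :
    CG αf βf b (tc h X) (tc h Y) := by
  subst h; exact hXY

theorem tc_chain {a b : ℕ} (h : a = b) (x : Fin a → H) :
    tc h (chainP K H a x) = chainP K H b (fun i => x (i.cast h.symm)) := by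
  subst h; rfl

theorem tc_slot {a b : ℕ} (h : a = b) (i : ℕ) (x : H) :
    tc h (slotP K H a i x) = slotP K H b i x := by
  subst h; rfl

theorem tc_fam {a b : ℕ} (h : a = b) (e : ∀ n, TP K H n) : tc h (e a) = e b := by
  subst h; rfl

theorem tc_fam' {a b : ℕ} (h : a + 1 = b + 1) (f : ∀ n, H → TP K H (n + 1)) (x : H) :
    tc h (f a x) = f b x := by
  obtain rfl : a = b := by omega
  rfl

/-- Concatenation of tensors. -/
def cat (a : ℕ) : (b : ℕ) → TP K H (a + 1) →ₗ[K] TP K H (b + 1) →ₗ[K] TP K H (a + b + 1 + 1)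
  | 0 => (LinearMap.lcomp K _ ((oo (K := K) (H := H)).symm.toLinearMap)).comp (sn (n := a))
  | b + 1 => (TensorProduct.lift.equiv (RingHom.id K) (TP K H (b + 1)) H
      (TP K H (a + b + 1 + 2))).toLinearMap.comp
      ((LinearMap.llcomp K (TP K H (b + 1)) (TP K H (a + b + 1 + 1)) _
        (sn (n := a + b + 1))).comp (cat a b))

theorem cat_oo {a : ℕ} (X : TP K H (a + 1)) (h : H) : cat a 0 X (oo h) = sn X h := rfl

theorem cat_sn {a b : ℕ} (X : TP K H (a + 1)) (Y : TP K H (b + 1)) (h : H) :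
    cat a (b + 1) X (sn Y h) = sn (cat a b X Y) h := rfl

theorem cat_mul : ∀ {a b : ℕ} (X X' : TP K H (a + 1)) (Y Y' : TP K H (b + 1)),
    cat a b X Y * cat a b X' Y' = cat a b (X * X') (Y * Y')
  | a, 0, X, X', Y, Y' => by
    obtain ⟨h, hhh⟩ := oo_surj Y; rw [hhh]
    obtain ⟨h', hhh'⟩ := oo_surj Y'; rw [hhh']
    rw [← map_mul, cat_oo, cat_oo, cat_oo]
    exact sn_mul _ _ _ _
  | a, b + 1, X, X', Y, Y' => by
    refine sn_ind (P := fun Y => cat a (b + 1) X Y * cat a (b + 1) X' Y' =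
      cat a (b + 1) (X * X') (Y * Y')) ?_ (fun Y h => ?_) Y
    · intro Y₁ Y₂ h₁ h₂
      rw [map_add, add_mul, h₁, h₂, add_mul, map_add]
    refine sn_ind (P := fun Y' => cat a (b + 1) X (sn Y h) * cat a (b + 1) X' Y' =
      cat a (b + 1) (X * X') (sn Y h * Y')) ?_ (fun Y' h' => ?_) Y'
    · intro Y₁ Y₂ h₁ h₂
      rw [map_add, mul_add, h₁, h₂, mul_add, map_add]
    rw [sn_mul, cat_sn, cat_sn, cat_sn, ← cat_mul]
    exact sn_mul _ _ _ _

theorem cat_one : ∀ {a b : ℕ}, cat (K := K) (H := H) a b 1 1 = 1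
  | a, 0 => (cat_oo (1 : TP K H (a + 1)) 1).trans sn_one
  | a, b + 1 => by
    have h := cat_one (a := a) (b := b)
    rw [← sn_one (n := b), cat_sn, h]
    exact sn_one

theorem cat_chain : ∀ {a b : ℕ} (h : a + 1 + (b + 1) = a + b + 1 + 1) (x : Fin (a + 1) → H)
    (y : Fin (b + 1) → H), cat a b (chainP K H (a + 1) x) (chainP K H (b + 1) y) =
      chainP K H (a + b + 1 + 1) (fun i => Fin.append x y (i.cast h.symm))
  | a, 0, h, x, y => by
    rw [chain_one, cat_oo, chain_succ]
    have h1 : (fun i : Fin (a + 1) => Fin.append x y ((Fin.castSucc i).cast h.symm)) = x := by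
      funext i
      exact Fin.append_left x y i
    have h2 : Fin.append x y ((Fin.last (a + 1)).cast h.symm) = y 0 := by
      exact Fin.append_right x y 0
    exact (congrArg₂ (fun u v => sn (chainP K H (a + 1) u) v) h1 h2).symm
  | a, b + 1, h, x, y => by
    rw [chain_succ, cat_sn, cat_chain (by omega), chain_succ (n := a + (b + 1))]
    have h1 : (fun i : Fin (a + b + 1 + 1) => Fin.append x y ((Fin.castSucc i).cast h.symm)) =
        (fun i => Fin.append x (fun i : Fin (b + 1) => y i.castSucc)
          (i.cast (by omega))) := by
      funext i
      refine Fin.addCases (m := a + 1) (n := b + 1) (fun j => ?_) (fun j => ?_)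
        (i.cast (by omega)) (motive := fun k => ∀ i : Fin (a + b + 1 + 1),
          i = k.cast (by omega) → Fin.append x y ((Fin.castSucc i).cast h.symm) =
          Fin.append x (fun i : Fin (b + 1) => y i.castSucc) (i.cast (by omega))) i rfl
      · rintro i rfl
        exact (Fin.append_left x y j).trans (Fin.append_left x _ j).symm
      · rintro i rfl
        refine Eq.trans ?_ (Fin.append_right x _ j).symm
        exact (Fin.append_right x y j.castSucc)
    have h2 : Fin.append x y ((Fin.last (a + (b + 1) + 1)).cast h.symm) = y (Fin.last _) := by
      refine Eq.trans (congrArg _ ?_) (Fin.append_right x y (Fin.last _))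
      ext
      simp; try omega
    exact (congrArg₂ (fun u v => sn (chainP K H (a + b + 1 + 1) u) v) h1 h2).symm

theorem cat_slot_right : ∀ {a b : ℕ} (_ : ℕ) (X : TP K H (a + 1)) (Y : TP K H (b + 1)) (h : H),
    cat a b X (slotP K H (b + 1) b h * Y) =
      slotP K H (a + b + 1 + 1) (a + b + 1) h * cat a b X Y
  | a, 0, i, X, Y, h => by
    obtain ⟨k, hhk⟩ := oo_surj Y; rw [hhk]
    rw [slot_one, ← map_mul, cat_oo, cat_oo]
    refine Eq.trans ?_ (congrArg (· * _) (slot_last (n := a) h).symm)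
    exact ((sn_mul _ _ _ _).trans (by rw [one_mul])).symm
  | a, b + 1, i, X, Y, h => by
    refine sn_ind (P := fun Y => cat a (b + 1) X (slotP K H (b + 1 + 1) (b + 1) h * Y) =
      slotP K H (a + (b + 1) + 1 + 1) (a + (b + 1) + 1) h * cat a (b + 1) X Y) ?_ ?_ Y
    · intro Y₁ Y₂ h₁ h₂
      rw [mul_add, map_add, h₁, h₂, map_add, mul_add]
    · intro Y k
      rw [slot_last, sn_mul, cat_sn, cat_sn, one_mul]
      refine Eq.trans ?_ (congrArg (· * _) (slot_last (n := a + (b + 1)) h).symm)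
      exact ((sn_mul _ _ _ _).trans (by rw [one_mul])).symm

theorem cat_idl_left {αf βf : R → H} : ∀ {a b : ℕ} {Z : TP K H (a + 1)}
    (_ : Z ∈ Idl K H αf βf (a + 1)) (Y : TP K H (b + 1)),
    cat a b Z Y ∈ Idl K H αf βf (a + b + 1 + 1)
  | a, 0, Z, hZ, Y => by
    obtain ⟨k, hhk⟩ := oo_surj Y; rw [hhk]
    exact idl_sn hZ k
  | a, b + 1, Z, hZ, Y => by
    refine sn_ind (P := fun Y => cat a (b + 1) Z Y ∈ Idl K H αf βf (a + (b + 1) + 1 + 1)) ?_ ?_ Y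
    · intro Y₁ Y₂ h₁ h₂
      rw [map_add]; exact add_mem h₁ h₂
    · intro Y k
      exact idl_sn (cat_idl_left hZ Y) k

theorem cat_idl_right {αf βf : R → H} : ∀ {a b : ℕ} (X : TP K H (a + 1)) {Z : TP K H (b + 1)}
    (_ : Z ∈ Idl K H αf βf (b + 1)), cat a b X Z ∈ Idl K H αf βf (a + b + 1 + 1)
  | a, 0, X, Z, hZ => by
    rw [idl_one, Submodule.mem_bot] at hZ
    rw [hZ, map_zero]; exact zero_mem _
  | a, b + 1, X, Z, hZ => by
    refine (idl_le (U := (Idl K H αf βf (a + (b + 1) + 1 + 1)).comap (cat a (b + 1) X)) ?_ ?_) hZ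
    · intro Z hZ h
      exact idl_sn (cat_idl_right X hZ) h
    · intro r Y h
      rw [Submodule.mem_comap, map_sub, cat_sn, cat_sn, cat_slot_right 0]
      exact idl_seam r _ _

theorem cat_seam {αf βf : R → H} : ∀ {a b : ℕ} (r : R) (X : TP K H (a + 1)) (Y : TP K H (b + 1)),
    CG αf βf (a + b + 1 + 1) (cat a b (slotP K H (a + 1) a (βf r) * X) Y)
      (cat a b X (slotP K H (b + 1) 0 (αf r) * Y))
  | a, 0, r, X, Y => by
    obtain ⟨k, hhk⟩ := oo_surj Y; rw [hhk]
    rw [slot_one, ← map_mul]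
    exact CG.seam r X k
  | a, b + 1, r, X, Y => by
    refine sn_ind (P := fun Y => CG αf βf (a + (b + 1) + 1 + 1)
      (cat a (b + 1) (slotP K H (a + 1) a (βf r) * X) Y)
      (cat a (b + 1) X (slotP K H (b + 1 + 1) 0 (αf r) * Y))) ?_ ?_ Y
    · intro Y₁ Y₂ h₁ h₂
      rw [map_add, mul_add, map_add]; exact h₁.add h₂
    · intro Y k
      rw [slot_ne (by omega), sn_mul, cat_sn, cat_sn, one_mul]
      exact (cat_seam r X Y).sn k

theorem CG.cat_left {αf βf : R → H} {a b : ℕ} {X X' : TP K H (a + 1)}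
    (h : CG αf βf (a + 1) X X') (Y : TP K H (b + 1)) :
    CG αf βf (a + b + 1 + 1) (cat a b X Y) (cat a b X' Y) := by
  have := cat_idl_left (b := b) h Y
  rwa [map_sub, LinearMap.sub_apply] at this

theorem CG.cat_right {αf βf : R → H} {a b : ℕ} (X : TP K H (a + 1)) {Y Y' : TP K H (b + 1)}
    (h : CG αf βf (b + 1) Y Y') :
    CG αf βf (a + b + 1 + 1) (cat a b X Y) (cat a b X Y') := by
  have := cat_idl_right (a := a) X h
  rwa [map_sub] at this

end Aux1

section Aux2

variable {K : Type u} [Field K] [CharZero K]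
variable {H : Type u} [Ring H] [Algebra K H]
variable {R : Type u} [Ring R] [Algebra K R]
variable {α : R →ₐ[K] H} {β : R →ₗ[K] H}

theorem ind2 {P : TP K H (0 + 2) → Prop} (hadd : ∀ X Y, P X → P Y → P (X + Y))
    (h : ∀ u v, P (sn (oo u) v)) (X : TP K H (0 + 2)) : P X := by
  refine sn_ind hadd (fun X v => ?_) X
  obtain ⟨u, hu⟩ := oo_surj X
  rw [hu]; exact h u v

theorem pres2 (X : TP K H (0 + 2)) :
    ∃ (C : ℕ) (uu : Fin C → H) (vv : Fin C → H), X = ∑ c, sn (oo (uu c)) (vv c) := by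
  obtain ⟨C, uu, vv, h⟩ := sn_pres X
  exact ⟨C, fun c => oo.symm (uu c), vv, by simpa using h⟩

/-- A linear section of the quotient map. -/
theorem sec_exists (αf βf : R → H) (n : ℕ) :
    ∃ g : QT K H αf βf n →ₗ[K] TP K H n, (qtMk K H αf βf n).comp g = LinearMap.id :=
  (qtMk K H αf βf n).exists_rightInverse_of_surjective (Submodule.range_mkQ _)

def sec (αf βf : R → H) (n : ℕ) : QT K H αf βf n →ₗ[K] TP K H n := (sec_exists αf βf n).choose

theorem sec_spec (αf βf : R → H) (n : ℕ) (x : QT K H αf βf n) :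
    qtMk K H αf βf n (sec αf βf n x) = x :=
  LinearMap.congr_fun (sec_exists αf βf n).choose_spec x

abbrev CA (α : R →ₐ[K] H) (β : R →ₗ[K] H) (n : ℕ) (X Y : TP K H n) : Prop :=
  CG (fun a => α a) (fun a => β a) n X Y

abbrev IA (α : R →ₐ[K] H) (β : R →ₗ[K] H) (n : ℕ) : Submodule K (TP K H n) :=
  Idl K H (fun a => α a) (fun a => β a) n

/-- Chosen linear lifts of the iterated coproducts. -/
def dl (D : HopfAlgebroid K H R α β) : (n : ℕ) → H →ₗ[K] TP K H (n + 1)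
  | 0 => oo.toLinearMap
  | n + 1 => (sec (fun a => α a) (fun a => β a) (n + 2)).comp (D.Δpow (n + 1))

variable (D : HopfAlgebroid K H R α β)

theorem dl_zero (x : H) : dl D 0 x = oo x := rfl

theorem dl_spec : ∀ (n : ℕ) (x : H),
    qtMk K H (fun a => α a) (fun a => β a) (n + 1) (dl D n x) = D.Δpow n x
  | 0, x => (D.Δpow_zero x).symm
  | n + 1, x => sec_spec _ _ _ _

theorem dl_spec1 (x : H) :
    qtMk K H (fun a => α a) (fun a => β a) 2 (dl D 1 x) = D.Δ x := by
  rw [← D.Δpow_one]; exact dl_spec D 1 x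

theorem CA_of_spec {n : ℕ} {x : H} {X : TP K H (n + 1)}
    (h : qtMk K H (fun a => α a) (fun a => β a) (n + 1) X = D.Δpow n x) :
    CA α β (n + 1) X (dl D n x) := by
  rw [CA, CG_iff, h, dl_spec]

theorem CA_of_spec1 {x : H} {X : TP K H 2}
    (h : qtMk K H (fun a => α a) (fun a => β a) 2 X = D.Δ x) :
    CA α β 2 X (dl D 1 x) := by
  rw [CA, CG_iff, h]; exact (dl_spec1 D x).symm

/-- `Δⁿ ⊗ id`. -/
def dmap (n : ℕ) : TP K H (0 + 2) →ₗ[K] TP K H (n + 2) :=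
  snLift ((sn (n := n)).comp ((dl D n).comp (oo (K := K) (H := H)).symm.toLinearMap))

theorem dmap_sn (n : ℕ) (u v : H) : dmap D n (sn (oo u) v) = sn (dl D n u) v := by
  rw [dmap, snLift_sn]; rfl

theorem dl_succ (n : ℕ) (x : H) : CA α β (n + 2) (dl D (n + 1) x) (dmap D n (dl D 1 x)) := by
  obtain ⟨C, uu, vv, h⟩ := pres2 (dl D 1 x)
  rw [CA, CG_iff]
  refine (dl_spec D (n + 1) x).trans ?_
  have h1 := D.Δpow_succ n x C uu vv (by rw [← dl_spec1, h]; rfl) (fun c => dl D n (uu c))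
    (fun c => dl_spec D n _)
  rw [h1, h, map_sum]
  congr 1

theorem slotβ_idl (D : HopfAlgebroid K H R α β) : ∀ {n : ℕ} (a : R) {Z : TP K H (n + 1)} (_ : Z ∈ IA α β (n + 1)),
    slotP K H (n + 1) n (β a) * Z ∈ IA α β (n + 1)
  | 0, a, Z, hZ => by
    rw [IA, idl_one, Submodule.mem_bot] at hZ
    rw [hZ, mul_zero]; exact zero_mem _
  | n + 1, a, Z, hZ => by
    refine (idl_le (U := (IA α β (n + 2)).comap
      (LinearMap.mulLeft K (slotP K H (n + 2) (n + 1) (β a)))) ?_ ?_) hZ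
    · intro Z hZ h
      rw [Submodule.mem_comap, LinearMap.mulLeft_apply, slot_last, sn_mul, one_mul]
      exact idl_sn hZ _
    · intro r X h
      rw [Submodule.mem_comap, LinearMap.mulLeft_apply, slot_last, mul_sub, sn_mul, sn_mul, one_mul,
        one_mul, ← mul_assoc (β a), ← D.αβ_comm, mul_assoc]
      exact idl_seam r _ _

theorem slot_αβ_comm (D : HopfAlgebroid K H R α β) : ∀ {n : ℕ} (a r : R),
    slotP K H (n + 1) 0 (α a) * slotP K H (n + 1) n (β r) =
      slotP K H (n + 1) n (β r) * slotP K H (n + 1) 0 (α a)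
  | 0, a, r => by
    rw [slot_one, slot_one, ← map_mul, D.αβ_comm, map_mul]
  | n + 1, a, r => by
    rw [slot_last, slot_ne (by omega), sn_mul, sn_mul]; simp

theorem slotα_idl (D : HopfAlgebroid K H R α β) : ∀ {n : ℕ} (a : R) {Z : TP K H (n + 1)} (_ : Z ∈ IA α β (n + 1)),
    slotP K H (n + 1) 0 (α a) * Z ∈ IA α β (n + 1)
  | 0, a, Z, hZ => by
    rw [IA, idl_one, Submodule.mem_bot] at hZ
    rw [hZ, mul_zero]; exact zero_mem _
  | n + 1, a, Z, hZ => by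
    refine (idl_le (U := (IA α β (n + 2)).comap
      (LinearMap.mulLeft K (slotP K H (n + 2) 0 (α a)))) ?_ ?_) hZ
    · intro Z hZ h
      rw [Submodule.mem_comap, LinearMap.mulLeft_apply, slot_ne (by omega), sn_mul, one_mul]
      exact idl_sn (slotα_idl D a hZ) _
    · intro r X h
      rw [Submodule.mem_comap, LinearMap.mulLeft_apply, slot_ne (by omega), mul_sub, sn_mul, sn_mul,
        one_mul, one_mul, ← mul_assoc, slot_αβ_comm D, mul_assoc]
      exact idl_seam r _ _

theorem CA.slotβ (D : HopfAlgebroid K H R α β) {n : ℕ} (a : R) {X Y : TP K H (n + 1)} (h : CA α β (n + 1) X Y) :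
    CA α β (n + 1) (slotP K H (n + 1) n (β a) * X) (slotP K H (n + 1) n (β a) * Y) := by
  have := slotβ_idl D a h
  rwa [mul_sub] at this

theorem CA.slotα (D : HopfAlgebroid K H R α β) {n : ℕ} (a : R) {X Y : TP K H (n + 1)} (h : CA α β (n + 1) X Y) :
    CA α β (n + 1) (slotP K H (n + 1) 0 (α a) * X) (slotP K H (n + 1) 0 (α a) * Y) := by
  have := slotα_idl D a h
  rwa [mul_sub] at this

theorem dmap_idl_of {n : ℕ} (hβ : ∀ (a : R) (x : H), CA α β (n + 1) (dl D n (β a * x))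
    (slotP K H (n + 1) n (β a) * dl D n x)) :
    IA α β (0 + 2) ≤ (IA α β (n + 2)).comap (dmap D n) := by
  refine idl_le ?_ ?_
  · intro Z hZ h
    rw [idl_one, Submodule.mem_bot] at hZ
    rw [hZ]; simp
  · intro r X h
    obtain ⟨u, hu⟩ := oo_surj X
    rw [hu, slot_one, ← map_mul, Submodule.mem_comap, map_sub, dmap_sn, dmap_sn]
    exact ((hβ r u).sn h).trans (CG.seam r _ _)

theorem dl_β : ∀ (n : ℕ) (a : R) (x : H), CA α β (n + 1) (dl D n (β a * x))
    (slotP K H (n + 1) n (β a) * dl D n x)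
  | 0, a, x => by
    rw [dl_zero, dl_zero, slot_one, map_mul]; exact CG.refl _
  | n + 1, a, x => by
    refine (dl_succ D n _).trans ?_
    have h1 : CA α β (0 + 2) (dl D 1 (β a * x)) (slotP K H (0 + 2) (0 + 1) (β a) * dl D 1 x) := by
      refine CG.symm (CA_of_spec1 D ?_)
      exact (D.Δ_bimod_right a x _ (dl_spec1 D x)).symm
    refine (CG.map (dmap_idl_of D (dl_β n)) h1).trans ?_
    refine CG.trans ?_ (CA.slotβ D a (dl_succ D n x).symm)
    refine CG.of_eq ?_
    generalize dl D 1 x = W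
    refine ind2 (P := fun W => dmap D n (slotP K H (0 + 2) (0 + 1) (β a) * W) =
      slotP K H (n + 1 + 1) (n + 1) (β a) * dmap D n W) ?_ ?_ W
    · intro X Y hX hY
      rw [mul_add, map_add, hX, hY, map_add, mul_add]
    · intro u v
      rw [slot_last, slot_last, sn_mul, dmap_sn, one_mul, dmap_sn, sn_mul, one_mul]

theorem dmap_idl (n : ℕ) : IA α β (0 + 2) ≤ (IA α β (n + 2)).comap (dmap D n) :=
  dmap_idl_of D (dl_β D n)

theorem dl_α : ∀ (n : ℕ) (a : R) (x : H), CA α β (n + 1) (dl D n (α a * x))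
    (slotP K H (n + 1) 0 (α a) * dl D n x)
  | 0, a, x => by
    rw [dl_zero, dl_zero, slot_one, map_mul]; exact CG.refl _
  | n + 1, a, x => by
    refine (dl_succ D n _).trans ?_
    have h1 : CA α β (0 + 2) (dl D 1 (α a * x)) (slotP K H (0 + 2) 0 (α a) * dl D 1 x) := by
      refine CG.symm (CA_of_spec1 D ?_)
      exact (D.Δ_bimod_left a x _ (dl_spec1 D x)).symm
    refine (CG.map (dmap_idl D n) h1).trans ?_
    refine CG.trans ?_ (CA.slotα D a (dl_succ D n x).symm)
    generalize dl D 1 x = W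
    refine ind2 (P := fun W => CA α β (n + 2) (dmap D n (slotP K H (0 + 2) 0 (α a) * W))
      (slotP K H (n + 1 + 1) 0 (α a) * dmap D n W)) ?_ ?_ W
    · intro X Y hX hY
      rw [mul_add, map_add, map_add, mul_add]; exact hX.add hY
    · intro u v
      rw [slot_ne (by omega), slot_ne (by omega), slot_one, sn_mul, ← map_mul, dmap_sn, one_mul,
        dmap_sn, sn_mul, one_mul]
      exact (dl_α n a u).sn v

theorem dl_unit : ∀ (n : ℕ), CA α β (n + 1) (dl D n 1) 1
  | 0 => by rw [dl_zero, map_one]; exact CG.refl _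
  | n + 1 => by
    refine (dl_succ D n _).trans ?_
    have h1 : CA α β (0 + 2) (dl D 1 1) (sn (oo 1) 1) :=
      CG.symm (CA_of_spec1 D (D.Δ_one.symm))
    refine (CG.map (dmap_idl D n) h1).trans ?_
    rw [dmap_sn]
    exact (dl_unit n).sn 1

theorem dl_inv_of {n : ℕ} (h2 : ∀ x : H, ∀ Z ∈ IA α β (n + 1), dl D n x * Z ∈ IA α β (n + 1)) :
    ∀ (x : H) {X Y : TP K H (n + 1)}, CA α β (n + 1) X Y →
      CA α β (n + 1) (dl D n x * X) (dl D n x * Y) := by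
  intro x X Y h
  have := h2 x _ h
  rwa [mul_sub] at this

theorem dl_mul_β_of {n : ℕ} (h2 : ∀ x : H, ∀ Z ∈ IA α β (n + 1), dl D n x * Z ∈ IA α β (n + 1))
    (h3 : ∀ x y : H, CA α β (n + 1) (dl D n (x * y)) (dl D n x * dl D n y)) (u : H) (r : R) :
    CA α β (n + 1) (dl D n (u * β r)) (dl D n u * slotP K H (n + 1) n (β r)) := by
  refine (h3 _ _).trans (dl_inv_of D h2 u ?_)
  have h := dl_β D n r 1
  rw [mul_one] at h
  refine h.trans ?_
  have := CA.slotβ D r (dl_unit D n)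
  rwa [mul_one] at this

theorem dl_23 : ∀ n : ℕ,
    (∀ x : H, ∀ Z ∈ IA α β (n + 1), dl D n x * Z ∈ IA α β (n + 1)) ∧
    (∀ x y : H, CA α β (n + 1) (dl D n (x * y)) (dl D n x * dl D n y))
  | 0 => by
    constructor
    · intro x Z hZ
      rw [IA, idl_one, Submodule.mem_bot] at hZ
      rw [hZ, mul_zero]; exact zero_mem _
    · intro x y
      rw [dl_zero, dl_zero, dl_zero, map_mul]; exact CG.refl _
  | n + 1 => by
    obtain ⟨h2, h3⟩ := dl_23 n
    have key : ∀ x : H, ∀ Z ∈ IA α β (n + 2), dmap D n (dl D 1 x) * Z ∈ IA α β (n + 2) := by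
      intro x Z hZ
      refine (idl_le (U := (IA α β (n + 2)).comap
        (LinearMap.mulLeft K (dmap D n (dl D 1 x)))) ?_ ?_) hZ
      · intro Z hZ h
        rw [Submodule.mem_comap, LinearMap.mulLeft_apply]
        refine ind2 (P := fun W => dmap D n W * sn Z h ∈ IA α β (n + 2)) ?_ ?_ (dl D 1 x)
        · intro X Y hX hY
          rw [map_add, add_mul]; exact add_mem hX hY
        · intro u v
          rw [dmap_sn, sn_mul]
          exact idl_sn (h2 u Z hZ) _
      · intro r X h
        rw [Submodule.mem_comap, LinearMap.mulLeft_apply]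
        have h4 : ∀ W : TP K H (0 + 2), CA α β (n + 2)
            (dmap D n W * (sn (slotP K H (n + 1) n (β r) * X) h - sn X (α r * h)))
            (dmap D n (W * (sn (oo (β r)) 1 - sn 1 (α r))) * sn X h) := by
          intro W
          refine ind2 (P := fun W => CA α β (n + 2)
            (dmap D n W * (sn (slotP K H (n + 1) n (β r) * X) h - sn X (α r * h)))
            (dmap D n (W * (sn (oo (β r)) 1 - sn 1 (α r))) * sn X h)) ?_ ?_ W
          · intro X Y hX hY
            rw [map_add, add_mul, add_mul, map_add, add_mul]; exact hX.add hY
          · intro u v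
            rw [mul_sub, mul_sub, dmap_sn, sn_mul, sn_mul, sn_mul, sn_mul, mul_one, mul_one,
              ← map_mul, map_sub, dmap_sn, dmap_sn, sub_mul, sn_mul, sn_mul, mul_assoc v,
              ← mul_assoc (dl D n u)]
            have h5 := ((dl_mul_β_of D h2 h3 u r).symm.mul X).sn (v * h)
            rw [sub_eq_add_neg, sub_eq_add_neg]
            exact h5.add (CG.refl _)
        have h6 : dl D 1 x * (sn (oo (β r)) 1 - sn 1 (α r)) ∈ IA α β (0 + 2) := by
          have h7 := D.Δ_compat x r (dl D 1 x) (dl_spec1 D x)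
          rw [Submodule.mkQ_apply, Submodule.Quotient.mk_eq_zero] at h7
          have h8 := relator_last (K := K) (n := 0) (αf := fun a => α a) (βf := fun a => β a) r
          rw [slot_one] at h8
          rw [← h8]
          exact h7
        have h7 := idl_mul (dmap_idl D n h6) (sn X h)
        have h8 := add_mem (h4 (dl D 1 x)) h7
        rwa [sub_add_cancel] at h8
    have h2' : ∀ x : H, ∀ Z ∈ IA α β (n + 2), dl D (n + 1) x * Z ∈ IA α β (n + 2) := by
      intro x Z hZ
      have h := add_mem ((dl_succ D n x).mul Z) (key x Z hZ)
      rwa [sub_add_cancel] at h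
    refine ⟨h2', fun x y => ?_⟩
    refine (dl_succ D n _).trans ?_
    have h1 : CA α β (0 + 2) (dl D 1 (x * y)) (dl D 1 x * dl D 1 y) :=
      CG.symm (CA_of_spec1 D (D.Δ_mul x y _ _ (dl_spec1 D x) (dl_spec1 D y)).symm)
    refine (CG.map (dmap_idl D n) h1).trans ?_
    have h4 : ∀ W W' : TP K H (0 + 2), CA α β (n + 2) (dmap D n (W * W'))
        (dmap D n W * dmap D n W') := by
      intro W W'
      refine ind2 (P := fun W => CA α β (n + 2) (dmap D n (W * W'))
        (dmap D n W * dmap D n W')) ?_ (fun u v => ?_) W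
      · intro X Y hX hY
        rw [add_mul, map_add, map_add, add_mul]; exact hX.add hY
      refine ind2 (P := fun W' => CA α β (n + 2) (dmap D n (sn (oo u) v * W'))
        (dmap D n (sn (oo u) v) * dmap D n W')) ?_ (fun u' v' => ?_) W'
      · intro X Y hX hY
        rw [mul_add, map_add, map_add, mul_add]; exact hX.add hY
      rw [sn_mul, ← map_mul, dmap_sn, dmap_sn, dmap_sn, sn_mul]
      exact (h3 u u').sn _
    refine (h4 _ _).trans ?_
    refine CG.trans ?_ ((dl_succ D n x).symm.mul _)
    have := key x _ (dl_succ D n y).symm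
    rwa [mul_sub] at this

theorem dl_idl {n : ℕ} (x : H) {Z : TP K H (n + 1)} (hZ : Z ∈ IA α β (n + 1)) :
    dl D n x * Z ∈ IA α β (n + 1) := (dl_23 D n).1 x Z hZ

theorem CA.dl {n : ℕ} (x : H) {X Y : TP K H (n + 1)} (h : CA α β (n + 1) X Y) :
    CA α β (n + 1) (dl D n x * X) (dl D n x * Y) := dl_inv_of D (dl_23 D n).1 x h

theorem dl_mul {n : ℕ} (x y : H) : CA α β (n + 1) (dl D n (x * y)) (dl D n x * dl D n y) :=
  (dl_23 D n).2 x y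

theorem dl_mul_β {n : ℕ} (u : H) (r : R) :
    CA α β (n + 1) (dl D n (u * β r)) (dl D n u * slotP K H (n + 1) n (β r)) :=
  dl_mul_β_of D (dl_23 D n).1 (dl_23 D n).2 u r

/-- `Δᵃ ⊗ Δᵇ`. -/
def dd (a b : ℕ) : TP K H (0 + 2) →ₗ[K] TP K H (a + b + 1 + 1) :=
  snLift (LinearMap.compl₁₂ (cat a b) ((dl D a).comp (oo (K := K) (H := H)).symm.toLinearMap)
    (dl D b))

theorem dd_sn (a b : ℕ) (u v : H) :
    dd D a b (sn (oo u) v) = cat a b (dl D a u) (dl D b v) := by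
  rw [dd, snLift_sn]; rfl

theorem dd_idl (a b : ℕ) : IA α β (0 + 2) ≤ (IA α β (a + b + 1 + 1)).comap (dd D a b) := by
  refine idl_le ?_ ?_
  · intro Z hZ h
    rw [idl_one, Submodule.mem_bot] at hZ
    rw [hZ]; simp
  · intro r X h
    obtain ⟨u, hu⟩ := oo_surj X
    rw [hu, slot_one, ← map_mul, Submodule.mem_comap, map_sub, dd_sn, dd_sn]
    exact ((dl_β D a r u).cat_left _).trans
      ((cat_seam r _ _).trans (CG.cat_right _ (dl_α D b r h).symm))

theorem dd_mul (a b : ℕ) (W W' : TP K H (0 + 2)) : CA α β (a + b + 1 + 1) (dd D a b (W * W'))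
    (dd D a b W * dd D a b W') := by
  refine ind2 (P := fun W => CA α β (a + b + 1 + 1) (dd D a b (W * W'))
    (dd D a b W * dd D a b W')) ?_ (fun u v => ?_) W
  · intro X Y hX hY
    rw [add_mul, map_add, map_add, add_mul]; exact hX.add hY
  refine ind2 (P := fun W' => CA α β (a + b + 1 + 1) (dd D a b (sn (oo u) v * W'))
    (dd D a b (sn (oo u) v) * dd D a b W')) ?_ (fun u' v' => ?_) W'
  · intro X Y hX hY
    rw [mul_add, map_add, map_add, mul_add]; exact hX.add hY
  rw [sn_mul, ← map_mul, dd_sn, dd_sn, dd_sn, cat_mul]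
  exact ((dl_mul D u u').cat_left _).trans (CG.cat_right _ (dl_mul D v v'))

theorem dmap_mul (a : ℕ) (W W' : TP K H (0 + 2)) : CA α β (a + 2) (dmap D a (W * W'))
    (dmap D a W * dmap D a W') := dd_mul D a 0 W W'

/-- `Δᵃ ⊗ Δᵇ ⊗ id`. -/
def ddd (a b : ℕ) : TP K H (0 + 1 + 2) →ₗ[K] TP K H (a + b + 1 + 2) :=
  snLift ((sn (n := a + b + 1)).comp (dd D a b))

theorem ddd_sn (a b : ℕ) (W : TP K H (0 + 2)) (v : H) :
    ddd D a b (sn W v) = sn (dd D a b W) v := by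
  rw [ddd, snLift_sn]; rfl

theorem ddd_cat (a b : ℕ) (u : H) (W : TP K H (0 + 2)) :
    ddd D a b (cat 0 1 (oo u) W) = cat a (b + 1) (dl D a u) (dmap D b W) := by
  refine ind2 (P := fun W => ddd D a b (cat 0 1 (oo u) W) =
    cat a (b + 1) (dl D a u) (dmap D b W)) ?_ ?_ W
  · intro X Y hX hY
    have h1 : cat 0 1 (oo u) (X + Y) = cat 0 1 (oo u) X + cat 0 1 (oo (K := K) u) Y := map_add _ _ _
    rw [h1]
    have h2 : ddd D a b (cat 0 1 (oo u) X + cat 0 1 (oo (K := K) u) Y) =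
      ddd D a b (cat 0 1 (oo u) X) + ddd D a b (cat 0 1 (oo (K := K) u) Y) := map_add _ _ _
    rw [h2, hX, hY, map_add, map_add]
  · intro v w
    refine Eq.trans (b := ddd D a b (sn (sn (oo u) v) w)) rfl ?_
    rw [ddd_sn, dd_sn, dmap_sn, cat_sn]

theorem ddd_idl (a b : ℕ) :
    IA α β (0 + 1 + 2) ≤ (IA α β (a + b + 1 + 2)).comap (ddd D a b) := by
  refine idl_le ?_ ?_
  · intro Z hZ h
    rw [Submodule.mem_comap, ddd_sn]
    exact idl_sn (dd_idl D a b hZ) h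
  · intro r X h
    rw [Submodule.mem_comap, map_sub, ddd_sn, ddd_sn]
    refine CG.trans (CG.sn ?_ h) (CG.seam r _ _)
    refine ind2 (P := fun X => CA α β (a + b + 1 + 1)
      (dd D a b (slotP K H (0 + 1 + 1) (0 + 1) (β r) * X))
      (slotP K H (a + b + 1 + 1) (a + b + 1) (β r) * dd D a b X)) ?_ ?_ X
    · intro X Y hX hY
      rw [mul_add, map_add, map_add, mul_add]; exact hX.add hY
    · intro u v
      rw [slot_last, sn_mul, one_mul, dd_sn, dd_sn, ← cat_slot_right 0]
      exact CG.cat_right _ (dl_β D b r v)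

theorem ddd_mul (a b : ℕ) (W W' : TP K H (0 + 1 + 2)) :
    CA α β (a + b + 1 + 2) (ddd D a b (W * W')) (ddd D a b W * ddd D a b W') := by
  refine sn_ind (P := fun W => CA α β (a + b + 1 + 2) (ddd D a b (W * W'))
    (ddd D a b W * ddd D a b W')) ?_ (fun u v => ?_) W
  · intro X Y hX hY
    rw [add_mul, map_add, map_add, add_mul]; exact hX.add hY
  refine sn_ind (P := fun W' => CA α β (a + b + 1 + 2) (ddd D a b (sn u v * W'))
    (ddd D a b (sn u v) * ddd D a b W')) ?_ (fun u' v' => ?_) W'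
  · intro X Y hX hY
    rw [mul_add, map_add, map_add, mul_add]; exact hX.add hY
  rw [sn_mul, ddd_sn, ddd_sn, ddd_sn, sn_mul]
  exact (dd_mul D a b u u').sn _

theorem assoc_cat (u : H) (W : TP K H (0 + 2)) :
    ((TensorProduct.assoc K H H H).symm (u ⊗ₜ[K] (show H ⊗[K] H from W)) : TP K H 3) =
      cat 0 1 (oo u) W := by
  refine ind2 (P := fun W => ((TensorProduct.assoc K H H H).symm
    (u ⊗ₜ[K] (show H ⊗[K] H from W)) : TP K H 3) = cat 0 1 (oo u) W) ?_ ?_ W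
  · intro X Y hX hY
    refine Eq.trans ?_ ((congrArg₂ (· + ·) hX hY).trans ?_)
    · have : (u ⊗ₜ[K] (show H ⊗[K] H from (X + Y))) =
        u ⊗ₜ[K] (show H ⊗[K] H from X) + u ⊗ₜ[K] (show H ⊗[K] H from Y) :=
        TensorProduct.tmul_add _ _ _
      rw [this, map_add]
    · exact (map_add (cat 0 1 (oo (K := K) u)) X Y).symm
  · intro v w
    rfl

theorem dl_coassoc (x : H) : CA α β (0 + 1 + 2) (dmap D 1 (dl D 1 x)) (dd D 0 1 (dl D 1 x)) := by
  obtain ⟨C, uu, vv, h⟩ := pres2 (dl D 1 x)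
  have h1 := D.coassoc x C uu vv (by rw [← dl_spec1, h]; rfl) (fun c => dl D 1 (uu c))
    (fun c => dl D 1 (vv c)) (fun c => dl_spec1 D _) (fun c => dl_spec1 D _)
  rw [CA, CG_iff, h, map_sum]
  refine Eq.trans ?_ (h1.trans ?_)
  · congr 1
  · rw [map_sum]
    refine congrArg _ (Finset.sum_congr rfl fun c _ => ?_)
    exact (assoc_cat _ _).trans (dd_sn D 0 1 _ _).symm

theorem dd_succ (a b : ℕ) (W : TP K H (0 + 2)) :
    CA α β (a + b + 1 + 2) (dd D a (b + 1) W) (ddd D a b (dd D 0 1 W)) := by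
  refine ind2 (P := fun W => CA α β (a + b + 1 + 2) (dd D a (b + 1) W)
    (ddd D a b (dd D 0 1 W))) ?_ ?_ W
  · intro X Y hX hY
    have h1 : dd D 0 1 (X + Y) = dd D 0 1 X + dd D 0 1 Y := map_add _ _ _
    have h2 : ddd D a b (dd D 0 1 X + dd D 0 1 Y) =
      ddd D a b (dd D 0 1 X) + ddd D a b (dd D 0 1 Y) := map_add _ _ _
    rw [h1, h2, map_add]; exact hX.add hY
  · intro u v
    refine CG.trans (CG.of_eq (dd_sn D a (b + 1) u v)) ?_
    refine CG.trans ?_ (CG.of_eq ((congrArg (ddd D a b) (dd_sn D 0 1 u v)).trans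
      (ddd_cat D a b u (dl D 1 v))).symm)
    have h : CA α β (a + (b + 1) + 1 + 1) (cat a (b + 1) (dl D a u) (dl D (b + 1) v))
      (cat a (b + 1) (dl D a u) (dmap D b (dl D 1 v))) :=
      CG.cat_right (a := a) (b := b + 1) (dl D a u) (dl_succ D b v)
    exact h

theorem ddd_dmap {a b : ℕ} (hc : ∀ x, CA α β (a + b + 1 + 1) (dd D a b (dl D 1 x))
    (dl D (a + b + 1) x)) (W : TP K H (0 + 2)) :
    CA α β (a + b + 1 + 2) (ddd D a b (dmap D 1 W)) (dmap D (a + b + 1) W) := by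
  refine ind2 (P := fun W => CA α β (a + b + 1 + 2) (ddd D a b (dmap D 1 W))
    (dmap D (a + b + 1) W)) ?_ ?_ W
  · intro X Y hX hY
    have h1 : dmap D 1 (X + Y) = dmap D 1 X + dmap D 1 Y := map_add _ _ _
    have h2 : ddd D a b (dmap D 1 X + dmap D 1 Y) =
      ddd D a b (dmap D 1 X) + ddd D a b (dmap D 1 Y) := map_add _ _ _
    rw [h1, h2, map_add]; exact hX.add hY
  · intro u v
    rw [dmap_sn, dmap_sn]
    refine (CG.of_eq (ddd_sn D a b _ _)).trans ?_
    exact (hc u).sn v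

theorem dd_coassoc : ∀ (a b : ℕ) (x : H),
    CA α β (a + b + 1 + 1) (dd D a b (dl D 1 x)) (dl D (a + b + 1) x)
  | a, 0, x => (dl_succ D a x).symm
  | a, b + 1, x => by
    refine (dd_succ D a b _).trans ?_
    refine (CG.map (ddd_idl D a b) (dl_coassoc D x).symm).trans ?_
    exact (ddd_dmap D (dd_coassoc a b) _).trans (dl_succ D (a + b + 1) x).symm

end Aux2

section Aux3

variable {K : Type u} [Field K] [CharZero K]
variable {H : Type u} [Ring H] [Algebra K H]
variable {R : Type u} [Ring R] [Algebra K R]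
variable {α : R →ₐ[K] H} {β : R →ₗ[K] H}

theorem cc_eq (n m : ℕ) : n + m + 1 + 1 = m + n + 2 := by omega

/-- Concatenation with reordered index. -/
def cc (n m : ℕ) : TP K H (n + 1) →ₗ[K] TP K H (m + 1) →ₗ[K] TP K H (m + n + 2) :=
  (cat n m).compr₂ (tc (cc_eq n m)).toLinearMap

theorem cc_apply {n m : ℕ} (X : TP K H (n + 1)) (Y : TP K H (m + 1)) :
    cc n m X Y = tc (cc_eq n m) (cat n m X Y) := rfl

theorem cc_mul {n m : ℕ} (X X' : TP K H (n + 1)) (Y Y' : TP K H (m + 1)) :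
    cc n m X Y * cc n m X' Y' = cc n m (X * X') (Y * Y') := by
  rw [cc_apply, cc_apply, cc_apply, ← map_mul, cat_mul]

theorem cc_one {n m : ℕ} : cc (K := K) (H := H) n m 1 1 = 1 := by
  rw [cc_apply, cat_one, map_one]

theorem cc_slot {n m : ℕ} (X : TP K H (n + 1)) (Y : TP K H (m + 1)) (h : H) :
    cc n m X (slotP K H (m + 1) m h * Y) = slotP K H (m + n + 2) (m + n + 1) h * cc n m X Y := by
  rw [cc_apply, cc_apply, cat_slot_right 0, map_mul, tc_slot]
  have : n + m + 1 = m + n + 1 := by omega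
  exact congrArg (fun k => slotP K H (m + n + 2) k h * _) this

theorem tc_idl {αf βf : R → H} {a b : ℕ} (h : a = b) {X : TP K H a} (hX : X ∈ Idl K H αf βf a) :
    tc h X ∈ Idl K H αf βf b := by
  subst h; exact hX

theorem CG.cc_left {αf βf : R → H} {n m : ℕ} {X X' : TP K H (n + 1)} (h : CG αf βf (n + 1) X X')
    (Y : TP K H (m + 1)) : CG αf βf (m + n + 2) (cc n m X Y) (cc n m X' Y) :=
  tc_CG _ (h.cat_left Y)

theorem CG.cc_right {αf βf : R → H} {n m : ℕ} (X : TP K H (n + 1)) {Y Y' : TP K H (m + 1)}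
    (h : CG αf βf (m + 1) Y Y') : CG αf βf (m + n + 2) (cc n m X Y) (cc n m X Y') :=
  tc_CG _ (CG.cat_right X h)

theorem cc_seam {αf βf : R → H} {n m : ℕ} (r : R) (X : TP K H (n + 1)) (Y : TP K H (m + 1)) :
    CG αf βf (m + n + 2) (cc n m (slotP K H (n + 1) n (βf r) * X) Y)
      (cc n m X (slotP K H (m + 1) 0 (αf r) * Y)) := tc_CG _ (cat_seam r X Y)

/-- Applying the `m`-th iterated coproduct in slot `i`. -/
def DI (D : HopfAlgebroid K H R α β) (m i : ℕ) : (n : ℕ) → TP K H (n + 1) →ₗ[K] TP K H (m + n + 1)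
  | 0 => (dl D m).comp (oo (K := K) (H := H)).symm.toLinearMap
  | n + 1 => if i = n + 1 then snLift ((cc n m).compl₂ (dl D m))
      else snLift ((sn (n := m + n)).comp (DI D m i n))

/-- Inserting a block in slot `i` of a pure tensor. -/
def IX (m i : ℕ) : (n : ℕ) → (Fin (n + 1) → H) → TP K H (m + 1) →ₗ[K] TP K H (m + n + 1)
  | 0, _ => LinearMap.id
  | n + 1, x => if i = n + 1 then cc n m (chainP K H (n + 1) (fun j => x j.castSucc))
      else ((sn (n := m + n)).flip (x (Fin.last _))).comp (IX m i n (fun j => x j.castSucc))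

variable (D : HopfAlgebroid K H R α β)

theorem DI_zero {m i : ℕ} (h : H) : DI D m i 0 (oo h) = dl D m h := by
  simp [DI]

theorem DI_last {m n : ℕ} (X : TP K H (n + 1)) (h : H) :
    DI D m (n + 1) (n + 1) (sn X h) = cc n m X (dl D m h) := by
  rw [DI, if_pos rfl, snLift_sn]; rfl

theorem DI_ne {m n i : ℕ} (hi : i ≠ n + 1) (X : TP K H (n + 1)) (h : H) :
    DI D m i (n + 1) (sn X h) = sn (DI D m i n X) h := by
  rw [DI, if_neg hi]; exact snLift_sn _ _ _

theorem IX_zero {m i : ℕ} (x : Fin (0 + 1) → H) (S : TP K H (m + 1)) : IX m i 0 x S = S := rfl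

theorem IX_last {m n : ℕ} (x : Fin (n + 2) → H) (S : TP K H (m + 1)) :
    IX m (n + 1) (n + 1) x S = cc n m (chainP K H (n + 1) (fun j => x j.castSucc)) S := by
  rw [IX, if_pos rfl]

theorem IX_ne {m n i : ℕ} (hi : i ≠ n + 1) (x : Fin (n + 2) → H) (S : TP K H (m + 1)) :
    IX m i (n + 1) x S = sn (IX m i n (fun j => x j.castSucc) S) (x (Fin.last _)) := by
  rw [IX, if_neg hi]; rfl

theorem DI_chain {m : ℕ} : ∀ {n : ℕ} (i : ℕ) (hi : i < n + 1) (x : Fin (n + 1) → H),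
    DI D m i n (chainP K H (n + 1) x) = IX m i n x (dl D m (x ⟨i, hi⟩))
  | 0, i, hi, x => by
    obtain rfl : i = 0 := by omega
    rw [chain_one, DI_zero, IX_zero]; rfl
  | n + 1, i, hi, x => by
    by_cases h : i = n + 1
    · subst h
      rw [chain_succ, DI_last, IX_last]; rfl
    · rw [chain_succ, DI_ne D h, IX_ne h, DI_chain i (by omega)]; rfl

theorem IX_mul {m : ℕ} : ∀ {n : ℕ} (i : ℕ) (x x' : Fin (n + 1) → H) (S S' : TP K H (m + 1)),
    IX m i n x S * IX m i n x' S' = IX m i n (fun j => x j * x' j) (S * S')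
  | 0, i, x, x', S, S' => rfl
  | n + 1, i, x, x', S, S' => by
    by_cases h : i = n + 1
    · subst h
      rw [IX_last, IX_last, IX_last, cc_mul, chain_mul]
    · rw [IX_ne h, IX_ne h, IX_ne h]
      refine (sn_mul _ _ _ _).trans ?_
      rw [IX_mul]

theorem IX_CG {αf βf : R → H} {m : ℕ} : ∀ {n : ℕ} (i : ℕ) (x : Fin (n + 1) → H)
    {S S' : TP K H (m + 1)}, CG αf βf (m + 1) S S' →
      CG αf βf (m + n + 1) (IX m i n x S) (IX m i n x S')
  | 0, i, x, S, S', h => h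
  | n + 1, i, x, S, S', hS => by
    by_cases h : i = n + 1
    · subst h
      rw [IX_last, IX_last]; exact CG.cc_right _ hS
    · rw [IX_ne h, IX_ne h]; exact CG.sn (IX_CG i _ hS) _

theorem IX_chain {m : ℕ} : ∀ {n : ℕ} (i : ℕ) (hi : i < n + 1) (x : Fin (n + 1) → H)
    (b : Fin (m + 1) → H) (h : n + (m + 1) = m + n + 1),
    IX m i n x (chainP K H (m + 1) b) =
      chainP K H (m + n + 1) (fun j => insChain ⟨i, hi⟩ x b (j.cast h.symm))
  | 0, i, hi, x, b, h => by
    obtain rfl : i = 0 := by omega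
    rw [IX_zero]
    congr 1
    funext j
    have := j.isLt
    simp only [insChain, Fin.val_cast, Nat.not_lt_zero, dite_false, Nat.sub_zero, Nat.zero_add]
    rw [dif_pos (by omega)]
  | n + 1, i, hi, x, b, h => by
    by_cases hh : i = n + 1
    · subst hh
      rw [IX_last, cc_apply, cat_chain (by omega), tc_chain]
      congr 1
      funext j
      have := j.isLt
      simp only [insChain, Fin.val_cast]
      by_cases h1 : (j : ℕ) < n + 1
      · rw [dif_pos h1]
        have : (Fin.cast (by omega) (Fin.cast (cc_eq n m).symm j) : Fin (n + 1 + (m + 1))) =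
          Fin.castAdd (m + 1) (⟨j, h1⟩ : Fin (n + 1)) := Fin.ext rfl
        rw [this, Fin.append_left]; rfl
      · rw [dif_neg h1, dif_pos (by omega)]
        have : (Fin.cast (by omega) (Fin.cast (cc_eq n m).symm j) : Fin (n + 1 + (m + 1))) =
          Fin.natAdd (n + 1) (⟨j - (n + 1), by omega⟩ : Fin (m + 1)) := by
          apply Fin.ext; simp; omega
        rw [this, Fin.append_right]
    · rw [IX_ne hh, IX_chain i (by omega) _ _ (by omega)]
      refine Eq.trans ?_ (chain_succ (n := m + n) _).symm
      congr 1
      · simp only [insChain, Fin.val_cast, Fin.val_last]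
        rw [dif_neg (by omega), dif_neg (by omega)]
        congr 1
        apply Fin.ext
        simp; omega

theorem DI_slotβ {m : ℕ} : ∀ {n : ℕ} (i : ℕ) (r : R) (X : TP K H (n + 1)),
    CA α β (m + n + 1) (DI D m i n (slotP K H (n + 1) n (β r) * X))
      (slotP K H (m + n + 1) (m + n) (β r) * DI D m i n X)
  | 0, i, r, X => by
    obtain ⟨u, hu⟩ := oo_surj X
    rw [hu, slot_one, ← map_mul, DI_zero, DI_zero]
    exact dl_β D m r u
  | n + 1, i, r, X => by
    refine sn_ind (P := fun X => CA α β (m + n + 2)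
      (DI D m i (n + 1) (slotP K H (n + 2) (n + 1) (β r) * X))
      (slotP K H (m + n + 2) (m + n + 1) (β r) * DI D m i (n + 1) X)) ?_ ?_ X
    · intro X Y hX hY
      rw [mul_add, map_add, map_add, mul_add]; exact hX.add hY
    · intro X h
      rw [slot_last, sn_mul, one_mul]
      by_cases hh : i = n + 1
      · subst hh
        rw [DI_last, DI_last, ← cc_slot]
        exact CG.cc_right _ (dl_β D m r h)
      · rw [DI_ne D hh, DI_ne D hh, slot_last, sn_mul, one_mul]; exact CG.refl _

theorem DI_idl {m : ℕ} : ∀ {n : ℕ} (i : ℕ),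
    IA α β (n + 1) ≤ (IA α β (m + n + 1)).comap (DI D m i n)
  | 0, i => by
    rw [IA, idl_one]; exact bot_le
  | n + 1, i => by
    refine idl_le ?_ ?_
    · intro Z hZ h
      rw [Submodule.mem_comap]
      by_cases hh : i = n + 1
      · subst hh
        rw [DI_last]
        exact tc_idl _ (cat_idl_left hZ _)
      · rw [DI_ne D hh]
        exact idl_sn (DI_idl i hZ) h
    · intro r X h
      rw [Submodule.mem_comap, map_sub]
      by_cases hh : i = n + 1
      · subst hh
        rw [DI_last, DI_last]
        exact (cc_seam r _ _).trans (CG.cc_right _ (dl_α D m r h).symm)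
      · rw [DI_ne D hh, DI_ne D hh]
        exact ((DI_slotβ D i r X).sn h).trans (CG.seam r _ _)

theorem DI_mul {m : ℕ} : ∀ {n : ℕ} (i : ℕ) (A X : TP K H (n + 1)),
    CA α β (m + n + 1) (DI D m i n (A * X)) (DI D m i n A * DI D m i n X)
  | 0, i, A, X => by
    obtain ⟨u, hu⟩ := oo_surj X
    obtain ⟨a, ha⟩ := oo_surj A
    rw [hu, ha, ← map_mul, DI_zero, DI_zero, DI_zero]
    exact dl_mul D a u
  | n + 1, i, A, X => by
    refine sn_ind (P := fun A => CA α β (m + n + 2) (DI D m i (n + 1) (A * X))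
      (DI D m i (n + 1) A * DI D m i (n + 1) X)) ?_ (fun A a => ?_) A
    · intro X Y hX hY
      rw [add_mul, map_add, map_add, add_mul]; exact hX.add hY
    refine sn_ind (P := fun X => CA α β (m + n + 2) (DI D m i (n + 1) (sn A a * X))
      (DI D m i (n + 1) (sn A a) * DI D m i (n + 1) X)) ?_ (fun X h => ?_) X
    · intro X Y hX hY
      rw [mul_add, map_add, map_add, mul_add]; exact hX.add hY
    rw [sn_mul]
    by_cases hh : i = n + 1
    · subst hh
      rw [DI_last, DI_last, DI_last, cc_mul]
      exact CG.cc_right _ (dl_mul D a h)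
    · rw [DI_ne D hh, DI_ne D hh, DI_ne D hh, sn_mul]
      exact (DI_mul i A X).sn _

theorem DI_dmap_last {m n : ℕ} (W : TP K H (0 + 2)) :
    DI D m (n + 1) (n + 1) (dmap D n W) = tc (cc_eq n m) (dd D n m W) := by
  refine ind2 (P := fun W => DI D m (n + 1) (n + 1) (dmap D n W) = tc (cc_eq n m) (dd D n m W))
    ?_ ?_ W
  · intro X Y hX hY
    rw [map_add, map_add, hX, hY, map_add, map_add]
  · intro u v
    rw [dmap_sn, DI_last, dd_sn]; rfl

theorem DI_dmap_ne {m n i : ℕ} (hi : i ≠ n + 1)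
    (hc : ∀ x, CA α β (m + n + 1) (DI D m i n (dl D n x)) (dl D (m + n) x)) (W : TP K H (0 + 2)) :
    CA α β (m + n + 2) (DI D m i (n + 1) (dmap D n W)) (dmap D (m + n) W) := by
  refine ind2 (P := fun W => CA α β (m + n + 2) (DI D m i (n + 1) (dmap D n W))
    (dmap D (m + n) W)) ?_ ?_ W
  · intro X Y hX hY
    rw [map_add, map_add, map_add]; exact hX.add hY
  · intro u v
    rw [dmap_sn, DI_ne D hi, dmap_sn]
    exact (hc u).sn v

theorem DI_dl {m : ℕ} : ∀ {n : ℕ} (i : ℕ) (x : H),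
    CA α β (m + n + 1) (DI D m i n (dl D n x)) (dl D (m + n) x)
  | 0, i, x => by
    rw [dl_zero, DI_zero]; exact CG.refl _
  | n + 1, i, x => by
    refine (CG.map (DI_idl D i) (dl_succ D n x)).trans ?_
    by_cases hh : i = n + 1
    · subst hh
      rw [DI_dmap_last]
      refine (tc_CG _ (dd_coassoc D n m x)).trans (CG.of_eq ?_)
      exact tc_fam' (a := n + m + 1) (b := m + n + 1) (cc_eq n m) (fun k y => dl D k y) x
    · exact (DI_dmap_ne D hh (DI_dl i) _).trans (dl_succ D (m + n) x).symm

theorem DI_IX_idl {m n : ℕ} (i : ℕ) (hi : i < n + 1) (A : TP K H (n + 1)) (x : Fin (n + 1) → H)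
    {Z Z' : TP K H (m + 1)} (hZ : CA α β (m + 1) Z Z') :
    CA α β (m + n + 1) (DI D m i n A * IX m i n x Z) (DI D m i n A * IX m i n x Z') := by
  refine chain_ind (P := fun A => CA α β (m + n + 1) (DI D m i n A * IX m i n x Z)
    (DI D m i n A * IX m i n x Z')) ?_ ?_ A
  · intro X Y hX hY
    rw [map_add, add_mul, add_mul]; exact hX.add hY
  · intro a
    rw [DI_chain D i hi, IX_mul, IX_mul]
    exact IX_CG _ _ (CA.dl D _ hZ)

end Aux3

section Aux4

variable {K : Type u} [Field K] [CharZero K]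
variable {H : Type u} [Ring H] [Algebra K H]
variable {R : Type u} [Ring R] [Algebra K R]
variable {α : R →ₐ[K] H} {β : R →ₗ[K] H}

/-- The slot maps as linear maps. -/
def slL (i : ℕ) : (n : ℕ) → H →ₗ[K] TP K H (n + 1)
  | 0 => (oo (K := K) (H := H)).toLinearMap
  | n + 1 => if i = n + 1 then sn (1 : TP K H (n + 1)) else ((sn (n := n)).flip 1).comp (slL i n)

theorem slL_eq (i : ℕ) : ∀ (n : ℕ) (h : H), slL i n h = slotP K H (n + 1) i h
  | 0, h => rfl
  | n + 1, h => by
    by_cases hi : i = n + 1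
    · subst hi
      rw [slot_last, slL, if_pos rfl]
    · rw [slot_ne hi, ← slL_eq, slL, if_neg hi]; rfl

variable (D : HopfAlgebroid K H R α β)

/-- Contraction of the last slot. -/
def LC (n : ℕ) : TP K H (n + 2) →ₗ[K] TP K H (n + 1) :=
  snLift (((LinearMap.mul K (TP K H (n + 1))).comp ((slL n n).comp (β.comp D.ε))).flip)

theorem LC_sn {n : ℕ} (X : TP K H (n + 1)) (h : H) :
    LC D n (sn X h) = slotP K H (n + 1) n (β (D.ε h)) * X := by
  rw [LC, snLift_sn, ← slL_eq]; rfl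

/-- Contraction of slot `i` by the counit. -/
def EC (i : ℕ) : (n : ℕ) → TP K H (n + 2) →ₗ[K] TP K H (n + 1)
  | 0 => if i = 0 + 1 then LC D 0 else
      snLift (((LinearMap.mul K H).compr₂ (oo (K := K) (H := H)).toLinearMap).comp
        (α.toLinearMap.comp (D.ε.comp (oo (K := K) (H := H)).symm.toLinearMap)))
  | n + 1 => if i = n + 2 then LC D (n + 1) else snLift ((sn (n := n)).comp (EC i n))

theorem EC_last : ∀ {n : ℕ} (X : TP K H (n + 1)) (h : H),
    EC D (n + 1) n (sn X h) = slotP K H (n + 1) n (β (D.ε h)) * X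
  | 0, X, h => by rw [EC, if_pos rfl, LC_sn]
  | n + 1, X, h => by rw [EC, if_pos rfl, LC_sn]

theorem EC_zero {i : ℕ} (hi : i ≠ 0 + 1) (x h : H) :
    EC D i 0 (sn (oo x) h) = oo (α (D.ε x) * h) := by
  rw [EC, if_neg hi, snLift_sn]; simp

theorem EC_ne {n i : ℕ} (hi : i ≠ n + 2) (X : TP K H (n + 2)) (h : H) :
    EC D i (n + 1) (sn X h) = sn (EC D i n X) h := by
  rw [EC, if_neg hi, snLift_sn]; rfl

theorem eps_congr (x : H) {y y' : H} (h : D.ε y = D.ε y') : D.ε (x * y) = D.ε (x * y') := by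
  have := D.ker_ε_ideal x (y - y') (by rw [map_sub, h, sub_self])
  rwa [mul_sub, map_sub, sub_eq_zero] at this

theorem eps_α (a : R) : D.ε (α a) = a := by
  have := D.ε_bimod_left a 1
  rwa [mul_one, D.ε_one, mul_one] at this

theorem eps_β (a : R) : D.ε (β a) = a := by
  have := D.ε_bimod_right a 1
  rwa [mul_one, D.ε_one, one_mul] at this

theorem EC_slotβ : ∀ {n : ℕ} (i : ℕ) (r : R) (X : TP K H (n + 2)),
    EC D i n (slotP K H (n + 2) (n + 1) (β r) * X) = slotP K H (n + 1) n (β r) * EC D i n X := by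
  intro n i r X
  refine sn_ind (P := fun X => EC D i n (slotP K H (n + 2) (n + 1) (β r) * X) =
    slotP K H (n + 1) n (β r) * EC D i n X) ?_ ?_ X
  · intro X Y hX hY
    rw [mul_add, map_add, hX, hY, map_add, mul_add]
  intro X h
  rw [slot_last, sn_mul, one_mul]
  by_cases hi : i = n + 1
  · subst hi
    rw [EC_last, EC_last, D.ε_bimod_right, D.β_mul, slot_mul, mul_assoc]
  · cases n with
    | zero =>
      obtain ⟨u, hu⟩ := oo_surj X
      rw [hu, EC_zero D hi, EC_zero D hi, slot_one, ← map_mul, ← mul_assoc, ← mul_assoc, D.αβ_comm]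
    | succ n =>
      rw [EC_ne D hi, EC_ne D hi, slot_last, sn_mul, one_mul]

theorem EC_idl : ∀ {n : ℕ} (i : ℕ), IA α β (n + 2) ≤ (IA α β (n + 1)).comap (EC D i n) := by
  intro n
  induction n with
  | zero =>
    intro i
    refine idl_le ?_ ?_
    · intro Z hZ h
      rw [idl_one, Submodule.mem_bot] at hZ
      rw [hZ]; simp
    · intro r X h
      rw [Submodule.mem_comap, map_sub]
      by_cases hi : i = 0 + 1
      · subst hi
        rw [EC_last, EC_last, D.ε_bimod_left, D.β_mul, slot_mul, mul_assoc, sub_self]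
        exact zero_mem _
      · obtain ⟨u, hu⟩ := oo_surj X
        rw [hu, slot_one, ← map_mul, EC_zero D hi, EC_zero D hi, D.ε_bimod_right, map_mul α, mul_assoc,
          sub_self]
        exact zero_mem _
  | succ n ih =>
    intro i
    refine idl_le ?_ ?_
    · intro Z hZ h
      rw [Submodule.mem_comap]
      by_cases hi : i = n + 2
      · subst hi
        rw [EC_last]
        exact slotβ_idl D _ hZ
      · rw [EC_ne D hi]
        exact idl_sn (ih i hZ) h
    · intro r X h
      rw [Submodule.mem_comap, map_sub]
      by_cases hi : i = n + 2
      · subst hi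
        rw [EC_last, EC_last, D.ε_bimod_left, D.β_mul, slot_mul, mul_assoc, sub_self]
        exact zero_mem _
      · rw [EC_ne D hi, EC_ne D hi, EC_slotβ]
        exact idl_seam r _ _

/-- Removing the entry `i`. -/
def rmv {n : ℕ} (i : ℕ) (x : Fin (n + 2) → H) (j : Fin (n + 1)) : H :=
  if (j : ℕ) < i then x j.castSucc else x j.succ

theorem EC_chain : ∀ {n : ℕ} (i : ℕ) (hi : i < n + 2) (A : TP K H (n + 2)) (x : Fin (n + 2) → H),
    EC D i n (A * chainP K H (n + 2) x) =
      EC D i n (A * slotP K H (n + 2) i (x ⟨i, hi⟩)) * chainP K H (n + 1) (rmv i x) := by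
  intro n
  induction n with
  | zero =>
    intro i hi A x
    refine ind2 (P := fun A => EC D i 0 (A * chainP K H (0 + 2) x) =
      EC D i 0 (A * slotP K H (0 + 2) i (x ⟨i, hi⟩)) * chainP K H (0 + 1) (rmv i x)) ?_ ?_ A
    · intro X Y hX hY
      rw [add_mul, map_add, hX, hY, add_mul, map_add, add_mul]
    intro a h
    by_cases hh : i = 0 + 1
    · subst hh
      rw [chain_succ, slot_last, sn_mul, sn_mul, EC_last, EC_last, mul_one, mul_assoc]
      rfl
    · have h0 : i = 0 := by omega
      subst h0
      rw [chain_succ, slot_ne hh, slot_one, chain_one, chain_one, sn_mul, sn_mul, ← map_mul,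
        ← map_mul, EC_zero D hh, EC_zero D hh, mul_one, ← map_mul, mul_assoc]
      rfl
  | succ n ih =>
    intro i hi A x
    refine sn_ind (P := fun A => EC D i (n + 1) (A * chainP K H (n + 1 + 2) x) =
      EC D i (n + 1) (A * slotP K H (n + 1 + 2) i (x ⟨i, hi⟩)) * chainP K H (n + 1 + 1) (rmv i x))
      ?_ ?_ A
    · intro X Y hX hY
      rw [add_mul, map_add, hX, hY, add_mul, map_add, add_mul]
    intro A h
    by_cases hh : i = n + 2
    · subst hh
      rw [chain_succ, slot_last, sn_mul, sn_mul, EC_last, EC_last, mul_one, mul_assoc]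
      congr 3
      funext j
      rw [rmv, if_pos j.isLt]
    · rw [chain_succ, slot_ne hh, sn_mul, sn_mul, EC_ne D hh, EC_ne D hh, ih i (by omega),
        chain_succ, sn_mul, mul_one]
      congr 2
      rw [rmv, if_neg (by simp; omega)]; rfl

theorem EC_congr : ∀ {n : ℕ} (i : ℕ) (_ : i < n + 2) (A : TP K H (n + 2)) {h h' : H}
    (_ : D.ε h = D.ε h'),
    EC D i n (A * slotP K H (n + 2) i h) = EC D i n (A * slotP K H (n + 2) i h') := by
  intro n
  induction n with
  | zero =>
    intro i hi A h h' he
    refine ind2 (P := fun A => EC D i 0 (A * slotP K H (0 + 2) i h) =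
      EC D i 0 (A * slotP K H (0 + 2) i h')) ?_ ?_ A
    · intro X Y hX hY
      rw [add_mul, map_add, hX, hY, add_mul, map_add]
    intro a k
    by_cases hh : i = 0 + 1
    · subst hh
      rw [slot_last, slot_last, sn_mul, sn_mul, EC_last, EC_last, eps_congr D k he]
    · rw [slot_ne hh, slot_ne hh, slot_one, slot_one, sn_mul, sn_mul, ← map_mul,
        ← map_mul, EC_zero D hh, EC_zero D hh, eps_congr D a he]
  | succ n ih =>
    intro i hi A h h' he
    refine sn_ind (P := fun A => EC D i (n + 1) (A * slotP K H (n + 1 + 2) i h) =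
      EC D i (n + 1) (A * slotP K H (n + 1 + 2) i h')) ?_ ?_ A
    · intro X Y hX hY
      rw [add_mul, map_add, hX, hY, add_mul, map_add]
    intro A k
    by_cases hh : i = n + 2
    · subst hh
      rw [slot_last, slot_last, sn_mul, sn_mul, EC_last, EC_last, eps_congr D k he]
    · rw [slot_ne hh, slot_ne hh, sn_mul, sn_mul, EC_ne D hh, EC_ne D hh, ih i (by omega) A he]

theorem EC_unit : ∀ {n : ℕ} (i : ℕ), EC D i n 1 = 1 := by
  intro n
  induction n with
  | zero =>
    intro i
    by_cases hh : i = 0 + 1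
    · subst hh
      rw [← sn_one, EC_last, D.ε_one, D.β_one, slot_unit, one_mul]
    · rw [← sn_one, ← map_one oo, EC_zero D hh, D.ε_one, map_one, one_mul]
  | succ n ih =>
    intro i
    by_cases hh : i = n + 2
    · subst hh
      rw [← sn_one, EC_last, D.ε_one, D.β_one, slot_unit, one_mul]
    · rw [← sn_one, EC_ne D hh, ih, sn_one]

theorem dl_mul_α {n : ℕ} (u : H) (r : R) :
    CA α β (n + 1) (dl D n (u * α r)) (dl D n u * slotP K H (n + 1) 0 (α r)) := by
  refine (dl_mul D _ _).trans (CA.dl D u ?_)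
  have h := dl_α D n r 1
  rw [mul_one] at h
  refine h.trans ?_
  have := CA.slotα D r (dl_unit D n)
  rwa [mul_one] at this

theorem EC_Δ_left (x : H) : EC D 0 0 (dl D 1 x) = oo x := by
  obtain ⟨C, uu, vv, h⟩ := pres2 (dl D 1 x)
  have h1 := D.counit_left x C uu vv (by rw [← dl_spec1, h]; rfl)
  rw [h, map_sum, ← h1, map_sum]
  exact Finset.sum_congr rfl fun c _ => EC_zero D (by omega) _ _

theorem EC_Δ_right (x : H) : EC D (0 + 1) 0 (dl D 1 x) = oo x := by
  obtain ⟨C, uu, vv, h⟩ := pres2 (dl D 1 x)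
  have h1 := D.counit_right x C uu vv (by rw [← dl_spec1, h]; rfl)
  rw [h, map_sum, ← h1, map_sum]
  refine Finset.sum_congr rfl fun c _ => ?_
  rw [EC_last, slot_one, ← map_mul]

theorem EC_dl_last {n : ℕ} (x : H) (X : TP K H (n + 1)) (h : H) :
    CA α β (n + 1) (EC D (n + 1) n (dmap D n (dl D 1 x) * sn X h))
      (dl D n x * (slotP K H (n + 1) n (β (D.ε h)) * X)) := by
  have key : ∀ W : TP K H (0 + 2), CA α β (n + 1) (EC D (n + 1) n (dmap D n W * sn X h))
      (dl D n (oo.symm (EC D (0 + 1) 0 (W * slotP K H (0 + 2) (0 + 1) (β (D.ε h))))) * X) := by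
    intro W
    refine ind2 (P := fun W => CA α β (n + 1) (EC D (n + 1) n (dmap D n W * sn X h))
      (dl D n (oo.symm (EC D (0 + 1) 0 (W * slotP K H (0 + 2) (0 + 1) (β (D.ε h))))) * X)) ?_ ?_ W
    · intro X Y hX hY
      rw [map_add, add_mul, map_add, add_mul, map_add, map_add, map_add, add_mul]
      exact hX.add hY
    · intro u v
      rw [dmap_sn, sn_mul, EC_last, slot_last, sn_mul, mul_one, EC_last, slot_one, ← map_mul,
        AlgEquiv.symm_apply_apply, eps_congr D v (eps_β D (D.ε h)).symm, ← mul_assoc]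
      exact ((dl_β D n _ u).symm).mul X
  refine (key _).trans ?_
  have h1 : CA α β (0 + 1) (EC D (0 + 1) 0 (dl D 1 x * slotP K H (0 + 2) (0 + 1) (β (D.ε h))))
      (oo (x * β (D.ε h))) := by
    refine (CG.map (EC_idl D (0 + 1)) (dl_mul_β D x (D.ε h)).symm).trans (CG.of_eq ?_)
    exact EC_Δ_right D _
  rw [h1.eq_one, AlgEquiv.symm_apply_apply, ← mul_assoc]
  exact (dl_mul_β D x _).mul X

theorem EC_dl_zero (x a h : H) :
    EC D 0 0 (dl D 1 x * sn (oo a) h) = oo x * oo (α (D.ε a) * h) := by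
  have key : ∀ W : TP K H (0 + 2), EC D 0 0 (W * sn (oo a) h) =
      EC D 0 0 (W * slotP K H (0 + 2) 0 (α (D.ε a))) * oo h := by
    intro W
    refine ind2 (P := fun W => EC D 0 0 (W * sn (oo a) h) =
      EC D 0 0 (W * slotP K H (0 + 2) 0 (α (D.ε a))) * oo h) ?_ ?_ W
    · intro X Y hX hY
      rw [add_mul, map_add, hX, hY, add_mul, map_add, add_mul]
    · intro u v
      rw [slot_ne (by omega), slot_one, sn_mul, sn_mul, ← map_mul, ← map_mul, EC_zero D (by omega),
        EC_zero D (by omega), mul_one, ← map_mul, eps_congr D u (eps_α D (D.ε a)).symm, mul_assoc]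
  rw [key]
  have h1 : CA α β (0 + 1) (EC D 0 0 (dl D 1 x * slotP K H (0 + 2) 0 (α (D.ε a))))
      (oo (x * α (D.ε a))) := by
    refine (CG.map (EC_idl D 0) (dl_mul_α D x (D.ε a)).symm).trans (CG.of_eq ?_)
    exact EC_Δ_left D _
  rw [h1.eq_one, ← map_mul, ← map_mul, mul_assoc]

theorem EC_dl : ∀ {n : ℕ} (i : ℕ) (_ : i < n + 2) (x : H) (X : TP K H (n + 2)),
    CA α β (n + 1) (EC D i n (dl D (n + 1) x * X)) (dl D n x * EC D i n X) := by
  intro n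
  induction n with
  | zero =>
    intro i hi x X
    refine ind2 (P := fun X => CA α β (0 + 1) (EC D i 0 (dl D (0 + 1) x * X))
      (dl D 0 x * EC D i 0 X)) ?_ ?_ X
    · intro X Y hX hY
      rw [mul_add, map_add, map_add, mul_add]; exact hX.add hY
    intro a h
    by_cases hh : i = 0 + 1
    · subst hh
      refine (CG.map (EC_idl D (0 + 1)) ((dl_succ D 0 x).mul _)).trans ?_
      rw [EC_last]
      exact EC_dl_last D x _ h
    · obtain rfl : i = 0 := by omega
      rw [EC_zero D hh]
      exact CG.of_eq (EC_dl_zero D x a h)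
  | succ n ih =>
    intro i hi x X
    refine sn_ind (P := fun X => CA α β (n + 2) (EC D i (n + 1) (dl D (n + 1 + 1) x * X))
      (dl D (n + 1) x * EC D i (n + 1) X)) ?_ ?_ X
    · intro X Y hX hY
      rw [mul_add, map_add, map_add, mul_add]; exact hX.add hY
    intro X h
    refine (CG.map (EC_idl D i) ((dl_succ D (n + 1) x).mul _)).trans ?_
    by_cases hh : i = n + 2
    · subst hh
      rw [EC_last]
      exact EC_dl_last D x _ h
    · rw [EC_ne D hh]
      refine CG.trans ?_ (((dl_succ D n x).symm).mul _)
      refine ind2 (P := fun W => CA α β (n + 2) (EC D i (n + 1) (dmap D (n + 1) W * sn X h))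
        (dmap D n W * sn (EC D i n X) h)) ?_ ?_ (dl D 1 x)
      · intro X Y hX hY
        rw [map_add, add_mul, map_add, map_add, add_mul]; exact hX.add hY
      · intro u v
        rw [dmap_sn, sn_mul, EC_ne D hh, dmap_sn, sn_mul]
        exact (ih i (by omega) u X).sn _

theorem contr {αf βf : R → H} (hα : ∀ c, D.ε (αf c) = c) (hβ : ∀ c, D.ε (βf c) = c) {n : ℕ}
    {E : TP K H (n + 2)} {E' : TP K H (n + 1)}
    (hE : ∀ (i : ℕ) (c : R), i ≤ n → CA α β (n + 2) (E * slotP K H (n + 2) i (βf c))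
      (E * slotP K H (n + 2) (i + 1) (αf c)))
    (hE' : ∀ i, i < n + 2 → CA α β (n + 1) (EC D i n E) E')
    (i : ℕ) (hi : i < n + 2) (x : Fin (n + 2) → H) (h : H) (c : R) (hc : D.ε (x ⟨i, hi⟩ * h) = c) :
    CA α β (n + 1) (EC D i n (E * chainP K H (n + 2) x * slotP K H (n + 2) i h))
      (E' * chainP K H (n + 1) (fun j : Fin (n + 1) =>
          if i ≤ n then
            (if (j : ℕ) < i then x ⟨(j : ℕ), by omega⟩
             else if (j : ℕ) = i then αf c * x ⟨(j : ℕ) + 1, by omega⟩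
             else x ⟨(j : ℕ) + 1, by omega⟩)
          else
            (if (j : ℕ) + 1 = n + 1 then βf c * x ⟨(j : ℕ), by omega⟩
             else x ⟨(j : ℕ), by omega⟩))) := by
  have h1 : EC D i n (E * chainP K H (n + 2) x * slotP K H (n + 2) i h) =
      EC D i n (E * slotP K H (n + 2) i (x ⟨i, hi⟩ * h)) * chainP K H (n + 1) (rmv i x) := by
    rw [mul_assoc, slot_chain i hi, chain_mul, EC_chain D i hi]
    simp only [if_true]
    congr 2
    funext j
    unfold rmv
    by_cases h1 : (j : ℕ) < i
    · rw [if_pos h1, if_pos h1]; beta_reduce; rw [if_neg (by rw [Fin.val_castSucc]; omega), mul_one]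
    · rw [if_neg h1, if_neg h1]; beta_reduce; rw [if_neg (by rw [Fin.val_succ]; omega), mul_one]
  rw [h1]
  have h2 : ∀ (k : ℕ) (y : H) (hk : k < n + 2), k ≠ i →
      CA α β (n + 1) (EC D i n (E * slotP K H (n + 2) k y))
        (E' * slotP K H (n + 1) (if k < i then k else k - 1) y) := by
    intro k y hk hki
    rw [slot_chain k hk, EC_chain D i hi, if_neg (by simpa using Ne.symm hki), slot_unit, mul_one,
      slot_chain (if k < i then k else k - 1) (by split_ifs <;> omega)]
    refine ((hE' i hi).mul _).trans (CG.of_eq ?_)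
    congr 2
    funext j
    unfold rmv
    have := j.isLt
    by_cases h1 : (j : ℕ) < i <;> by_cases h2 : k < i <;> simp only [h1, h2, if_true, if_false,
      Fin.val_castSucc, Fin.val_succ] <;> congr 1 <;> simp only [eq_iff_iff] <;> omega
  by_cases hin : i ≤ n
  · rw [EC_congr D i hi E (hc.trans (hβ c).symm)]
    refine ((CG.map (EC_idl D i) (hE i c hin)).mul _).trans ?_
    refine ((h2 (i + 1) (αf c) (by omega) (by omega)).mul _).trans (CG.of_eq ?_)
    rw [if_neg (by omega), Nat.add_sub_cancel, mul_assoc, slot_chain i (by omega), chain_mul]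
    congr 2
    funext j
    unfold rmv
    rw [if_pos hin]
    by_cases h3 : (j : ℕ) < i
    · rw [if_pos h3, if_pos h3, if_neg (by omega), one_mul]; rfl
    · rw [if_neg h3, if_neg h3]
      split_ifs
      · rfl
      · rw [one_mul]; rfl
  · obtain rfl : i = n + 1 := by omega
    rw [EC_congr D _ hi E (hc.trans (hα c).symm)]
    refine ((CG.map (EC_idl D (n + 1)) (hE n c le_rfl).symm).mul _).trans ?_
    refine ((h2 n (βf c) (by omega) (by omega)).mul _).trans (CG.of_eq ?_)
    rw [if_pos (by omega), mul_assoc, slot_chain n (by omega), chain_mul]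
    congr 2
    funext j
    unfold rmv
    rw [if_neg hin, if_pos j.isLt]
    by_cases h3 : (j : ℕ) = n
    · rw [if_pos h3, if_pos (by omega)]; rfl
    · rw [if_neg h3, if_neg (by omega), one_mul]; rfl

end Aux4

section Aux5

variable {K : Type u} [Field K] [CharZero K]
variable {H : Type u} [Ring H] [Algebra K H]
variable {R : Type u} [Ring R] [Algebra K R]
variable {α : R →ₐ[K] H} {β : R →ₗ[K] H}

/-- The chosen lift of the twistor. -/
def FF (K : Type u) [Field K] {H : Type u} [Ring H] [Algebra K H] {C : ℕ} (p q : Fin C → H) :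
    TP K H (0 + 2) := ∑ c, sn (oo (p c)) (q c)

/-- The chosen lifts of the elements `E_n`. -/
def eE (D : HopfAlgebroid K H R α β) {C : ℕ} (p q : Fin C → H) : (n : ℕ) → TP K H n
  | 0 => 1
  | 1 => 1
  | n + 2 => dmap D n (FF K p q) * sn (eE D p q (n + 1)) 1

variable (D : HopfAlgebroid K H R α β) {C : ℕ} {p q : Fin C → H}

theorem eE_one : eE D p q (0 + 1) = 1 := rfl

theorem eE_succ (n : ℕ) : eE D p q (n + 2) = dmap D n (FF K p q) * sn (eE D p q (n + 1)) 1 := rfl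

theorem dmap_zero (W : TP K H (0 + 2)) : dmap D 0 W = W := by
  refine ind2 (P := fun W => dmap D 0 W = W) ?_ ?_ W
  · intro X Y hX hY
    rw [map_add, hX, hY]
  · intro u v
    rw [dmap_sn, dl_zero]

theorem eE_two : eE D p q (0 + 2) = FF K p q := by
  rw [eE_succ, dmap_zero, eE_one, sn_one, mul_one]

theorem twist1 (htw : IsTwistor D p q) : CA α β (0 + 1 + 2)
    (dmap D 1 (FF K p q) * sn (FF K p q) 1)
    (dd D 0 1 (FF K p q) * cat 0 1 (oo 1) (FF K p q)) := by
  obtain ⟨⟨s, t, hs, ht, h⟩, -⟩ := htw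
  have h' : CA α β (0 + 1 + 2) ((∑ c, sn (n := 1) (s c) (q c)) * (∑ c, sn (n := 1) (sn (oo (p c)) (q c)) 1))
      ((∑ c, cat 0 1 (oo (p c)) (t c)) * (∑ c, cat 0 1 (oo 1) (sn (oo (p c)) (q c)))) := by
    rw [CA, CG_iff]
    exact h
  have e1 : (∑ c, sn (n := 1) (sn (oo (p c)) (q c)) 1 : TP K H (0 + 1 + 2)) = sn (FF K p q) 1 := by
    rw [FF, map_sum, LinearMap.sum_apply]
  have e2 : (∑ c, cat 0 1 (oo 1) (sn (oo (p c)) (q c)) : TP K H (0 + 1 + 2)) =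
      cat 0 1 (oo 1) (FF K p q) := by
    exact (map_sum (cat 0 1 (oo (K := K) 1)) _ _).symm
  rw [e1, e2] at h'
  have c1 : CA α β (0 + 1 + 2) (dmap D 1 (FF K p q)) (∑ c, sn (n := 1) (s c) (q c)) := by
    have e3 : dmap D 1 (FF K p q) = ∑ c, sn (n := 1) (dl D 1 (p c)) (q c) := by
      rw [FF, map_sum]; exact Finset.sum_congr rfl fun c _ => dmap_sn D 1 _ _
    refine (CG.of_eq e3).trans (CG.sum fun c _ => ?_)
    exact ((CA_of_spec1 D (hs c)).symm).sn (q c)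
  have c2 : CA α β (0 + 1 + 2) (∑ c, cat 0 1 (oo (p c)) (t c)) (dd D 0 1 (FF K p q)) := by
    have e3 : dd D 0 1 (FF K p q) = ∑ c, cat 0 1 (oo (p c)) (dl D 1 (q c)) := by
      rw [FF, map_sum]; exact Finset.sum_congr rfl fun c _ => dd_sn D 0 1 _ _
    refine CG.trans (CG.sum fun c _ => ?_) (CG.of_eq e3.symm)
    exact CG.cat_right (a := 0) (b := 1) _ (CA_of_spec1 D (ht c))
  exact ((c1.mul _).trans h').trans (c2.mul _)

theorem twist2l (htw : IsTwistor D p q) : EC D 0 0 (FF K p q) = oo 1 := by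
  rw [← htw.2.1.1, FF, map_sum, map_sum]
  exact Finset.sum_congr rfl fun c _ => EC_zero D (by omega) _ _

theorem twist2r (htw : IsTwistor D p q) : EC D (0 + 1) 0 (FF K p q) = oo 1 := by
  rw [← htw.2.1.2, FF, map_sum, map_sum]
  refine Finset.sum_congr rfl fun c _ => ?_
  rw [EC_last, slot_one, ← map_mul]

theorem dmap_sn_idl {n : ℕ} (W : TP K H (0 + 2)) {Z : TP K H (n + 1)} (hZ : Z ∈ IA α β (n + 1))
    (h : H) : dmap D n W * sn Z h ∈ IA α β (n + 2) := by
  refine ind2 (P := fun W => dmap D n W * sn Z h ∈ IA α β (n + 2)) ?_ ?_ W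
  · intro X Y hX hY
    rw [map_add, add_mul]; exact add_mem hX hY
  · intro u v
    rw [dmap_sn, sn_mul]
    exact idl_sn (dl_idl D u hZ) _

theorem dmap_sn_CG {n : ℕ} (W : TP K H (0 + 2)) {Z Z' : TP K H (n + 1)} (hZ : CA α β (n + 1) Z Z')
    (h : H) : CA α β (n + 2) (dmap D n W * sn Z h) (dmap D n W * sn Z' h) := by
  have := dmap_sn_idl D W hZ h
  rwa [map_sub, LinearMap.sub_apply, mul_sub] at this

theorem dl_mul_unit {n : ℕ} (u : H) : CA α β (n + 1) (dl D n u * dl D n 1) (dl D n u) := by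
  have := dl_mul D (n := n) u 1
  rw [mul_one] at this
  exact this.symm

theorem dd_unit_left {a b : ℕ} (W : TP K H (0 + 2)) (X : TP K H (a + 1)) (Y : TP K H (b + 1)) :
    CA α β (a + b + 1 + 1) (dd D a b W * cat a b (dl D a 1 * X) Y) (dd D a b W * cat a b X Y) := by
  refine ind2 (P := fun W => CA α β (a + b + 1 + 1) (dd D a b W * cat a b (dl D a 1 * X) Y)
    (dd D a b W * cat a b X Y)) ?_ ?_ W
  · intro X Y hX hY
    rw [map_add, add_mul, add_mul]; exact hX.add hY
  · intro u v
    rw [dd_sn, cat_mul, cat_mul, ← mul_assoc]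
    exact ((dl_mul_unit D u).mul X).cat_left _

theorem dd_unit_right {a b : ℕ} (W : TP K H (0 + 2)) (X : TP K H (a + 1)) (Y : TP K H (b + 1)) :
    CA α β (a + b + 1 + 1) (dd D a b W * cat a b X (dl D b 1 * Y)) (dd D a b W * cat a b X Y) := by
  refine ind2 (P := fun W => CA α β (a + b + 1 + 1) (dd D a b W * cat a b X (dl D b 1 * Y))
    (dd D a b W * cat a b X Y)) ?_ ?_ W
  · intro X Y hX hY
    rw [map_add, add_mul, add_mul]; exact hX.add hY
  · intro u v
    rw [dd_sn, cat_mul, cat_mul, ← mul_assoc]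
    exact CG.cat_right _ ((dl_mul_unit D v).mul Y)

theorem eE_split (htw : IsTwistor D p q) (a : ℕ) : ∀ b : ℕ, CA α β (a + b + 1 + 1)
    (eE D p q (a + b + 1 + 1))
    (dd D a b (FF K p q) * cat a b (eE D p q (a + 1)) (eE D p q (b + 1)))
  | 0 => CG.refl _
  | b + 1 => by
    have ih := eE_split htw a b
    have s1 : CA α β (a + b + 1 + 2) (eE D p q (a + b + 1 + 2))
        (dmap D (a + b + 1) (FF K p q) * sn (dd D a b (FF K p q) *
          cat a b (eE D p q (a + 1)) (eE D p q (b + 1))) 1) := by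
      rw [eE_succ]
      exact dmap_sn_CG D _ ih 1
    have e1 : (sn (dd D a b (FF K p q) * cat a b (eE D p q (a + 1)) (eE D p q (b + 1))) (1 : H) :
        TP K H (a + b + 1 + 2)) = ddd D a b (sn (FF K p q) 1) *
          sn (cat a b (eE D p q (a + 1)) (eE D p q (b + 1))) 1 := by
      rw [ddd_sn, sn_mul, one_mul]
    rw [e1, ← mul_assoc] at s1
    have s2 : CA α β (a + b + 1 + 2) (dmap D (a + b + 1) (FF K p q) * ddd D a b (sn (FF K p q) 1))
        (ddd D a b (dd D 0 1 (FF K p q)) * ddd D a b (cat 0 1 (oo 1) (FF K p q))) := by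
      refine ((ddd_dmap D (dd_coassoc D a b) (FF K p q)).symm.mul _).trans ?_
      refine (ddd_mul D a b _ _).symm.trans ?_
      refine (CG.map (ddd_idl D a b) (twist1 D htw)).trans ?_
      exact ddd_mul D a b _ _
    have s3 : CA α β (a + b + 1 + 2)
        (ddd D a b (dd D 0 1 (FF K p q)) * ddd D a b (cat 0 1 (oo 1) (FF K p q)))
        (dd D a (b + 1) (FF K p q) * cat a (b + 1) (dl D a 1) (dmap D b (FF K p q))) := by
      refine ((dd_succ D a b _).symm.mul _).trans (CG.of_eq ?_)
      exact congrArg (fun Z => dd D a (b + 1) (FF K p q) * Z) (ddd_cat D a b 1 (FF K p q))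
    refine (s1.trans ((s2.trans s3).mul _)).trans ?_
    have e2 : (dd D a (b + 1) (FF K p q) * cat a (b + 1) (dl D a 1) (dmap D b (FF K p q))) *
        cat a (b + 1) (eE D p q (a + 1)) (sn (eE D p q (b + 1)) 1) =
        dd D a (b + 1) (FF K p q) * cat a (b + 1) (dl D a 1 * eE D p q (a + 1))
          (eE D p q (b + 2)) := by
      rw [mul_assoc, cat_mul, eE_succ]
    refine (CG.of_eq e2).trans ?_
    exact dd_unit_left D (a := a) (b := b + 1) _ _ _

theorem DI_mul' {m n : ℕ} (i : ℕ) (A X : TP K H (n + 2)) : CA α β (m + n + 2)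
    (DI D m i (n + 1) (A * X)) (DI D m i (n + 1) A * DI D m i (n + 1) X) :=
  DI_mul D (n := n + 1) i A X

theorem eE_ins_last (htw : IsTwistor D p q) (m n : ℕ) :
    CA α β (m + n + 2) (eE D p q (m + n + 2))
      (DI D m (n + 1) (n + 1) (eE D p q (n + 2)) * IX m (n + 1) (n + 1) (fun _ => 1)
        (eE D p q (m + 1))) := by
  have s0 : IX m (n + 1) (n + 1) (fun _ => 1) (eE D p q (m + 1)) = cc n m 1 (eE D p q (m + 1)) := by
    rw [IX_last, chain_unit]
  have s1 : CA α β (m + n + 2)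
      (DI D m (n + 1) (n + 1) (eE D p q (n + 2)))
      (tc (cc_eq n m) (dd D n m (FF K p q)) * cc n m (eE D p q (n + 1)) (dl D m 1)) := by
    rw [eE_succ D n]
    have := DI_mul' D (m := m) (n + 1) (dmap D n (FF K p q)) (sn (eE D p q (n + 1)) 1)
    rwa [DI_dmap_last, DI_last] at this
  have s2 : tc (cc_eq n m) (dd D n m (FF K p q)) * cc n m (eE D p q (n + 1)) (dl D m 1) *
      cc n m 1 (eE D p q (m + 1)) = tc (cc_eq n m) (dd D n m (FF K p q) * cat n m (eE D p q (n + 1))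
            (dl D m 1 * eE D p q (m + 1))) := by
    rw [mul_assoc, cc_mul, mul_one, map_mul (tc _), cc_apply]
  have s3 := tc_CG (cc_eq n m) ((eE_split D htw n m).trans
        (dd_unit_right D (FF K p q) (eE D p q (n + 1)) (eE D p q (m + 1))).symm)
  have s4 : tc (cc_eq n m) (eE D p q (n + m + 1 + 1)) = eE D p q (m + n + 2) :=
    tc_fam (cc_eq n m) (eE D p q)
  rw [s4, ← s2] at s3
  rw [s0]
  exact s3.trans (s1.mul _).symm

theorem eE_ins_ne (m n i : ℕ) (hh : i ≠ n + 1)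
    (ih : CA α β (m + n + 1) (eE D p q (m + n + 1))
      (DI D m i n (eE D p q (n + 1)) * IX m i n (fun _ => 1) (eE D p q (m + 1)))) :
    CA α β (m + n + 2) (eE D p q (m + n + 2))
      (DI D m i (n + 1) (eE D p q (n + 2)) * IX m i (n + 1) (fun _ => 1)
        (eE D p q (m + 1))) := by
  have s0 : IX m i (n + 1) (fun _ => 1) (eE D p q (m + 1)) =
      sn (IX m i n (fun _ => 1) (eE D p q (m + 1))) 1 := IX_ne hh _ _
  have s1 : CA α β (m + n + 2)
      (DI D m i (n + 1) (eE D p q (n + 2)))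
      (dmap D (m + n) (FF K p q) * sn (DI D m i n (eE D p q (n + 1))) 1) := by
    rw [eE_succ D n]
    have := DI_mul' D (m := m) i (dmap D n (FF K p q)) (sn (eE D p q (n + 1)) 1)
    rw [DI_ne D hh] at this
    exact this.trans ((DI_dmap_ne D hh (DI_dl D i) (FF K p q)).mul _)
  have s2 := s1.mul (sn (IX m i n (fun _ => 1) (eE D p q (m + 1))) 1)
  rw [mul_assoc, sn_mul, one_mul] at s2
  rw [s0, eE_succ D (m + n)]
  exact (dmap_sn_CG D _ ih 1).trans s2.symm

theorem eE_ins (htw : IsTwistor D p q) (m : ℕ) : ∀ (n i : ℕ) (_ : i < n + 1),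
    CA α β (m + n + 1) (eE D p q (m + n + 1))
      (DI D m i n (eE D p q (n + 1)) * IX m i n (fun _ => 1) (eE D p q (m + 1)))
  | 0, i, hi => by
    rw [eE_one, ← map_one oo, DI_zero, IX_zero]
    have := ((dl_unit D m).symm).mul (eE D p q (m + 1))
    rwa [one_mul] at this
  | n + 1, i, hi => by
    by_cases hh : i = n + 1
    · subst hh
      exact eE_ins_last D htw m n
    · exact eE_ins_ne D m n i hh (eE_ins htw m n i (by omega))

theorem EC_dmap_last {n : ℕ} (W : TP K H (0 + 2)) (X : TP K H (n + 1)) (h : H) :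
    CA α β (n + 1) (EC D (n + 1) n (dmap D n W * sn X h))
      (dl D n (oo.symm (EC D (0 + 1) 0 (W * sn (oo 1) h))) * X) := by
  refine ind2 (P := fun W => CA α β (n + 1) (EC D (n + 1) n (dmap D n W * sn X h))
      (dl D n (oo.symm (EC D (0 + 1) 0 (W * sn (oo 1) h))) * X)) ?_ ?_ W
  · intro X Y hX hY
    rw [map_add, add_mul, map_add, add_mul, map_add, map_add, map_add, add_mul]
    exact hX.add hY
  · intro u v
    rw [dmap_sn, sn_mul, EC_last, sn_mul, EC_last, slot_one, ← map_mul, ← map_mul, mul_one,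
      AlgEquiv.symm_apply_apply, ← mul_assoc]
    exact ((dl_β D n _ u).symm).mul X

theorem eE_contr (htw : IsTwistor D p q) : ∀ (n i : ℕ) (_ : i < n + 2),
    CA α β (n + 1) (EC D i n (eE D p q (n + 2))) (eE D p q (n + 1)) := by
  have hl : ∀ n : ℕ, CA α β (n + 1) (EC D (n + 1) n (eE D p q (n + 2))) (eE D p q (n + 1)) := by
    intro n
    rw [eE_succ]
    refine (EC_dmap_last D _ _ _).trans ?_
    rw [map_one oo, sn_one, mul_one, twist2r D htw, AlgEquiv.symm_apply_apply]
    have := (dl_unit D n).mul (eE D p q (n + 1))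
    rwa [one_mul] at this
  intro n
  induction n with
  | zero =>
    intro i hi
    by_cases hh : i = 0 + 1
    · subst hh; exact hl 0
    · obtain rfl : i = 0 := by omega
      rw [eE_two, twist2l D htw, map_one]
      exact CG.refl _
  | succ n ih =>
    intro i hi
    by_cases hh : i = n + 2
    · subst hh; exact hl (n + 1)
    · rw [eE_succ D (n + 1), eE_succ D n]
      refine ind2 (P := fun W => CA α β (n + 2)
        (EC D i (n + 1) (dmap D (n + 1) W * sn (eE D p q (n + 2)) 1))
        (dmap D n W * sn (eE D p q (n + 1)) 1)) ?_ ?_ (FF K p q)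
      · intro X Y hX hY
        rw [map_add, add_mul, map_add, map_add, add_mul]; exact hX.add hY
      · intro u v
        rw [dmap_sn, sn_mul, EC_ne D hh, dmap_sn, sn_mul]
        exact ((EC_dl D i (by omega) u _).trans (CA.dl D u (ih i (by omega)))).sn _

theorem eps_alphaF (htw : IsTwistor D p q) (a : R) : D.ε (alphaF D p q a) = a := by
  have h := congrArg (fun x => D.ε (x * α a)) htw.2.1.2
  simp only [one_mul, eps_α, Finset.sum_mul, map_sum, mul_assoc, D.ε_bimod_right] at h
  rw [alphaF, map_sum]
  simpa only [D.ε_bimod_left, HopfAlgebroid.hAct] using h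

theorem eps_betaF (htw : IsTwistor D p q) (a : R) : D.ε (betaF D p q a) = a := by
  have h := congrArg (fun x => D.ε (x * α a)) htw.2.1.1
  simp only [one_mul, eps_α, Finset.sum_mul, map_sum, mul_assoc, D.ε_bimod_left] at h
  rw [betaF, map_sum]
  simpa only [D.ε_bimod_right, HopfAlgebroid.hAct] using h

theorem EC_betaF (a : R) : EC D (0 + 1) 0 (FF K p q * sn (oo 1) (α a)) = oo (betaF D p q a) := by
  rw [FF, Finset.sum_mul, map_sum, betaF, map_sum]
  refine Finset.sum_congr rfl fun c _ => ?_
  rw [sn_mul, EC_last, slot_one, ← map_mul, ← map_mul, mul_one]; rfl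

theorem EC_cat01 (u : H) (Y : TP K H (0 + 2)) :
    EC D (1 + 1) 1 (cat 0 1 (oo u) Y) = sn (oo u) (oo.symm (EC D (0 + 1) 0 Y)) := by
  refine ind2 (P := fun Y => EC D (1 + 1) 1 (cat 0 1 (oo u) Y) =
    sn (oo u) (oo.symm (EC D (0 + 1) 0 Y))) ?_ ?_ Y
  · intro X Y hX hY
    have h1 : cat 0 1 (oo u) (X + Y) = cat 0 1 (oo u) X + cat 0 1 (oo (K := K) u) Y := map_add _ _ _
    have h2 : EC D (1 + 1) 1 (cat 0 1 (oo u) X + cat 0 1 (oo (K := K) u) Y) =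
      EC D (1 + 1) 1 (cat 0 1 (oo u) X) + EC D (1 + 1) 1 (cat 0 1 (oo (K := K) u) Y) := map_add _ _ _
    rw [h1, h2, hX, hY, map_add, map_add, map_add]
  · intro v w
    have h1 : cat 0 1 (oo u) (sn (oo v) w) = sn (n := 1) (sn (oo (K := K) u) v) w := rfl
    rw [h1, EC_last, EC_last]
    refine (congrArg (fun Z => Z * sn (oo u) v) (slot_last (n := 0) (β (D.ε w)))).trans ?_
    rw [sn_mul, one_mul, slot_one, ← map_mul, AlgEquiv.symm_apply_apply]

theorem F_betaF (htw : IsTwistor D p q) (a : R) :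
    CA α β (0 + 2) (FF K p q * sn (oo 1) (betaF D p q a))
      (dl D 1 (betaF D p q a) * FF K p q) := by
  have h1 := CG.map (EC_idl D (n := 1) (1 + 1)) ((twist1 D htw).mul (sn (n := 1) 1 (α a)))
  have h2 : CA α β (0 + 2) (EC D (1 + 1) 1 (dmap D 1 (FF K p q) * sn (FF K p q) 1 *
      sn (n := 1) 1 (α a))) (dl D 1 (betaF D p q a) * FF K p q) := by
    have e1 : dmap D 1 (FF K p q) * sn (FF K p q) 1 * sn (n := 1) 1 (α a) =
      dmap D 1 (FF K p q) * sn (n := 1) (FF K p q) (α a) := by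
      rw [mul_assoc]
      refine congrArg (fun Z => dmap D 1 (FF K p q) * Z) ((sn_mul (n := 1) _ _ _ _).trans ?_)
      rw [mul_one, one_mul]
    rw [e1]
    refine (EC_dmap_last D (n := 1) _ _ _).trans ?_
    rw [EC_betaF, AlgEquiv.symm_apply_apply]
    exact CG.refl _
  have h3 : EC D (1 + 1) 1 (dd D 0 1 (FF K p q) * cat 0 1 (oo 1) (FF K p q) *
      sn (n := 1) 1 (α a)) = FF K p q * sn (oo 1) (betaF D p q a) := by
    have e1 : (sn (n := 1) 1 (α a) : TP K H (0 + 1 + 2)) = cat 0 1 (oo 1) (sn (oo 1) (α a)) := rfl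
    rw [e1]
    refine ind2 (P := fun W => EC D (1 + 1) 1 (dd D 0 1 W * cat 0 1 (oo 1) (FF K p q) *
      cat 0 1 (oo 1) (sn (oo 1) (α a))) = W * sn (oo 1) (betaF D p q a)) ?_ ?_ (FF K p q)
    · intro X Y hX hY
      have h4 : dd D 0 1 (X + Y) = dd D 0 1 X + dd D 0 1 Y := map_add _ _ _
      rw [h4, add_mul, add_mul, add_mul, ← hX, ← hY]
      exact map_add _ _ _
    · intro u v
      have e2 : dd D 0 1 (sn (oo u) v) * cat 0 1 (oo 1) (FF K p q) *
          cat 0 1 (oo 1) (sn (oo 1) (α a)) =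
          cat 0 1 (oo u) (dl D 1 v * (FF K p q * sn (oo 1) (α a))) := by
        have e3 : dd D 0 1 (sn (oo u) v) = cat 0 1 (oo u) (dl D 1 v) := dd_sn D 0 1 u v
        rw [e3]
        refine (congrArg (fun Z => Z * cat 0 1 (oo 1) (sn (oo 1) (α a)))
          (cat_mul (a := 0) (b := 1) _ _ _ _)).trans ?_
        refine (cat_mul (a := 0) (b := 1) _ _ _ _).trans ?_
        rw [map_one, mul_one, mul_one, mul_assoc]
      rw [e2, EC_cat01, (EC_dl D (0 + 1) (by omega) v (FF K p q * sn (oo 1) (α a))).eq_one,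
        EC_betaF, dl_zero, ← map_mul, AlgEquiv.symm_apply_apply, sn_mul, ← map_mul, mul_one]
  exact (CG.of_eq h3.symm).trans (h1.symm.trans h2)

theorem eE_betaF (htw : IsTwistor D p q) : ∀ (n : ℕ) (a : R),
    CA α β (n + 1) (eE D p q (n + 1) * slotP K H (n + 1) n (betaF D p q a))
      (dl D n (betaF D p q a) * eE D p q (n + 1))
  | 0, a => by
    rw [eE_one, one_mul, mul_one, slot_one, dl_zero]; exact CG.refl _
  | n + 1, a => by
    have e1 : eE D p q (n + 2) * slotP K H (n + 2) (n + 1) (betaF D p q a) =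
        dmap D n (FF K p q * sn (oo 1) (betaF D p q a)) * sn (eE D p q (n + 1)) 1 := by
      rw [eE_succ, slot_last]
      refine ind2 (P := fun W => dmap D n W * sn (eE D p q (n + 1)) 1 * sn 1 (betaF D p q a) =
        dmap D n (W * sn (oo 1) (betaF D p q a)) * sn (eE D p q (n + 1)) 1) ?_ ?_ (FF K p q)
      · intro X Y hX hY
        rw [map_add, add_mul, add_mul, add_mul, map_add, add_mul, hX, hY]
      · intro u v
        rw [dmap_sn, sn_mul, sn_mul, sn_mul, ← map_mul, dmap_sn, sn_mul, mul_one, mul_one, mul_one,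
          mul_one]
    refine (CG.of_eq e1).trans ?_
    refine ((CG.map (dmap_idl D n) (F_betaF D htw a)).mul _).trans ?_
    refine ((dmap_mul D n _ _).mul _).trans ?_
    rw [mul_assoc, ← eE_succ]
    exact ((dl_succ D n _).symm).mul _

theorem F_rel (htw : IsTwistor D p q) (r : R) :
    FF K p q * (sn (oo (betaF D p q r)) 1 - sn (oo 1) (alphaF D p q r)) ∈ IA α β (0 + 2) := by
  obtain ⟨G, hG, -⟩ := htw.2.2 H H (Algebra.lmul K H) (Algebra.lmul K H)
  have h1 := hG ((betaF D p q r) ⊗ₜ[K] (1 : H) - (1 : H) ⊗ₜ[K] (alphaF D p q r))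
  have h2 : (Submodule.Quotient.mk ((betaF D p q r) ⊗ₜ[K] (1 : H) - (1 : H) ⊗ₜ[K]
      (alphaF D p q r)) : (H ⊗[K] H) ⧸ modRel K (alphaF D p q) (betaF D p q) (Algebra.lmul K H)
        (Algebra.lmul K H)) = 0 := by
    rw [Submodule.Quotient.mk_eq_zero]
    exact Submodule.subset_span ⟨r, 1, 1, by simp⟩
  rw [h2, map_zero] at h1
  have h3 := (Submodule.Quotient.mk_eq_zero _).1 h1.symm
  have h4 : modRel K (fun a => α a) (fun a => β a) (Algebra.lmul K H) (Algebra.lmul K H) ≤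
      IA α β (0 + 2) := by
    refine Submodule.span_le.2 ?_
    rintro z ⟨r, m, m', rfl⟩
    exact idl_seam (n := 0) (αf := fun a => α a) (βf := fun a => β a) r (oo m) m'
  have h5 := h4 h3
  have h6 : FF K p q * (sn (oo (betaF D p q r)) 1 - sn (oo 1) (alphaF D p q r)) =
      ∑ c, (show TP K H (0 + 2) from
        (TensorProduct.map (Algebra.lmul K H (p c)) (Algebra.lmul K H (q c)))
        ((betaF D p q r) ⊗ₜ[K] (1 : H) - (1 : H) ⊗ₜ[K] (alphaF D p q r))) := by
    rw [FF, Finset.sum_mul]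
    refine Finset.sum_congr rfl fun c _ => ?_
    rw [mul_sub, sn_mul, sn_mul]
    exact (map_sub (TensorProduct.map (Algebra.lmul K H (p c)) (Algebra.lmul K H (q c)))
      ((betaF D p q r) ⊗ₜ[K] (1 : H)) ((1 : H) ⊗ₜ[K] (alphaF D p q r))).symm
  rw [h6]
  exact h5

theorem eE_idl (htw : IsTwistor D p q) : ∀ {n : ℕ} {Z : TP K H (n + 1)},
    Z ∈ Idl K H (alphaF D p q) (betaF D p q) (n + 1) → eE D p q (n + 1) * Z ∈ IA α β (n + 1) := by
  intro n
  induction n with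
  | zero =>
    intro Z hZ
    rw [idl_one, Submodule.mem_bot] at hZ
    rw [hZ, mul_zero]; exact zero_mem _
  | succ n ih =>
    intro Z hZ
    refine (idl_le (U := (IA α β (n + 2)).comap (LinearMap.mulLeft K (eE D p q (n + 2)))) ?_ ?_) hZ
    · intro Z hZ h
      rw [Submodule.mem_comap, LinearMap.mulLeft_apply, eE_succ, mul_assoc, sn_mul]
      exact dmap_sn_idl D _ (ih hZ) _
    · intro r X h
      rw [Submodule.mem_comap, LinearMap.mulLeft_apply, mul_sub, eE_succ, mul_assoc, mul_assoc,
        sn_mul, sn_mul, one_mul, one_mul, ← mul_assoc (eE D p q (n + 1))]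
      have h1 := dmap_sn_CG D (FF K p q) ((eE_betaF D htw n r).mul X) h
      rw [mul_assoc (dl D n (betaF D p q r))] at h1
      generalize eE D p q (n + 1) * X = Y at *
      have h2 : ∀ W : TP K H (0 + 2), CA α β (n + 2)
          (dmap D n W * sn (dl D n (betaF D p q r) * Y) h)
          (dmap D n (W * sn (oo (betaF D p q r)) 1) * sn Y h) := by
        intro W
        refine ind2 (P := fun W => CA α β (n + 2)
          (dmap D n W * sn (dl D n (betaF D p q r) * Y) h)
          (dmap D n (W * sn (oo (betaF D p q r)) 1) * sn Y h)) ?_ ?_ W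
        · intro X Y hX hY
          rw [map_add, add_mul, add_mul, map_add, add_mul]; exact hX.add hY
        · intro u v
          rw [dmap_sn, sn_mul, sn_mul, ← map_mul, mul_one, dmap_sn, sn_mul, ← mul_assoc]
          exact ((dl_mul D u _).symm.mul Y).sn _
      have h3 : ∀ W : TP K H (0 + 2), dmap D n W * sn Y (alphaF D p q r * h) =
          dmap D n (W * sn (oo 1) (alphaF D p q r)) * sn Y h := by
        intro W
        refine ind2 (P := fun W => dmap D n W * sn Y (alphaF D p q r * h) =
          dmap D n (W * sn (oo 1) (alphaF D p q r)) * sn Y h) ?_ ?_ W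
        · intro X Y hX hY
          rw [map_add, add_mul, add_mul, map_add, add_mul, hX, hY]
        · intro u v
          rw [dmap_sn, sn_mul, sn_mul, ← map_mul, mul_one, dmap_sn, sn_mul, ← mul_assoc v]
      rw [h3]
      refine (h1.trans (h2 _)).trans ?_
      have h4 := idl_mul (dmap_idl D n (F_rel D htw r)) (sn Y h)
      rwa [mul_sub, map_sub, sub_mul] at h4

end Aux5

section Aux6

variable {K : Type u} [Field K] [CharZero K]
variable {H : Type u} [Ring H] [Algebra K H]
variable {R : Type u} [Ring R] [Algebra K R]
variable {α : R →ₐ[K] H} {β : R →ₗ[K] H}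

/-- quotient of `TP` by `IA`. -/
abbrev QA (α : R →ₐ[K] H) (β : R →ₗ[K] H) (n : ℕ) : Type u :=
  QT K H (fun a => α a) (fun a => β a) n

abbrev mA (α : R →ₐ[K] H) (β : R →ₗ[K] H) (n : ℕ) : TP K H n →ₗ[K] QA α β n :=
  qtMk K H (fun a => α a) (fun a => β a) n

theorem mA_surj {n : ℕ} (z : QA α β n) : ∃ Z, mA α β n Z = z := Submodule.mkQ_surjective _ z

theorem mA_eq {n : ℕ} {X Y : TP K H n} (h : CA α β n X Y) : mA α β n X = mA α β n Y :=
  CG_iff.1 h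

variable (D : HopfAlgebroid K H R α β)

/-- action of `H` on the quotient, one element. -/
def rhoE (n : ℕ) (x : H) : QA α β (n + 1) →ₗ[K] QA α β (n + 1) :=
  Submodule.mapQ _ _ (LinearMap.mulLeft K (dl D n x)) (fun _ hZ => dl_idl D x hZ)

theorem rhoE_mk (n : ℕ) (x : H) (Z : TP K H (n + 1)) :
    rhoE D n x (mA α β (n + 1) Z) = mA α β (n + 1) (dl D n x * Z) := rfl

/-- action of `H` on the quotient. -/
def rho (n : ℕ) : H →ₐ[K] Module.End K (QA α β (n + 1)) :=
  AlgHom.ofLinearMap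
    { toFun := rhoE D n
      map_add' := fun x y => by
        refine LinearMap.ext fun z => ?_
        obtain ⟨Z, rfl⟩ := mA_surj z
        rw [LinearMap.add_apply, rhoE_mk, rhoE_mk, rhoE_mk, map_add, add_mul, map_add]
      map_smul' := fun x y => by
        refine LinearMap.ext fun z => ?_
        obtain ⟨Z, rfl⟩ := mA_surj z
        rw [LinearMap.smul_apply, rhoE_mk, rhoE_mk, map_smul, smul_mul_assoc, map_smul,
          RingHom.id_apply] }
    (by
      refine LinearMap.ext fun z => ?_
      obtain ⟨Z, rfl⟩ := mA_surj z
      have := mA_eq ((dl_unit D n).mul Z)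
      rw [one_mul] at this
      exact this)
    (fun x y => by
      refine LinearMap.ext fun z => ?_
      obtain ⟨Z, rfl⟩ := mA_surj z
      have := mA_eq ((dl_mul D (n := n) x y).mul Z)
      rw [mul_assoc] at this
      exact this)

theorem rho_mk (n : ℕ) (x : H) (Z : TP K H (n + 1)) :
    rho D n x (mA α β (n + 1) Z) = mA α β (n + 1) (dl D n x * Z) := rfl

/-- The relations of `M₁ ⊗_R H` with `M₁` the tensor power. -/
abbrev mr (αf βf : R → H) (n : ℕ) : Submodule K (QA α β (n + 1) ⊗[K] H) :=
  modRel K αf βf (rho D n) (Algebra.lmul K H)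

/-- `sn` on the quotient. -/
def lamE (α : R →ₐ[K] H) (β : R →ₗ[K] H) (n : ℕ) :
    (QA α β (n + 1) ⊗[K] H) →ₗ[K] QA α β (n + 2) :=
  TensorProduct.lift (Submodule.liftQ _ ((sn (n := n)).compr₂ (mA α β (n + 2))) (by
    intro Z hZ
    refine LinearMap.ext fun h => ?_
    exact (Submodule.Quotient.mk_eq_zero _).2 (idl_sn hZ h)))

theorem lamE_mk (n : ℕ) (X : TP K H (n + 1)) (h : H) :
    lamE α β n (mA α β (n + 1) X ⊗ₜ[K] h) = mA α β (n + 2) (sn X h) := rfl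

theorem dl_betaR (n : ℕ) (r : R) : CA α β (n + 1) (dl D n (β r)) (slotP K H (n + 1) n (β r)) := by
  have h := dl_mul_β D (n := n) 1 r
  rw [one_mul] at h
  have h2 := (dl_unit D n).mul (slotP K H (n + 1) n (β r))
  rw [one_mul] at h2
  exact h.trans h2

theorem lamE_mr (n : ℕ) : mr D (fun a => α a) (fun a => β a) n ≤ LinearMap.ker (lamE α β n) := by
  refine Submodule.span_le.2 ?_
  rintro z ⟨r, m, h, rfl⟩
  obtain ⟨X, rfl⟩ := mA_surj m
  rw [SetLike.mem_coe, LinearMap.mem_ker, map_sub, rho_mk, lamE_mk, sub_eq_zero]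
  refine Eq.trans (mA_eq ?_) (lamE_mk n X (α r * h)).symm
  exact (((dl_betaR D n r).mul X).sn h).trans (CG.seam r X h)

/-- `B`. -/
def BE (α : R →ₐ[K] H) (β : R →ₗ[K] H) (n : ℕ) : TP K H (n + 2) →ₗ[K] QA α β (n + 1) ⊗[K] H :=
  snLift ((TensorProduct.mk K (QA α β (n + 1)) H).comp (mA α β (n + 1)))

theorem BE_sn (n : ℕ) (X : TP K H (n + 1)) (h : H) :
    BE α β n (sn X h) = mA α β (n + 1) X ⊗ₜ[K] h := snLift_sn _ _ _

theorem lam_BE (n : ℕ) (Z : TP K H (n + 2)) : lamE α β n (BE α β n Z) = mA α β (n + 2) Z := by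
  refine sn_ind (P := fun Z => lamE α β n (BE α β n Z) = mA α β (n + 2) Z) ?_ ?_ Z
  · intro X Y hX hY
    rw [map_add, map_add, hX, hY, map_add]
  · intro X h
    rw [BE_sn, lamE_mk]

theorem BE_idl (n : ℕ) : IA α β (n + 2) ≤
    (mr D (fun a => α a) (fun a => β a) n).comap (BE α β n) := by
  refine idl_le ?_ ?_
  · intro Z hZ h
    rw [Submodule.mem_comap, BE_sn,
      show mA α β (n + 1) Z = 0 from (Submodule.Quotient.mk_eq_zero _).2 hZ, TensorProduct.zero_tmul]
    exact zero_mem _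
  · intro r X h
    rw [Submodule.mem_comap, map_sub, BE_sn, BE_sn]
    refine Submodule.subset_span ⟨r, mA α β (n + 1) X, h, ?_⟩
    rw [rho_mk, mA_eq ((dl_betaR D n r).mul X)]
    rfl

/-- Every element of `M₁ ⊗ H` is in the image of `BE`. -/
theorem BE_surj (n : ℕ) (w : QA α β (n + 1) ⊗[K] H) : ∃ Z, BE α β n Z = w := by
  induction w using TensorProduct.induction_on with
  | zero => exact ⟨0, map_zero _⟩
  | tmul m h =>
    obtain ⟨X, rfl⟩ := mA_surj m
    exact ⟨sn X h, BE_sn n X h⟩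
  | add x y hx hy =>
    obtain ⟨X, rfl⟩ := hx
    obtain ⟨Y, rfl⟩ := hy
    exact ⟨X + Y, map_add _ _ _⟩

theorem lamE_inj (n : ℕ) (w : QA α β (n + 1) ⊗[K] H) (hw : lamE α β n w = 0) :
    w ∈ mr D (fun a => α a) (fun a => β a) n := by
  obtain ⟨Z, rfl⟩ := BE_surj n w
  rw [lam_BE] at hw
  exact BE_idl D n ((Submodule.Quotient.mk_eq_zero _).1 hw)

variable {C : ℕ} {p q : Fin C → H}

/-- quotient of `TP` by the twisted ideal. -/
abbrev QF (D : HopfAlgebroid K H R α β) {C : ℕ} (p q : Fin C → H) (n : ℕ) : Type u :=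
  QT K H (alphaF D p q) (betaF D p q) n

abbrev mF (D : HopfAlgebroid K H R α β) {C : ℕ} (p q : Fin C → H) (n : ℕ) :
    TP K H n →ₗ[K] QF D p q n :=
  qtMk K H (alphaF D p q) (betaF D p q) n

theorem mF_surj {n : ℕ} (z : QF D p q n) : ∃ Z, mF D p q n Z = z := Submodule.mkQ_surjective _ z

/-- The maps `F♯` in positive degree. -/
def fs (htw : IsTwistor D p q) (n : ℕ) : QF D p q (n + 1) →ₗ[K] QA α β (n + 1) :=
  Submodule.mapQ _ _ (LinearMap.mulLeft K (eE D p q (n + 1))) (fun _ hZ => eE_idl D htw hZ)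

theorem fs_mk (htw : IsTwistor D p q) (n : ℕ) (Z : TP K H (n + 1)) :
    fs D htw n (mF D p q (n + 1) Z) = mA α β (n + 1) (eE D p q (n + 1) * Z) := rfl

theorem fs_zero (htw : IsTwistor D p q) : Function.Bijective (fs D htw 0) := by
  constructor
  · rw [injective_iff_map_eq_zero]
    intro z hz
    obtain ⟨Z, rfl⟩ := mF_surj D z
    rw [fs_mk, eE_one, one_mul] at hz
    have := (Submodule.Quotient.mk_eq_zero _).1 hz
    rw [idl_one, Submodule.mem_bot] at this
    rw [this, map_zero]
  · intro z
    obtain ⟨Z, rfl⟩ := mA_surj z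
    exact ⟨mF D p q (0 + 1) Z, by rw [fs_mk, eE_one, one_mul]⟩

/-- `A`. -/
def AE (D : HopfAlgebroid K H R α β) {C : ℕ} (p q : Fin C → H) (n : ℕ) :
    TP K H (n + 2) →ₗ[K] QA α β (n + 1) ⊗[K] H :=
  snLift ((TensorProduct.mk K (QA α β (n + 1)) H).comp
    ((mA α β (n + 1)).comp (LinearMap.mulLeft K (eE D p q (n + 1)))))

theorem AE_sn (n : ℕ) (X : TP K H (n + 1)) (h : H) :
    AE D p q n (sn X h) = mA α β (n + 1) (eE D p q (n + 1) * X) ⊗ₜ[K] h := snLift_sn _ _ _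

theorem AE_surj (htw : IsTwistor D p q) (n : ℕ) (hb : Function.Bijective (fs D htw n))
    (w : QA α β (n + 1) ⊗[K] H) : ∃ Z, AE D p q n Z = w := by
  induction w using TensorProduct.induction_on with
  | zero => exact ⟨0, map_zero _⟩
  | tmul m h =>
    obtain ⟨x, rfl⟩ := hb.2 m
    obtain ⟨X, rfl⟩ := mF_surj D x
    exact ⟨sn X h, AE_sn D n X h⟩
  | add x y hx hy =>
    obtain ⟨X, rfl⟩ := hx
    obtain ⟨Y, rfl⟩ := hy
    exact ⟨X + Y, map_add _ _ _⟩

/-- `sn` on the twisted quotient. -/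
def snF (D : HopfAlgebroid K H R α β) {C : ℕ} (p q : Fin C → H) (n : ℕ) :
    QF D p q (n + 1) →ₗ[K] H →ₗ[K] QF D p q (n + 2) :=
  Submodule.liftQ _ ((sn (n := n)).compr₂ (mF D p q (n + 2))) (by
    intro Z hZ
    refine LinearMap.ext fun h => ?_
    exact (Submodule.Quotient.mk_eq_zero _).2 (idl_sn hZ h))

theorem snF_mk (n : ℕ) (X : TP K H (n + 1)) (h : H) :
    snF D p q n (mF D p q (n + 1) X) h = mF D p q (n + 2) (sn X h) := rfl

/-- the twisted `lamE`. -/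
def lamF (htw : IsTwistor D p q) (n : ℕ) (hb : Function.Bijective (fs D htw n)) :
    (QA α β (n + 1) ⊗[K] H) →ₗ[K] QF D p q (n + 2) :=
  TensorProduct.lift ((snF D p q n).comp (LinearEquiv.ofBijective (fs D htw n) hb).symm.toLinearMap)

theorem lamF_mk (htw : IsTwistor D p q) (n : ℕ) (hb : Function.Bijective (fs D htw n))
    (X : TP K H (n + 1)) (h : H) :
    lamF D htw n hb (mA α β (n + 1) (eE D p q (n + 1) * X) ⊗ₜ[K] h) = mF D p q (n + 2) (sn X h) := by
  have h1 : (LinearEquiv.ofBijective (fs D htw n) hb).symm (mA α β (n + 1) (eE D p q (n + 1) * X)) =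
      mF D p q (n + 1) X := by
    rw [LinearEquiv.symm_apply_eq]; rfl
  refine (TensorProduct.lift.tmul _ _).trans ?_
  refine (congrArg (fun z => snF D p q n z h) h1).trans ?_
  exact snF_mk D n X h

theorem lamF_mr (htw : IsTwistor D p q) (n : ℕ) (hb : Function.Bijective (fs D htw n)) :
    mr D (alphaF D p q) (betaF D p q) n ≤ LinearMap.ker (lamF D htw n hb) := by
  refine Submodule.span_le.2 ?_
  rintro z ⟨r, m, h, rfl⟩
  obtain ⟨x, rfl⟩ := hb.2 m
  obtain ⟨X, rfl⟩ := mF_surj D x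
  rw [SetLike.mem_coe, LinearMap.mem_ker, map_sub, fs_mk, rho_mk, sub_eq_zero, ← mul_assoc,
    ← mA_eq ((eE_betaF D htw n r).mul X), mul_assoc, lamF_mk]
  refine Eq.trans ?_ (lamF_mk D htw n hb X (alphaF D p q r * h)).symm
  exact CG_iff.1 (CG.seam r X h)

theorem lamF_AE (htw : IsTwistor D p q) (n : ℕ) (hb : Function.Bijective (fs D htw n))
    (Z : TP K H (n + 2)) : lamF D htw n hb (AE D p q n Z) = mF D p q (n + 2) Z := by
  refine sn_ind (P := fun Z => lamF D htw n hb (AE D p q n Z) = mF D p q (n + 2) Z) ?_ ?_ Z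
  · intro X Y hX hY
    rw [map_add, map_add, hX, hY, map_add]
  · intro X h
    rw [AE_sn, lamF_mk]

theorem lamE_AE (n : ℕ) (Z : TP K H (n + 2)) :
    lamE α β n (∑ c, TensorProduct.map (rho D n (p c)) (Algebra.lmul K H (q c)) (AE D p q n Z)) =
      mA α β (n + 2) (eE D p q (n + 2) * Z) := by
  refine sn_ind (P := fun Z => lamE α β n (∑ c, TensorProduct.map (rho D n (p c))
    (Algebra.lmul K H (q c)) (AE D p q n Z)) = mA α β (n + 2) (eE D p q (n + 2) * Z)) ?_ ?_ Z
  · intro X Y hX hY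
    rw [mul_add, map_add (mA α β (n + 2)), ← hX, ← hY, ← map_add, ← Finset.sum_add_distrib,
      map_add (AE D p q n)]
    simp only [map_add]
  · intro X h
    rw [AE_sn, map_sum, eE_succ, mul_assoc, sn_mul, one_mul, FF, map_sum, Finset.sum_mul, map_sum]
    refine Finset.sum_congr rfl fun c _ => ?_
    rw [TensorProduct.map_tmul, rho_mk, dmap_sn, sn_mul, lamE_mk]
    rfl

theorem fs_succ (htw : IsTwistor D p q) (n : ℕ) (hb : Function.Bijective (fs D htw n)) :
    Function.Bijective (fs D htw (n + 1)) := by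
  obtain ⟨G, hG, hGb⟩ := htw.2.2 (QA α β (n + 1)) H (rho D n) (Algebra.lmul K H)
  constructor
  · rw [injective_iff_map_eq_zero]
    intro z hz
    obtain ⟨Z, rfl⟩ := mF_surj D z
    have h1 : mA α β (n + 2) (eE D p q (n + 2) * Z) = 0 := hz
    rw [← lamE_AE] at h1
    have h2 := lamE_inj D n _ h1
    have h3 := hG (AE D p q n Z)
    rw [(Submodule.Quotient.mk_eq_zero _).2 h2] at h3
    have h4 := (injective_iff_map_eq_zero G).1 hGb.1 _ h3
    have h5 := lamF_mr D htw n hb ((Submodule.Quotient.mk_eq_zero _).1 h4)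
    rw [LinearMap.mem_ker, lamF_AE] at h5
    exact h5
  · intro z
    obtain ⟨Y, rfl⟩ := mA_surj z
    obtain ⟨w, hw⟩ := hGb.2 (Submodule.Quotient.mk (BE α β n Y))
    obtain ⟨w, rfl⟩ := Submodule.Quotient.mk_surjective _ w
    obtain ⟨Z, rfl⟩ := AE_surj D htw n hb w
    rw [hG] at hw
    have h1 := lamE_mr D n ((Submodule.Quotient.eq _).1 hw)
    rw [LinearMap.mem_ker, map_sub, lam_BE, lamE_AE, sub_eq_zero] at h1
    exact ⟨mF D p q (n + 2) Z, h1⟩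

theorem fs_bij (htw : IsTwistor D p q) : ∀ n : ℕ, Function.Bijective (fs D htw n)
  | 0 => fs_zero D htw
  | n + 1 => fs_succ D htw n (fs_bij htw n)

end Aux6

section Aux7

variable {K : Type u} [Field K] [CharZero K]
variable {H : Type u} [Ring H] [Algebra K H]
variable {R : Type u} [Ring R] [Algebra K R]
variable {α : R →ₐ[K] H} {β : R →ₗ[K] H}
variable (D : HopfAlgebroid K H R α β) {C : ℕ} {p q : Fin C → H}

/-- The inverse of `fs`. -/
def fsE (htw : IsTwistor D p q) (n : ℕ) : QF D p q (n + 1) ≃ₗ[K] QA α β (n + 1) :=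
  LinearEquiv.ofBijective (fs D htw n) (fs_bij D htw n)

theorem fsE_mk (htw : IsTwistor D p q) (n : ℕ) (Z : TP K H (n + 1)) :
    fsE D htw n (mF D p q (n + 1) Z) = mA α β (n + 1) (eE D p q (n + 1) * Z) := rfl

/-- The twisted iterated coproducts. -/
def dpF (htw : IsTwistor D p q) (n : ℕ) : H →ₗ[K] QF D p q (n + 1) :=
  (fsE D htw n).symm.toLinearMap.comp
    ((mA α β (n + 1)).comp ((LinearMap.mulRight K (eE D p q (n + 1))).comp (dl D n)))

theorem dpF_spec (htw : IsTwistor D p q) (n : ℕ) (x : H) :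
    fsE D htw n (dpF D htw n x) = mA α β (n + 1) (dl D n x * eE D p q (n + 1)) :=
  (fsE D htw n).apply_symm_apply _

theorem dpF_iff (htw : IsTwistor D p q) (n : ℕ) (x : H) (Z : TP K H (n + 1)) :
    mF D p q (n + 1) Z = dpF D htw n x ↔
      CA α β (n + 1) (eE D p q (n + 1) * Z) (dl D n x * eE D p q (n + 1)) := by
  rw [← (fsE D htw n).injective.eq_iff, dpF_spec, fsE_mk, CA, CG_iff]

theorem dpF_iter (htw : IsTwistor D p q) :
    IsIteratedOn (alphaF D p q) (betaF D p q) (dpF D htw 1) (dpF D htw) := by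
  refine ⟨?_, rfl, ?_⟩
  · intro x
    refine ((dpF_iff D htw 0 x (oo x)).2 ?_).symm
    rw [eE_one, one_mul, mul_one]
    exact CG.refl _
  · intro n x C' uu vv h s hs
    refine ((dpF_iff D htw (n + 1) x _).2 ?_).symm
    have h0 : CA α β (0 + 2) (FF K p q * ∑ c, sn (oo (uu c)) (vv c)) (dl D 1 x * FF K p q) := by
      have := (dpF_iff D htw 1 x (∑ c, sn (n := 0) (oo (uu c)) (vv c))).1 h
      rw [show eE D p q (1 + 1) = FF K p q from eE_two D] at this
      exact this
    have hs' := fun c => (dpF_iff D htw n (uu c) (s c)).1 (hs c)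
    have e1 : eE D p q (n + 2) * (∑ c, sn (s c) (vv c)) =
        ∑ c, dmap D n (FF K p q) * sn (eE D p q (n + 1) * s c) (vv c) := by
      rw [Finset.mul_sum]
      refine Finset.sum_congr rfl fun c _ => ?_
      rw [eE_succ, mul_assoc, sn_mul, one_mul]
    refine CG.trans (CG.of_eq e1) ?_
    have e2 : ∀ c, CA α β (n + 2) (dmap D n (FF K p q) * sn (eE D p q (n + 1) * s c) (vv c))
        (dmap D n (FF K p q) * dmap D n (sn (oo (uu c)) (vv c)) * sn (eE D p q (n + 1)) 1) := by
      intro c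
      refine (dmap_sn_CG D _ (hs' c) _).trans (CG.of_eq ?_)
      rw [dmap_sn, mul_assoc, sn_mul, mul_one]
    refine (CG.sum fun c _ => e2 c).trans ?_
    rw [← Finset.sum_mul, ← Finset.mul_sum, ← map_sum]
    refine ((dmap_mul D n _ _).symm.mul _).trans ?_
    refine ((CG.map (dmap_idl D n) h0).mul _).trans ?_
    refine ((dmap_mul D n _ _).mul _).trans ?_
    rw [mul_assoc, ← eE_succ]
    exact ((dl_succ D n x).symm).mul _

theorem eE_echain : IsEChain D p q (eE D p q) := by
  refine ⟨rfl, ?_, ?_⟩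
  · exact congrArg (mA α β (0 + 2)) (eE_two D)
  · intro n CP ZP h
    refine CG_iff.1 ?_
    have e1 : (∑ c, ∑ d : Fin (CP c), chainP K H (n + 2) (Fin.snoc (ZP c d) (q c))) =
        ∑ c, sn (∑ d : Fin (CP c), chainP K H (n + 1) (ZP c d)) (q c) := by
      refine Finset.sum_congr rfl fun c _ => ?_
      rw [map_sum, LinearMap.sum_apply]
      refine Finset.sum_congr rfl fun d _ => ?_
      rw [chain_succ]
      simp
    rw [e1]
    refine CG.mul ?_ (sn (eE D p q (n + 1)) 1)
    rw [FF, map_sum]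
    refine CG.sum fun c _ => ?_
    rw [dmap_sn]
    exact ((CA_of_spec D (h c)).symm).sn _

/-- The family `F♯`. -/
def Fsh (htw : IsTwistor D p q) : ∀ n : ℕ, PH K H (alphaF D p q) (betaF D p q) n →ₗ[K]
    PH K H (fun a => α a) (fun a => β a) n
  | 0 => (LinearMap.id : R →ₗ[K] R)
  | n + 1 => fs D htw n

theorem Fsh_bij (htw : IsTwistor D p q) : ∀ n : ℕ, Function.Bijective (Fsh D htw n)
  | 0 => Function.bijective_id
  | n + 1 => fs_bij D htw n

theorem Fsh_sharp (htw : IsTwistor D p q) : IsFSharp D p q (eE D p q) (Fsh D htw) :=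
  ⟨fun _ => rfl, fun _ _ => rfl⟩

theorem Fsh_delta (htw : IsTwistor D p q) (x : H) (s : TP K H 2) (h : qmk K H α β 2 s = D.Δ x) :
    Fsh D htw 2 (dpF D htw 1 x) =
      qmk K H α β 2 (s * (show TP K H 2 from ∑ c, p c ⊗ₜ[K] q c)) := by
  refine (dpF_spec D htw 1 x).trans ?_
  refine Eq.trans (congrArg (fun Z => mA α β 2 (dl D 1 x * Z)) (eE_two D)) ?_
  exact CG_iff.1 ((CA_of_spec1 D h).symm.mul _)

theorem Fsh_one (htw : IsTwistor D p q) (h : H) :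
    Fsh D htw 1 (qtMk K H (alphaF D p q) (betaF D p q) 1 h) = qmk K H α β 1 h :=
  congrArg (mA α β (0 + 1)) (one_mul (oo (K := K) h))

theorem Fsh_two (htw : IsTwistor D p q) :
    Fsh D htw 2 (qtMk K H (alphaF D p q) (betaF D p q) 2 1) =
        qmk K H α β 2 (∑ c, (p c ⊗ₜ[K] q c : TP K H 2)) :=
  congrArg (mA α β (0 + 2)) ((mul_one _).trans (eE_two D))

end Aux7

section Aux8

variable {K : Type u} [Field K] [CharZero K]
variable {H : Type u} [Ring H] [Algebra K H]
variable {R : Type u} [Ring R] [Algebra K R]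
variable {α : R →ₐ[K] H} {β : R →ₗ[K] H}
variable (D : HopfAlgebroid K H R α β) {C : ℕ} {p q : Fin C → H}

theorem nm_eq (n m : ℕ) : m + n + 1 = n + (m + 1) := by omega

/-- Partial composition on the level of tensors. -/
def cmT (n m i : ℕ) : TP K H (n + 1) →ₗ[K] TP K H (m + 1) →ₗ[K] TP K H (n + (m + 1)) :=
  ((LinearMap.mul K (TP K H (m + n + 1))).compl₁₂ (DI D m i n) (IX m i n (fun _ => 1))).compr₂
    (tc (nm_eq n m)).toLinearMap

theorem cmT_apply (n m i : ℕ) (X : TP K H (n + 1)) (Y : TP K H (m + 1)) :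
    cmT D n m i X Y = tc (nm_eq n m) (DI D m i n X * IX m i n (fun _ => 1) Y) := rfl

theorem cmT_CG (n m i : ℕ) (hi : i < n + 1) {X X' : TP K H (n + 1)} {Y Y' : TP K H (m + 1)}
    (hX : CA α β (n + 1) X X') (hY : CA α β (m + 1) Y Y') :
    CA α β (n + (m + 1)) (cmT D n m i X Y) (cmT D n m i X' Y') := by
  rw [cmT_apply, cmT_apply]
  refine tc_CG _ ?_
  exact (DI_IX_idl D i hi X _ hY).trans ((CG.map (DI_idl D i) hX).mul _)

abbrev sA (α : R →ₐ[K] H) (β : R →ₗ[K] H) (n : ℕ) : QA α β n →ₗ[K] TP K H n :=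
  sec (fun a => α a) (fun a => β a) n

theorem sA_mk {n : ℕ} (X : TP K H n) : CA α β n (sA α β n (mA α β n X)) X :=
  CG_iff.2 (sec_spec _ _ _ _)

/-- Partial composition, positive degrees. -/
def cmQ (n m i : ℕ) : QA α β (n + 1) →ₗ[K] QA α β (m + 1) →ₗ[K] QA α β (n + (m + 1)) :=
  ((cmT D n m i).compr₂ (mA α β (n + (m + 1)))).compl₁₂ (sA α β (n + 1)) (sA α β (m + 1))

theorem cmQ_mk (n m i : ℕ) (hi : i < n + 1) (X : TP K H (n + 1)) (Y : TP K H (m + 1)) :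
    cmQ D n m i (mA α β (n + 1) X) (mA α β (m + 1) Y) = mA α β (n + (m + 1)) (cmT D n m i X Y) :=
  mA_eq (cmT_CG D n m i hi (sA_mk X) (sA_mk Y))

/-- Insertion of degree zero, on tensors. -/
def czT (n i : ℕ) : TP K H (n + 2) →ₗ[K] R →ₗ[K] TP K H (n + 1) :=
  ((LinearMap.mul K (TP K H (n + 2))).compl₂ ((slL i (n + 1)).comp α.toLinearMap)).compr₂ (EC D i n)

theorem czT_apply (n i : ℕ) (X : TP K H (n + 2)) (a : R) :
    czT D n i X a = EC D i n (X * slotP K H (n + 2) i (α a)) := by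
  rw [← slL_eq i (n + 1)]; rfl

/-- Insertion of degree zero. -/
def czQ (n i : ℕ) : QA α β (n + 2) →ₗ[K] R →ₗ[K] QA α β (n + 1) :=
  ((czT D n i).compr₂ (mA α β (n + 1))).comp (sA α β (n + 2))

theorem czQ_mk (n i : ℕ) (X : TP K H (n + 2)) (a : R) :
    czQ D n i (mA α β (n + 2) X) a = mA α β (n + 1) (EC D i n (X * slotP K H (n + 2) i (α a))) := by
  rw [← czT_apply]
  refine mA_eq ?_
  rw [czT_apply, czT_apply]
  exact CG.map (EC_idl D i) ((sA_mk X).mul _)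

/-- Insertion of degree zero in degree one. -/
def c0Q : QA α β (0 + 1) →ₗ[K] R →ₗ[K] R :=
  (((LinearMap.mul K H).compl₂ α.toLinearMap).compr₂ D.ε).comp
    ((oo (K := K) (H := H)).symm.toLinearMap.comp (sA α β (0 + 1)))

theorem c0Q_mk (h : H) (a : R) : c0Q D (mA α β (0 + 1) (oo h)) a = D.ε (h * α a) := by
  have h1 : sA α β (0 + 1) (mA α β (0 + 1) (oo h)) = oo h := (sA_mk _).eq_one
  have h2 : c0Q D (mA α β (0 + 1) (oo h)) a =
    D.ε (oo.symm (sA α β (0 + 1) (mA α β (0 + 1) (oo h))) * α a) := rfl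
  rw [h2, h1, AlgEquiv.symm_apply_apply]

/-- Partial compositions of `P_H`. -/
def cR (n m : ℕ) (i : Fin (n + 1)) : PH K H (fun a => α a) (fun a => β a) (n + 1) →ₗ[K]
    PH K H (fun a => α a) (fun a => β a) m →ₗ[K] PH K H (fun a => α a) (fun a => β a) (n + m) :=
  match m, n with
  | m + 1, n => cmQ D n m i
  | 0, 0 => c0Q D
  | 0, n + 1 => czQ D n i

theorem tc_IX (n m : ℕ) (i : Fin (n + 1)) (x : Fin (n + 1) → H) (b : Fin (m + 1) → H) :
    tc (nm_eq n m) (IX m i n x (chainP K H (m + 1) b)) =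
      chainP K H (n + (m + 1)) (insChain i x b) := by
  rw [IX_chain (i : ℕ) i.isLt x b (nm_eq n m).symm, tc_chain]
  rfl

theorem tc_IX_sum (n m : ℕ) (i : Fin (n + 1)) (x : Fin (n + 1) → H) (y : Fin (m + 1) → H)
    {C' : ℕ} (z : Fin C' → Fin (m + 1) → H) :
    tc (nm_eq n m) (IX m i n x ((∑ c, chainP K H (m + 1) (z c)) * chainP K H (m + 1) y)) =
      ∑ c, chainP K H (n + (m + 1)) (insChain i x (fun t => z c t * y t)) := by
  rw [Finset.sum_mul, map_sum, map_sum]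
  refine Finset.sum_congr rfl fun c _ => ?_
  rw [chain_mul, tc_IX]

theorem IX_mul_r {m n : ℕ} (i : ℕ) (x : Fin (n + 1) → H) (S S' : TP K H (m + 1)) :
    IX m i n x S * IX m i n (fun _ => 1) S' = IX m i n x (S * S') := by
  rw [IX_mul]; simp only [mul_one]

theorem IX_mul_l {m n : ℕ} (i : ℕ) (x : Fin (n + 1) → H) (S S' : TP K H (m + 1)) :
    IX m i n (fun _ => 1) S * IX m i n x S' = IX m i n x (S * S') := by
  rw [IX_mul]; simp only [one_mul]

theorem cmT_chain (n m : ℕ) (i : Fin (n + 1)) (x : Fin (n + 1) → H) (y : Fin (m + 1) → H)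
    {C' : ℕ} (z : Fin C' → Fin (m + 1) → H)
    (hz : CA α β (m + 1) (∑ c, chainP K H (m + 1) (z c)) (dl D m (x i))) :
    CA α β (n + (m + 1)) (cmT D n m i (chainP K H (n + 1) x) (chainP K H (m + 1) y))
      (∑ c, chainP K H (n + (m + 1)) (insChain i x (fun t => z c t * y t))) := by
  rw [← tc_IX_sum, cmT_apply, DI_chain D (i : ℕ) i.isLt x, IX_mul_r]
  exact tc_CG _ (IX_CG _ _ ((hz.symm).mul _))

theorem cmT_chainF (htw : IsTwistor D p q) (n m : ℕ) (i : Fin (n + 1)) (x : Fin (n + 1) → H)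
    (y : Fin (m + 1) → H) {C' : ℕ} (z : Fin C' → Fin (m + 1) → H)
    (hz : CA α β (m + 1) (eE D p q (m + 1) * ∑ c, chainP K H (m + 1) (z c))
      (dl D m (x i) * eE D p q (m + 1))) :
    CA α β (n + (m + 1)) (cmT D n m i (eE D p q (n + 1) * chainP K H (n + 1) x)
        (eE D p q (m + 1) * chainP K H (m + 1) y))
      (eE D p q (n + (m + 1)) *
        ∑ c, chainP K H (n + (m + 1)) (insChain i x (fun t => z c t * y t))) := by
  rw [← tc_IX_sum, cmT_apply, ← tc_fam (nm_eq n m) (eE D p q), ← map_mul (tc (nm_eq n m))]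
  refine tc_CG _ ?_
  refine ((DI_mul D (i : ℕ) _ _).mul _).trans ?_
  rw [DI_chain D (i : ℕ) i.isLt x, mul_assoc, IX_mul_r, ← mul_assoc (dl D m _)]
  have h1 := (hz.mul (chainP K H (m + 1) y)).symm
  rw [mul_assoc (eE D p q (m + 1))] at h1
  refine (DI_IX_idl D (i : ℕ) i.isLt _ x h1).trans ?_
  rw [← IX_mul_l, ← mul_assoc]
  exact ((eE_ins D htw m n i i.isLt).symm).mul _

theorem cR_comp : IsCompOn (fun a => α a) (fun a => β a) (fun h a => D.hAct h a) D.Δpow (cR D) := by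
  refine ⟨?_, ?_, ?_⟩
  · intro n m i x y C' z hz
    refine (cmQ_mk D n m i i.isLt _ _).trans (mA_eq ?_)
    exact cmT_chain D n m i x y z (CA_of_spec D hz)
  · intro i h a
    exact c0Q_mk D h a
  · intro n i x a
    refine (czQ_mk D n i _ a).trans (mA_eq ?_)
    have := contr D (αf := fun a => α a) (βf := fun a => β a) (eps_α D) (eps_β D) (n := n)
      (E := 1) (E' := 1) (by
        intro i c hi
        refine Submodule.subset_span ⟨c, i, 1, by omega, ?_⟩
        rw [one_mul, one_mul, mul_one, relator])
      (fun i _ => CG.of_eq (EC_unit D i)) (i : ℕ) i.isLt x (α a) _ rfl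
    rw [one_mul, one_mul] at this
    exact this

/-- `F♯` as an equivalence. -/
def FshE (htw : IsTwistor D p q) (n : ℕ) : PH K H (alphaF D p q) (betaF D p q) n ≃ₗ[K]
    PH K H (fun a => α a) (fun a => β a) n :=
  LinearEquiv.ofBijective (Fsh D htw n) (Fsh_bij D htw n)

/-- Partial compositions of the twisted operad. -/
def cF (htw : IsTwistor D p q) (n m : ℕ) (i : Fin (n + 1)) :
    PH K H (alphaF D p q) (betaF D p q) (n + 1) →ₗ[K]
    PH K H (alphaF D p q) (betaF D p q) m →ₗ[K] PH K H (alphaF D p q) (betaF D p q) (n + m) :=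
  ((cR D n m i).compl₁₂ (Fsh D htw (n + 1)) (Fsh D htw m)).compr₂
    (FshE D htw (n + m)).symm.toLinearMap

theorem cF_spec (htw : IsTwistor D p q) (n m : ℕ) (i : Fin (n + 1))
    (h : PH K H (alphaF D p q) (betaF D p q) (n + 1)) (u : PH K H (alphaF D p q) (betaF D p q) m) :
    Fsh D htw (n + m) (cF D htw n m i h u) = cR D n m i (Fsh D htw (n + 1) h) (Fsh D htw m u) :=
  (FshE D htw (n + m)).apply_symm_apply _

theorem cF_eq (htw : IsTwistor D p q) (n m : ℕ) (i : Fin (n + 1))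
    (h : PH K H (alphaF D p q) (betaF D p q) (n + 1)) (u : PH K H (alphaF D p q) (betaF D p q) m)
    (z : PH K H (alphaF D p q) (betaF D p q) (n + m))
    (hz : cR D n m i (Fsh D htw (n + 1) h) (Fsh D htw m u) = Fsh D htw (n + m) z) :
    cF D htw n m i h u = z :=
  (Fsh_bij D htw (n + m)).1 ((cF_spec D htw n m i h u).trans hz)

theorem cF_comp (htw : IsTwistor D p q) : IsCompOn (alphaF D p q) (betaF D p q)
    (fun h a => D.ε (h * alphaF D p q a)) (dpF D htw) (cF D htw) := by
  have heps : ∀ (x : H) (a : R), D.ε (x * alphaF D p q a) = D.ε (x * α a) := fun x a =>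
    eps_congr D x (by rw [eps_alphaF D htw, eps_α])
  refine ⟨?_, ?_, ?_⟩
  · intro n m i x y C' z hz
    refine cF_eq D htw n (m + 1) i _ _ _ ?_
    refine (cmQ_mk D n m i i.isLt (eE D p q (n + 1) * chainP K H (n + 1) x)
      (eE D p q (m + 1) * chainP K H (m + 1) y)).trans (mA_eq ?_)
    exact cmT_chainF D htw n m i x y z ((dpF_iff D htw m (x i) _).1 hz)
  · intro i h a
    refine cF_eq D htw 0 0 i _ _ _ ?_
    have h1 : Fsh D htw (0 + 1) (qtMk K H (alphaF D p q) (betaF D p q) 1 h) =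
      mA α β (0 + 1) (oo h) := Fsh_one D htw h
    rw [h1]
    exact (c0Q_mk D h a).trans (heps h a).symm
  · intro n i x a
    refine cF_eq D htw (n + 1) 0 i _ _ _ ?_
    refine (czQ_mk D n i (eE D p q (n + 2) * chainP K H (n + 2) x) a).trans (mA_eq ?_)
    refine contr D (αf := alphaF D p q) (βf := betaF D p q) (eps_alphaF D htw) (eps_betaF D htw)
      (n := n) (E := eE D p q (n + 2)) (E' := eE D p q (n + 1)) ?_ (eE_contr D htw n)
      (i : ℕ) i.isLt x (α a) _ (heps _ _).symm
    intro i c hi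
    have := eE_idl D htw (n := n + 1) (Z := relator K H (alphaF D p q) (betaF D p q) (n + 2) c i)
      (Submodule.subset_span ⟨c, i, 1, by omega, by rw [mul_one]⟩)
    rwa [relator, mul_sub] at this

end Aux8

/-! ### STATEMENT 15 -/

/-- **`F♯` is an isomorphism of operads `P_{H_F} ≅ P_H` sending `1 ⊗_{R_F} 1` to `F`.**
Let `F = Σ_c (p c) ⊗_R (q c)` be a twistor of the Hopf algebroid `H` and `H_F` the
twisted Hopf algebroid over `R_F`.  The maps
`F♯ₙ : P_{H_F}(n) → P_H(n)`, `x₁ ⊗_{R_F} ⋯ ⊗_{R_F} x_n ↦ F{F{⋯F{x₁,x₂}⋯}, x_n}`, are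
`K`-linear bijections, `F♯₁` is the identity of `H`, `F♯` intertwines the operadic
compositions (in partial-composition form), and `F♯(1 ⊗_{R_F} 1) = F`. -/
theorem FSharp_operad_isomorphism
    (K : Type u) [Field K] [CharZero K]
    (H : Type u) [Ring H] [Algebra K H]
    (R : Type u) [Ring R] [Algebra K R]
    (α : R →ₐ[K] H) (β : R →ₗ[K] H)
    (D : HopfAlgebroid K H R α β)
    (C : ℕ) (p q : Fin C → H) (htw : IsTwistor D p q) :
    ∃ (e : ∀ n : ℕ, TP K H n)
      (Fs : ∀ n : ℕ, PH K H (alphaF D p q) (betaF D p q) n →ₗ[K]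
          PH K H (fun a => α a) (fun a => β a) n)
      (ΔF : H →ₗ[K] QT K H (alphaF D p q) (betaF D p q) 2)
      (ΔpF : ∀ n : ℕ, H →ₗ[K] QT K H (alphaF D p q) (betaF D p q) (n + 1))
      (compR : ∀ n m : ℕ, Fin (n + 1) →
          (PH K H (fun a => α a) (fun a => β a) (n + 1) →ₗ[K]
            PH K H (fun a => α a) (fun a => β a) m →ₗ[K]
            PH K H (fun a => α a) (fun a => β a) (n + m)))
      (compF : ∀ n m : ℕ, Fin (n + 1) →
          (PH K H (alphaF D p q) (betaF D p q) (n + 1) →ₗ[K]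
            PH K H (alphaF D p q) (betaF D p q) m →ₗ[K]
            PH K H (alphaF D p q) (betaF D p q) (n + m))),
      IsEChain D p q e ∧ IsFSharp D p q e Fs ∧
      -- `Δ_F(x) = (F♯)⁻¹(Δ(x) · F)` and its iterates
      (∀ (x : H) (s : TP K H 2), qmk K H α β 2 s = D.Δ x →
        Fs 2 (ΔF x) = qmk K H α β 2 (s * (show TP K H 2 from ∑ c, p c ⊗ₜ[K] q c))) ∧
      IsIteratedOn (alphaF D p q) (betaF D p q) ΔF ΔpF ∧
      -- the operadic partial compositions of `P_H` and of `P_{H_F}`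
      IsCompOn (fun a => α a) (fun a => β a) (fun h a => D.hAct h a) D.Δpow compR ∧
      IsCompOn (alphaF D p q) (betaF D p q) (fun h a => D.ε (h * alphaF D p q a))
        ΔpF compF ∧
      -- each `F♯ₙ` is a `K`-linear bijection
      (∀ n : ℕ, Function.Bijective (Fs n)) ∧
      -- `F♯₁` is the identity of `H`
      (∀ h : H, Fs 1 (qtMk K H (alphaF D p q) (betaF D p q) 1 h) = qmk K H α β 1 h) ∧
      -- `F♯(1 ⊗_{R_F} 1) = F`
      (Fs 2 (qtMk K H (alphaF D p q) (betaF D p q) 2 1) =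
        qmk K H α β 2 (∑ c, (p c ⊗ₜ[K] q c : TP K H 2))) ∧
      -- `F♯` intertwines the operadic compositions
      (∀ (n m : ℕ) (i : Fin (n + 1))
          (h : PH K H (alphaF D p q) (betaF D p q) (n + 1))
          (u : PH K H (alphaF D p q) (betaF D p q) m),
        Fs (n + m) (compF n m i h u) = compR n m i (Fs (n + 1) h) (Fs m u)) := by
  exact ⟨eE D p q, Fsh D htw, dpF D htw 1, dpF D htw, cR D, cF D htw,
    eE_echain D, Fsh_sharp D htw, Fsh_delta D htw, dpF_iter D htw, cR_comp D, cF_comp D htw,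
    Fsh_bij D htw, Fsh_one D htw, Fsh_two D htw, cF_spec D htw⟩
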